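/- As n → ∞, ln( α([3]^n) / 2^{N(3,n)} ) divided by ( √((1 + 2√2)/(2√2·π)) · n^{−1/2} · ((1 + 2√2)/2)^n ) tends to 1, where N(3,n) is the size of the middle layer of [3]^n, i.e. the number of n-tuples x ∈ {0,1,2}^n with Σᵢ xᵢ = n, and ln denotes the natural logarithm. (Jenssen–Park–Sarantis theorem: sharp asymptotics for the number of antichains in [3]^n.) -/

import Mathlib

open Filter

/-- The number of antichains in the poset `[t]^n` (n-tuples of elements of
`{0,…,t−1}` with the pointwise order). -/
noncomputable def alphaT (t n : ℕ) : ℕ :=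
  Nat.card {A : Finset (Fin n → Fin t) // IsAntichain (· ≤ ·) (A : Set (Fin n → Fin t))}

/-- `N(3,n)`: the size of the middle layer of `[3]^n`, i.e. the number of
`x ∈ {0,1,2}^n` with coordinate sum `n`. -/
def midLayer3 (n : ℕ) : ℕ :=
  Fintype.card {x : Fin n → Fin 3 // ∑ i, (x i : ℕ) = n}

namespace AntichainCount

set_option linter.unusedSectionVars false

section Linked
variable {X : Type} [DecidableEq X]

/-- `U` is connected with respect to the relation `H`. -/
def Linked (H : X → X → Prop) (U : Finset X) : Prop :=
  ∀ x ∈ U, ∀ y ∈ U, Relation.ReflTransGen (fun a b => a ∈ U ∧ b ∈ U ∧ H a b) x y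

lemma Linked.exists_cross {H : X → X → Prop} {U U' : Finset X} (hU : Linked H U)
    (hsub : U' ⊆ U) {x₀ : X} (hx₀ : x₀ ∈ U') (hne : U' ≠ U) :
    ∃ a ∈ U', ∃ b ∈ U, b ∉ U' ∧ H a b := by
  obtain ⟨y, hyU, hyU'⟩ : ∃ y ∈ U, y ∉ U' := by
    by_contra! h
    exact hne (Finset.Subset.antisymm hsub h)
  have hpath := hU x₀ (hsub hx₀) y hyU
  by_contra! hno
  have : ∀ z, Relation.ReflTransGen (fun a b => a ∈ U ∧ b ∈ U ∧ H a b) x₀ z → z ∈ U' := by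
    intro z hz
    induction hz with
    | refl => exact hx₀
    | tail _ h ih =>
      by_contra hc
      exact hno _ ih _ h.2.1 hc h.2.2
  exact hyU' (this y hpath)

lemma Linked.exists_list {H : X → X → Prop} (hsymm : ∀ a b, H a b → H b a) {U : Finset X}
    (hU : Linked H U) {x₀ : X} (hx₀ : x₀ ∈ U) :
    ∃ l : List X, (x₀ :: l).IsChain H ∧ l.length = 2 * (U.card - 1) ∧
      (x₀ :: l).toFinset = U := by
  suffices h : ∀ k < U.card, ∃ l : List X, (x₀ :: l).IsChain H ∧ l.length = 2 * k ∧
      (x₀ :: l).toFinset ⊆ U ∧ (x₀ :: l).toFinset.card = k + 1 by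
    have hpos : 0 < U.card := Finset.card_pos.mpr ⟨x₀, hx₀⟩
    obtain ⟨l, h1, h2, h3, h4⟩ := h (U.card - 1) (by omega)
    exact ⟨l, h1, h2, Finset.eq_of_subset_of_card_le h3 (by omega)⟩
  intro k
  induction k with
  | zero =>
    intro _
    refine ⟨[], by simp, rfl, ?_, by simp⟩
    simpa using hx₀
  | succ k ih =>
    intro hk
    obtain ⟨l, h1, h2, h3, h4⟩ := ih (by omega)
    have hne : (x₀ :: l).toFinset ≠ U := by
      intro h
      rw [h] at h4
      omega
    obtain ⟨a, ha, b, hb, hbn, hab⟩ := hU.exists_cross h3 (x₀ := x₀) (by simp) hne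
    rw [List.mem_toFinset] at ha
    obtain ⟨l₁, l₂, hl⟩ := List.append_of_mem ha
    have hins : ∃ l' : List X, l₁ ++ a :: b :: a :: l₂ = x₀ :: l' := by
      cases l₁ with
      | nil =>
        simp only [List.nil_append, List.cons.injEq] at hl
        exact ⟨b :: a :: l₂, by simp [hl.1]⟩
      | cons c l₁ =>
        simp only [List.cons_append, List.cons.injEq] at hl
        exact ⟨l₁ ++ a :: b :: a :: l₂, by simp [hl.1]⟩
    obtain ⟨l', hl'⟩ := hins
    have hset : (x₀ :: l').toFinset = insert b (x₀ :: l).toFinset := by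
      rw [← hl', hl]
      ext z
      simp only [List.mem_toFinset, List.mem_append, List.mem_cons, Finset.mem_insert]
      tauto
    refine ⟨l', ?_, ?_, ?_, ?_⟩
    · rw [← hl']
      rw [hl, List.isChain_split] at h1
      rw [List.isChain_split]
      exact ⟨h1.1, List.IsChain.cons_cons hab (List.IsChain.cons_cons (hsymm _ _ hab) h1.2)⟩
    · have e1 := congrArg List.length hl'
      have e2 := congrArg List.length hl
      simp at e1 e2
      omega
    · rw [hset]
      exact Finset.insert_subset hb h3
    · rw [hset, Finset.card_insert_of_notMem hbn, h4]

/-- Walks of a given length along the neighbourhood map `nb`, without their starting point. -/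
def walks (nb : X → Finset X) : ℕ → X → Finset (List X)
  | 0, _ => {[]}
  | k + 1, x => (nb x).biUnion fun y => (walks nb k y).image (List.cons y)

lemma card_walks_le {nb : X → Finset X} {Δ : ℕ} (hΔ : ∀ x, (nb x).card ≤ Δ) (k : ℕ) (x : X) :
    (walks nb k x).card ≤ Δ ^ k := by
  induction k generalizing x with
  | zero => simp [walks]
  | succ k ih =>
    calc (walks nb (k + 1) x).card ≤ ∑ y ∈ nb x, ((walks nb k y).image (List.cons y)).card :=
          Finset.card_biUnion_le
      _ ≤ ∑ _y ∈ nb x, Δ ^ k := Finset.sum_le_sum fun y _ => Finset.card_image_le.trans (ih y)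
      _ = (nb x).card * Δ ^ k := by simp
      _ ≤ Δ ^ (k + 1) := by rw [pow_succ']; exact Nat.mul_le_mul_right _ (hΔ x)

lemma mem_walks {H : X → X → Prop} {nb : X → Finset X} (hnb : ∀ x y, H x y → y ∈ nb x)
    (l : List X) (x : X) (h : (x :: l).IsChain H) : l ∈ walks nb l.length x := by
  induction l generalizing x with
  | nil => simp [walks]
  | cons y l ih =>
    rw [List.isChain_cons_cons] at h
    simp only [List.length_cons, walks, Finset.mem_biUnion, Finset.mem_image]
    exact ⟨y, hnb _ _ h.1, l, ih y h.2, rfl⟩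

/-- The number of linked sets of size `s` through a given point. -/
lemma card_linked_le {H : X → X → Prop} (hsymm : ∀ a b, H a b → H b a) {nb : X → Finset X}
    (hnb : ∀ x y, H x y → y ∈ nb x) {Δ : ℕ} (hΔ : ∀ x, (nb x).card ≤ Δ) (x₀ : X) (s : ℕ)
    (𝓕 : Finset (Finset X)) (h𝓕 : ∀ U ∈ 𝓕, x₀ ∈ U ∧ Linked H U ∧ U.card = s) :
    𝓕.card ≤ Δ ^ (2 * (s - 1)) := by
  refine le_trans (Finset.card_le_card (t := (walks nb (2 * (s - 1)) x₀).image
    fun l => (x₀ :: l).toFinset) ?_) (Finset.card_image_le.trans (card_walks_le hΔ _ _))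
  intro U hU
  obtain ⟨h1, h2, h3⟩ := h𝓕 U hU
  obtain ⟨l, hl, hlen, hset⟩ := h2.exists_list hsymm h1
  rw [Finset.mem_image]
  exact ⟨l, by rw [← h3, ← hlen]; exact mem_walks hnb l x₀ hl, hset⟩

lemma card_linked_le' {H : X → X → Prop} (hsymm : ∀ a b, H a b → H b a) {nb : X → Finset X}
    (hnb : ∀ x y, H x y → y ∈ nb x) {Δ : ℕ} (hΔ : ∀ x, (nb x).card ≤ Δ) (hΔ2 : 2 ≤ Δ)
    (x₀ : X) (m : ℕ)
    (𝓕 : Finset (Finset X)) (h𝓕 : ∀ U ∈ 𝓕, x₀ ∈ U ∧ Linked H U ∧ U.card ≤ m) :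
    𝓕.card ≤ Δ ^ (2 * m) := by
  have h1 : 𝓕.card = ∑ s ∈ Finset.range m, (𝓕.filter fun U => U.card - 1 = s).card := by
    refine Finset.card_eq_sum_card_fiberwise (f := fun U : Finset X => U.card - 1) ?_
    intro U hU
    obtain ⟨h1, _, h3⟩ := h𝓕 U hU
    have : 0 < U.card := Finset.card_pos.mpr ⟨x₀, h1⟩
    simp only [Finset.coe_range, Set.mem_Iio]
    omega
  rw [h1]
  calc ∑ s ∈ Finset.range m, (𝓕.filter fun U => U.card - 1 = s).card
      ≤ ∑ s ∈ Finset.range m, (Δ ^ 2) ^ s := by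
        refine Finset.sum_le_sum fun s _ => ?_
        have := card_linked_le hsymm hnb hΔ x₀ (s + 1) (𝓕.filter fun U => U.card - 1 = s) ?_
        · rwa [Nat.add_sub_cancel, pow_mul] at this
        · intro U hU
          rw [Finset.mem_filter] at hU
          obtain ⟨h1, h2, _⟩ := h𝓕 U hU.1
          have : 0 < U.card := Finset.card_pos.mpr ⟨x₀, h1⟩
          exact ⟨h1, h2, by omega⟩
    _ ≤ Δ ^ (2 * m) := by
        rw [pow_mul]
        exact (Nat.geomSum_lt (n := m) (by nlinarith) (fun k hk => Finset.mem_range.mp hk)).le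

end Linked

/-- The number of small subsets of a finite set. -/
lemma card_subsets_le {X : Type} [DecidableEq X] (Ω : Finset X) (M lam : ℝ) (hlam : 0 ≤ lam)
    (𝓕 : Finset (Finset X)) (h𝓕 : ∀ B ∈ 𝓕, B ⊆ Ω ∧ (B.card : ℝ) ≤ M) :
    (𝓕.card : ℝ) ≤ Real.exp (Real.exp (-lam) * Ω.card + lam * M) := by
  have h1 : ∑ B ∈ Ω.powerset, Real.exp (-lam) ^ B.card = (Real.exp (-lam) + 1) ^ Ω.card := by
    have := Finset.sum_pow_mul_eq_add_pow (Real.exp (-lam)) 1 Ω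
    simpa using this
  have h2 : (𝓕.card : ℝ) * Real.exp (-(lam * M)) ≤ (Real.exp (-lam) + 1) ^ Ω.card := by
    rw [← h1]
    calc (𝓕.card : ℝ) * Real.exp (-(lam * M)) = ∑ B ∈ 𝓕, Real.exp (-(lam * M)) := by simp
      _ ≤ ∑ B ∈ 𝓕, Real.exp (-lam) ^ B.card := by
          refine Finset.sum_le_sum fun B hB => ?_
          rw [← Real.exp_nat_mul]
          apply Real.exp_le_exp.mpr
          have := mul_le_mul_of_nonneg_left (h𝓕 B hB).2 hlam
          linarith
      _ ≤ _ := Finset.sum_le_sum_of_subset_of_nonneg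
          (fun B hB => Finset.mem_powerset.mpr (h𝓕 B hB).1) (fun _ _ _ => by positivity)
  have h3 : (Real.exp (-lam) + 1) ^ Ω.card ≤ Real.exp (Real.exp (-lam) * Ω.card) := by
    rw [mul_comm, Real.exp_nat_mul]
    exact pow_le_pow_left₀ (by positivity) (Real.add_one_le_exp _) _
  rw [Real.exp_add]
  have h4 := h2.trans h3
  rw [Real.exp_neg, ← div_eq_mul_inv, div_le_iff₀ (Real.exp_pos _)] at h4
  exact h4

/-- Averaging over a random subset: a sparse set of small cost that meets almost all of the
large sets `W y`. -/
lemma exists_sparse_hitting {Y : Type} [DecidableEq Y] (G Good : Finset Y) (W : Y → Finset Y)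
    (c : Y → ℝ) (p K M : ℝ) (hp0 : 0 ≤ p) (hp1 : p ≤ 1) (hK : 0 ≤ K)
    (hW : ∀ y ∈ Good, W y ⊆ G) (hM : ∀ y ∈ Good, M ≤ (W y).card) :
    ∃ T ⊆ G, ∑ y ∈ T, c y + K * (Good.filter fun y => Disjoint T (W y)).card ≤
      p * ∑ y ∈ G, c y + K * (Good.card * Real.exp (-(p * M))) := by
  classical
  set w : Finset Y → ℝ := fun T => (∏ _i ∈ T, p) * ∏ _i ∈ G \ T, (1 - p) with hw
  have hw0 : ∀ T, 0 ≤ w T := fun T =>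
    mul_nonneg (Finset.prod_nonneg fun _ _ => hp0)
      (Finset.prod_nonneg fun _ _ => by linarith)
  have hsum : ∑ T ∈ G.powerset, w T = 1 := by
    rw [hw, ← Finset.prod_add]
    simp
  have hmem : ∀ y ∈ G, ∑ T ∈ G.powerset, w T * (if y ∈ T then 1 else 0) = p := by
    intro y hy
    have h := Finset.prod_add (fun _ : Y => p) (fun i => if i = y then 0 else 1 - p) G
    have h2 : ∏ i ∈ G, (p + if i = y then 0 else 1 - p) = p := by
      rw [Finset.prod_eq_single_of_mem y hy]
      · simp
      · intro b _ hb
        simp [hb]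
    rw [h2] at h
    rw [h]
    refine Finset.sum_congr rfl fun T hT => ?_
    by_cases hyT : y ∈ T
    · simp only [hyT, if_true, mul_one, hw]
      congr 1
      refine Finset.prod_congr rfl fun i hi => ?_
      have : i ≠ y := by
        rintro rfl
        exact (Finset.mem_sdiff.mp hi).2 hyT
      simp [this]
    · simp only [hyT, if_false, mul_zero]
      rw [Finset.prod_eq_zero (i := y) (s := G \ T) (Finset.mem_sdiff.mpr ⟨hy, hyT⟩) (by simp)]
      simp
  have hdisj : ∀ y ∈ Good, ∑ T ∈ G.powerset, w T * (if Disjoint T (W y) then 1 else 0)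
      ≤ Real.exp (-(p * M)) := by
    intro y hy
    have h := Finset.prod_add (fun i : Y => if i ∈ W y then 0 else p) (fun _ => 1 - p) G
    have h2 : ∏ i ∈ G, ((if i ∈ W y then 0 else p) + (1 - p)) = (1 - p) ^ (W y).card := by
      rw [← Finset.prod_sdiff (hW y hy)]
      rw [Finset.prod_eq_one (s := G \ W y), one_mul, Finset.prod_congr rfl (g := fun _ => 1 - p)]
      · simp
      · intro i hi
        simp [hi]
      · intro i hi
        simp [(Finset.mem_sdiff.mp hi).2]
    rw [h2] at h
    have h3 : ∑ T ∈ G.powerset, w T * (if Disjoint T (W y) then 1 else 0)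
        = (1 - p) ^ (W y).card := by
      rw [h]
      refine Finset.sum_congr rfl fun T hT => ?_
      by_cases hd : Disjoint T (W y)
      · simp only [hd, if_true, mul_one, hw]
        congr 1
        refine Finset.prod_congr rfl fun i hi => ?_
        simp [Finset.disjoint_left.mp hd hi]
      · simp only [hd, if_false, mul_zero]
        rw [Finset.not_disjoint_iff] at hd
        obtain ⟨i, hiT, hiW⟩ := hd
        rw [Finset.prod_eq_zero (i := i) hiT (by simp [hiW])]
        simp
    rw [h3]
    calc (1 - p) ^ (W y).card ≤ Real.exp (-p) ^ (W y).card :=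
          pow_le_pow_left₀ (by linarith) (by linarith [Real.add_one_le_exp (-p)]) _
      _ = Real.exp (-(p * (W y).card)) := by rw [← Real.exp_nat_mul]; ring_nf
      _ ≤ Real.exp (-(p * M)) := by
          apply Real.exp_le_exp.mpr
          have := mul_le_mul_of_nonneg_left (hM y hy) hp0
          linarith
  by_contra! hcon
  set cost : Finset Y → ℝ := fun T =>
    ∑ y ∈ T, c y + K * (Good.filter fun y => Disjoint T (W y)).card with hcost
  have hE : ∑ T ∈ G.powerset, w T * cost T ≤
      p * ∑ y ∈ G, c y + K * (Good.card * Real.exp (-(p * M))) := by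
    have e1 : ∑ T ∈ G.powerset, w T * ∑ y ∈ T, c y = p * ∑ y ∈ G, c y := by
      have : ∀ T ∈ G.powerset, w T * ∑ y ∈ T, c y
          = ∑ y ∈ G, c y * (w T * (if y ∈ T then 1 else 0)) := by
        intro T hT
        have hs : ∑ y ∈ T, c y = ∑ y ∈ G, if y ∈ T then c y else 0 := by
          rw [← Finset.sum_filter, Finset.filter_mem_eq_inter,
            Finset.inter_eq_right.mpr (Finset.mem_powerset.mp hT)]
        rw [hs, Finset.mul_sum]
        refine Finset.sum_congr rfl fun y _ => ?_
        split_ifs <;> ring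
      rw [Finset.sum_congr rfl this, Finset.sum_comm, Finset.mul_sum]
      refine Finset.sum_congr rfl fun y hy => ?_
      rw [← Finset.mul_sum, hmem y hy, mul_comm]
    have e2 : ∑ T ∈ G.powerset, w T * (Good.filter fun y => Disjoint T (W y)).card
        ≤ Good.card * Real.exp (-(p * M)) := by
      have : ∀ T ∈ G.powerset, w T * ((Good.filter fun y => Disjoint T (W y)).card : ℝ)
          = ∑ y ∈ Good, w T * (if Disjoint T (W y) then 1 else 0) := by
        intro T _
        rw [← Finset.mul_sum, Finset.sum_boole]
      rw [Finset.sum_congr rfl this, Finset.sum_comm]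
      calc _ ≤ ∑ y ∈ Good, Real.exp (-(p * M)) := Finset.sum_le_sum hdisj
        _ = _ := by simp
    calc ∑ T ∈ G.powerset, w T * cost T
        = ∑ T ∈ G.powerset, w T * ∑ y ∈ T, c y
          + K * ∑ T ∈ G.powerset, w T * (Good.filter fun y => Disjoint T (W y)).card := by
          rw [Finset.mul_sum, ← Finset.sum_add_distrib]
          refine Finset.sum_congr rfl fun T _ => ?_
          simp only [hcost]
          ring
      _ ≤ _ := by
          rw [e1]
          gcongr
  have hlt : (p * ∑ y ∈ G, c y + K * (Good.card * Real.exp (-(p * M))))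
      < ∑ T ∈ G.powerset, w T * cost T := by
    obtain ⟨T₀, hT₀, hw₀⟩ : ∃ T ∈ G.powerset, 0 < w T := by
      by_contra! h
      have := Finset.sum_nonpos h
      rw [hsum] at this
      linarith
    calc (p * ∑ y ∈ G, c y + K * (Good.card * Real.exp (-(p * M))))
        = ∑ T ∈ G.powerset, w T * (p * ∑ y ∈ G, c y + K * (Good.card * Real.exp (-(p * M)))) := by
          rw [← Finset.sum_mul, hsum, one_mul]
      _ < _ := Finset.sum_lt_sum
          (fun T hT => mul_le_mul_of_nonneg_left (hcon T (Finset.mem_powerset.mp hT)).le (hw0 T))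
          ⟨T₀, hT₀, mul_lt_mul_of_pos_left (hcon T₀ (Finset.mem_powerset.mp hT₀)) hw₀⟩
  linarith

section Bipartite
variable {X Y : Type} [Fintype X] [Fintype Y]

open Classical in
/-- Lower neighbourhood of a vertex. -/
noncomputable def dn (r : X → Y → Prop) (x : X) : Finset Y := Finset.univ.filter fun y => r x y

open Classical in
/-- Upper neighbourhood of a vertex. -/
noncomputable def up (r : X → Y → Prop) (y : Y) : Finset X := Finset.univ.filter fun x => r x y

open Classical in
/-- Lower neighbourhood of a set. -/
noncomputable def nbr (r : X → Y → Prop) (A : Finset X) : Finset Y :=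
  Finset.univ.filter fun y => ∃ x ∈ A, r x y

open Classical in
/-- Upper neighbourhood of a set. -/
noncomputable def upn (r : X → Y → Prop) (T : Finset Y) : Finset X :=
  Finset.univ.filter fun x => ∃ y ∈ T, r x y

open Classical in
/-- The vertices all of whose lower neighbours lie in `G`. -/
noncomputable def inner (r : X → Y → Prop) (G : Finset Y) : Finset X :=
  Finset.univ.filter fun x => dn r x ⊆ G

/-- Two upper vertices with a common lower neighbour. -/
def Adj2 (r : X → Y → Prop) (x x' : X) : Prop := ∃ y, r x y ∧ r x' y

variable {r : X → Y → Prop}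

@[simp] lemma mem_dn {x : X} {y : Y} : y ∈ dn r x ↔ r x y := by simp [dn]
@[simp] lemma mem_up {x : X} {y : Y} : x ∈ up r y ↔ r x y := by simp [up]
@[simp] lemma mem_nbr {A : Finset X} {y : Y} : y ∈ nbr r A ↔ ∃ x ∈ A, r x y := by simp [nbr]
@[simp] lemma mem_upn {T : Finset Y} {x : X} : x ∈ upn r T ↔ ∃ y ∈ T, r x y := by simp [upn]
@[simp] lemma mem_inner {G : Finset Y} {x : X} : x ∈ inner r G ↔ dn r x ⊆ G := by simp [inner]

lemma Adj2.symm {x x' : X} (h : Adj2 r x x') : Adj2 r x' x := by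
  obtain ⟨y, h1, h2⟩ := h
  exact ⟨y, h2, h1⟩

lemma nbr_mono {A B : Finset X} (h : A ⊆ B) : nbr r A ⊆ nbr r B := by
  intro y hy
  rw [mem_nbr] at *
  obtain ⟨x, hx, hxy⟩ := hy
  exact ⟨x, h hx, hxy⟩

lemma subset_inner_nbr (A : Finset X) : A ⊆ inner r (nbr r A) := by
  intro x hx
  rw [mem_inner]
  intro y hy
  exact mem_nbr.mpr ⟨x, hx, mem_dn.mp hy⟩

lemma nbr_inner_subset (G : Finset Y) : nbr r (inner r G) ⊆ G := by
  intro y hy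
  obtain ⟨x, hx, hxy⟩ := mem_nbr.mp hy
  exact mem_inner.mp hx (mem_dn.mpr hxy)

lemma nbr_inner_nbr (A : Finset X) : nbr r (inner r (nbr r A)) = nbr r A :=
  Finset.Subset.antisymm (nbr_inner_subset _) (nbr_mono (subset_inner_nbr A))

variable [DecidableEq X] [DecidableEq Y]

/-- The properties of the bipartite graph between two consecutive layers above the middle one
that are used for counting. -/
structure LayerGraph (r : X → Y → Prop) (n : ℕ) : Prop where
  deg_lower : ∀ x, (n : ℝ) / 2 ≤ (dn r x).card
  deg_upper : ∀ x, (dn r x).card ≤ n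
  up_upper : ∀ y, (up r y).card ≤ n
  up_le_dn : ∀ x y, r x y → (up r y).card ≤ (dn r x).card
  codeg : ∀ x x', x ≠ x' → (dn r x ∩ dn r x').card ≤ 1
  expand : ∀ A : Finset X, ((nbr r A).card : ℝ) ≤ 16 * n * ((nbr r A).card - A.card)
  edges : ∀ A : Finset X, ∑ x ∈ A, ((dn r x).card : ℝ) ≤
    (A.card + (nbr r A).card) * Real.logb 2 (A.card + (nbr r A).card)

namespace LayerGraph
variable {n : ℕ}

lemma deg_pos (h : LayerGraph r n) (hn : 0 < n) (x : X) : (0 : ℝ) < (dn r x).card := by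
  have := h.deg_lower x
  have : (0 : ℝ) < n := by exact_mod_cast hn
  linarith

lemma sum_swap (f : X → Y → ℝ) (A : Finset X) (G : Finset Y) :
    ∑ x ∈ A, ∑ y ∈ dn r x ∩ G, f x y = ∑ y ∈ G, ∑ x ∈ up r y ∩ A, f x y := by
  refine Finset.sum_comm' ?_
  intro x y
  simp only [Finset.mem_inter, mem_dn, mem_up]
  tauto

lemma sum_recv_le (h : LayerGraph r n) (A : Finset X) (y : Y) :
    ∑ x ∈ up r y ∩ A, (1 : ℝ) / (dn r x).card ≤ ((up r y ∩ A).card : ℝ) / (up r y).card := by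
  calc ∑ x ∈ up r y ∩ A, (1 : ℝ) / (dn r x).card
      ≤ ∑ x ∈ up r y ∩ A, (1 : ℝ) / (up r y).card := by
        refine Finset.sum_le_sum fun x hx => ?_
        have hx' := (Finset.mem_inter.mp hx).1
        have hpos : 0 < (up r y).card := Finset.card_pos.mpr ⟨x, hx'⟩
        apply one_div_le_one_div_of_le
        · exact_mod_cast hpos
        · exact_mod_cast h.up_le_dn x y (mem_up.mp hx')
    _ = _ := by rw [Finset.sum_const, nsmul_eq_mul]; ring

lemma sum_recv_le_one (h : LayerGraph r n) (A : Finset X) (y : Y) :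
    ∑ x ∈ up r y ∩ A, (1 : ℝ) / (dn r x).card ≤ 1 := by
  refine (h.sum_recv_le A y).trans ?_
  apply div_le_one_of_le₀
  · exact_mod_cast Finset.card_le_card Finset.inter_subset_left
  · positivity

lemma excess_eq (h : LayerGraph r n) (hn : 0 < n) (G : Finset Y) :
    ∑ y ∈ G, (1 - ∑ x ∈ up r y ∩ inner r G, (1 : ℝ) / (dn r x).card)
      = G.card - (inner r G).card := by
  rw [Finset.sum_sub_distrib, ← sum_swap (fun x _ => (1 : ℝ) / (dn r x).card)]
  congr 1
  · simp
  · rw [Finset.cast_card]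
    refine Finset.sum_congr rfl fun x hx => ?_
    rw [Finset.inter_eq_left.mpr (mem_inner.mp hx), Finset.sum_const, nsmul_eq_mul]
    exact mul_one_div_cancel (h.deg_pos hn x).ne'

/-- The number of edges leaving `inner G` from `G`. -/
lemma boundary_le (h : LayerGraph r n) (hn : 0 < n) (F : Finset X) :
    ∑ y ∈ nbr r F, ((up r y \ inner r (nbr r F)).card : ℝ) ≤
      n * ((nbr r F).card - (inner r (nbr r F)).card) := by
  rw [← h.excess_eq hn, Finset.mul_sum]
  refine Finset.sum_le_sum fun y hy => ?_
  set A := inner r (nbr r F)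
  obtain ⟨x, _, hxy⟩ := mem_nbr.mp hy
  have hpos : (0 : ℝ) < (up r y).card := by
    exact_mod_cast Finset.card_pos.mpr ⟨x, mem_up.mpr hxy⟩
  have h1 := h.sum_recv_le A y
  have h2 : ((up r y \ A).card : ℝ) + (up r y ∩ A).card = (up r y).card := by
    exact_mod_cast Finset.card_sdiff_add_card_inter (up r y) A
  have h3 : ((up r y).card : ℝ) ≤ n := by exact_mod_cast h.up_upper y
  have h4 : ((up r y \ A).card : ℝ) / (up r y).card
      ≤ 1 - ∑ x ∈ up r y ∩ A, (1 : ℝ) / (dn r x).card := by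
    have : ((up r y \ A).card : ℝ) / (up r y).card + ((up r y ∩ A).card : ℝ) / (up r y).card = 1 := by
      rw [← add_div, h2, div_self hpos.ne']
    linarith
  calc ((up r y \ A).card : ℝ) = (up r y).card * (((up r y \ A).card : ℝ) / (up r y).card) := by
        field_simp
    _ ≤ n * (((up r y \ A).card : ℝ) / (up r y).card) := by gcongr
    _ ≤ _ := by gcongr

/-- Few vertices of `G` have few neighbours in `inner G`. -/
lemma card_bad_le (h : LayerGraph r n) (hn : 0 < n) (G : Finset Y) (φ : ℝ) (hφ : φ ≤ n / 8)
    (B : Finset Y) (hBG : B ⊆ G) (hB : ∀ y ∈ B, ((up r y ∩ inner r G).card : ℝ) ≤ φ) :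
    (B.card : ℝ) ≤ 2 * (G.card - (inner r G).card) := by
  rw [← h.excess_eq hn]
  have hn' : (0 : ℝ) < n := by exact_mod_cast hn
  have h1 : ∀ y ∈ B, (1 : ℝ) / 2 ≤ 1 - ∑ x ∈ up r y ∩ inner r G, (1 : ℝ) / (dn r x).card := by
    intro y hy
    have : ∑ x ∈ up r y ∩ inner r G, (1 : ℝ) / (dn r x).card
        ≤ ∑ x ∈ up r y ∩ inner r G, (1 : ℝ) / (n / 2) :=
      Finset.sum_le_sum fun x _ => one_div_le_one_div_of_le (by positivity) (h.deg_lower x)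
    rw [Finset.sum_const, nsmul_eq_mul] at this
    have h2 : ((up r y ∩ inner r G).card : ℝ) * (1 / (n / 2)) ≤ n / 8 * (1 / (n / 2)) := by
      gcongr
      exact (hB y hy).trans hφ
    have h3 : (n : ℝ) / 8 * (1 / (n / 2)) = 1 / 4 := by field_simp; norm_num
    linarith
  have h2 : (B.card : ℝ) * (1 / 2) ≤
      ∑ y ∈ B, (1 - ∑ x ∈ up r y ∩ inner r G, (1 : ℝ) / (dn r x).card) := by
    have := Finset.sum_le_sum h1
    simpa using this
  have h3 := Finset.sum_le_sum_of_subset_of_nonneg hBG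
    (f := fun y => 1 - ∑ x ∈ up r y ∩ inner r G, (1 : ℝ) / (dn r x).card)
    (fun y _ _ => by linarith [h.sum_recv_le_one (inner r G) y])
  linarith

lemma card_le_of_missing (h : LayerGraph r n) (hn : 0 < n) (S : Finset X) (F : Finset Y) :
    (S.card : ℝ) ≤ F.card + 2 / n * ∑ x ∈ S, ((dn r x \ F).card : ℝ) := by
  have hn' : (0 : ℝ) < n := by exact_mod_cast hn
  have h1 : (S.card : ℝ) = ∑ x ∈ S, ∑ y ∈ dn r x ∩ F, (1 : ℝ) / (dn r x).card
      + ∑ x ∈ S, ((dn r x \ F).card : ℝ) / (dn r x).card := by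
    rw [← Finset.sum_add_distrib, Finset.cast_card]
    refine Finset.sum_congr rfl fun x _ => ?_
    rw [Finset.sum_const, nsmul_eq_mul, mul_one_div, ← add_div]
    have h2 : ((dn r x ∩ F).card : ℝ) + (dn r x \ F).card = (dn r x).card := by
      exact_mod_cast Finset.card_inter_add_card_sdiff (dn r x) F
    rw [h2, div_self (h.deg_pos hn x).ne']
  rw [h1, sum_swap, Finset.mul_sum]
  have h2 : ∑ y ∈ F, ∑ x ∈ up r y ∩ S, (1 : ℝ) / (dn r x).card ≤ F.card := by
    calc _ ≤ ∑ y ∈ F, (1 : ℝ) := Finset.sum_le_sum fun y _ => h.sum_recv_le_one S y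
      _ = _ := by simp
  have h3 : ∑ x ∈ S, ((dn r x \ F).card : ℝ) / (dn r x).card
      ≤ ∑ x ∈ S, 2 / n * ((dn r x \ F).card : ℝ) := by
    refine Finset.sum_le_sum fun x _ => ?_
    rw [div_eq_mul_one_div, mul_comm]
    refine mul_le_mul_of_nonneg_right ?_ (Nat.cast_nonneg _)
    calc (1 : ℝ) / (dn r x).card ≤ 1 / (n / 2) :=
          one_div_le_one_div_of_le (by positivity) (h.deg_lower x)
      _ = 2 / n := by field_simp
  linarith

lemma card_nbr_le (h : LayerGraph r n) (A : Finset X) : (nbr r A).card ≤ A.card * n := by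
  have : nbr r A = A.biUnion (dn r) := by ext y; simp
  rw [this]
  exact Finset.card_biUnion_le_card_mul _ _ _ fun x _ => h.deg_upper x

lemma card_upn_le (h : LayerGraph r n) (T : Finset Y) : (upn r T).card ≤ T.card * n := by
  have : upn r T = T.biUnion (up r) := by ext y; simp
  rw [this]
  exact Finset.card_biUnion_le_card_mul _ _ _ fun x _ => h.up_upper x

/-- The second neighbourhood of a vertex with many neighbours in `A` is large. -/
lemma card_second_nbr (h : LayerGraph r n) (B : Finset X) (y : Y) (hB : B ⊆ up r y) :
    (B.card : ℝ) * (n / 2 - 1) ≤ (nbr r B).card := by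
  have hsub : B.biUnion (fun x => (dn r x).erase y) ⊆ nbr r B := by
    intro z hz
    simp only [Finset.mem_biUnion, Finset.mem_erase, mem_dn] at hz
    obtain ⟨x, hx, _, hxz⟩ := hz
    exact mem_nbr.mpr ⟨x, hx, hxz⟩
  have hcard : (B.biUnion (fun x => (dn r x).erase y)).card
      = ∑ x ∈ B, ((dn r x).erase y).card := by
    apply Finset.card_biUnion
    intro x hx x' hx' hne
    rw [Function.onFun, Finset.disjoint_left]
    intro z hz hz'
    simp only [Finset.mem_erase, mem_dn] at hz hz'
    have h1 := h.codeg x x' hne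
    have h2 : ({y, z} : Finset Y) ⊆ dn r x ∩ dn r x' := by
      intro w hw
      simp only [Finset.mem_insert, Finset.mem_singleton] at hw
      rw [Finset.mem_inter, mem_dn, mem_dn]
      rcases hw with rfl | rfl
      · exact ⟨mem_up.mp (hB hx), mem_up.mp (hB hx')⟩
      · exact ⟨hz.2, hz'.2⟩
    have h3 := Finset.card_le_card h2
    rw [Finset.card_pair hz.1.symm] at h3
    omega
  have h1 : (B.card : ℝ) * (n / 2 - 1) ≤ ∑ x ∈ B, (((dn r x).erase y).card : ℝ) := by
    rw [← nsmul_eq_mul]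
    refine Finset.card_nsmul_le_sum _ _ _ fun x hx => ?_
    have := Finset.card_erase_add_one (mem_dn.mpr (mem_up.mp (hB hx)))
    have h4 : (((dn r x).erase y).card : ℝ) + 1 = (dn r x).card := by exact_mod_cast this
    linarith [h.deg_lower x]
  refine h1.trans ?_
  have := Finset.card_le_card hsub
  rw [hcard] at this
  exact_mod_cast this

end LayerGraph
end Bipartite

/-- A maximal packing of sets of weight at least one. -/
lemma exists_packing {X Y : Type} [DecidableEq X] [DecidableEq Y] (F : Finset X) (G : Finset Y)
    (B : X → Finset Y) (μ : Y → ℝ) (hμ : ∀ y, 0 ≤ μ y) (hBG : ∀ x ∈ F, B x ⊆ G)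
    (hB : ∀ x ∈ F, 1 ≤ ∑ y ∈ B x, μ y) :
    ∃ P ⊆ F, (P.card : ℝ) ≤ ∑ y ∈ G, μ y ∧ ∀ x ∈ F, ∃ u ∈ P, ¬ Disjoint (B x) (B u) := by
  classical
  obtain ⟨P, hP, hmax⟩ := Finset.exists_max_image
    (F.powerset.filter fun P : Finset X => (P : Set X).PairwiseDisjoint B) Finset.card
    ⟨∅, by simp⟩
  rw [Finset.mem_filter, Finset.mem_powerset] at hP
  refine ⟨P, hP.1, ?_, ?_⟩
  · calc (P.card : ℝ) = ∑ x ∈ P, (1 : ℝ) := by simp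
      _ ≤ ∑ x ∈ P, ∑ y ∈ B x, μ y := Finset.sum_le_sum fun x hx => hB x (hP.1 hx)
      _ = ∑ y ∈ P.biUnion B, μ y := (Finset.sum_biUnion hP.2).symm
      _ ≤ ∑ y ∈ G, μ y := Finset.sum_le_sum_of_subset_of_nonneg
          (Finset.biUnion_subset.mpr fun x hx => hBG x (hP.1 hx)) fun y _ _ => hμ y
  · intro x hx
    by_contra! hcon
    have hxP : x ∉ P := by
      intro hxP
      have h0 := hcon x hxP
      rw [disjoint_self, Finset.bot_eq_empty] at h0
      have := hB x hx
      rw [h0] at this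
      simp at this
      linarith
    have hmem : insert x P ∈ F.powerset.filter fun P : Finset X => (P : Set X).PairwiseDisjoint B := by
      rw [Finset.mem_filter, Finset.mem_powerset]
      refine ⟨Finset.insert_subset hx hP.1, ?_⟩
      rw [Finset.coe_insert]
      exact hP.2.insert fun u hu _ => hcon u hu
    have := hmax _ hmem
    rw [Finset.card_insert_of_notMem hxP] at this
    omega

section Bipartite
variable {X Y : Type} [Fintype X] [Fintype Y]

/-- The relation of being reachable in a given number of steps of `Adj2`. -/
def Reach (r : X → Y → Prop) : ℕ → X → X → Prop
  | 0, x, x' => x = x'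
  | j + 1, x, x' => ∃ z, Reach r j x z ∧ Adj2 r z x'

open Classical in
/-- The vertices that can be reached from `A` in `j` steps. -/
noncomputable def ball (r : X → Y → Prop) (j : ℕ) (A : Finset X) : Finset X :=
  Finset.univ.filter fun x => ∃ a ∈ A, Reach r j a x

variable {r : X → Y → Prop}

@[simp] lemma mem_ball {j : ℕ} {A : Finset X} {x : X} :
    x ∈ ball r j A ↔ ∃ a ∈ A, Reach r j a x := by simp [ball]

lemma Reach.add {i j : ℕ} {x y z : X} (h : Reach r i x y) (h' : Reach r j y z) :
    Reach r (i + j) x z := by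
  induction j generalizing z with
  | zero => cases h'; exact h
  | succ j ih =>
    obtain ⟨w, hw, hwz⟩ := h'
    exact ⟨w, ih hw, hwz⟩

lemma Adj2.reach {x y : X} (h : Adj2 r x y) : Reach r 1 x y := ⟨x, rfl, h⟩

lemma Reach.symm {j : ℕ} {x y : X} (h : Reach r j x y) : Reach r j y x := by
  induction j generalizing y with
  | zero => exact Eq.symm h
  | succ j ih =>
    obtain ⟨w, hw, hwz⟩ := h
    rw [add_comm]
    exact hwz.symm.reach.add (ih hw)

variable [DecidableEq X] [DecidableEq Y]

namespace LayerGraph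
variable {n : ℕ}

lemma exists_dn (h : LayerGraph r n) (hn : 0 < n) (x : X) : ∃ y, r x y := by
  have h1 : 0 < (dn r x).card := by exact_mod_cast h.deg_pos hn x
  obtain ⟨y, hy⟩ := Finset.card_pos.mp h1
  exact ⟨y, mem_dn.mp hy⟩

lemma adj2_refl (h : LayerGraph r n) (hn : 0 < n) (x : X) : Adj2 r x x := by
  obtain ⟨y, hy⟩ := h.exists_dn hn x
  exact ⟨y, hy, hy⟩

lemma reach_mono (h : LayerGraph r n) (hn : 0 < n) {i j : ℕ} (hij : i ≤ j) {x y : X}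
    (hxy : Reach r i x y) : Reach r j x y := by
  induction hij with
  | refl => exact hxy
  | step _ ih => exact ⟨y, ih, h.adj2_refl hn y⟩

lemma card_ball_le (h : LayerGraph r n) (j : ℕ) (A : Finset X) :
    (ball r j A).card ≤ A.card * (n * n) ^ j := by
  induction j with
  | zero =>
    have : ball r 0 A = A := by ext x; simp [Reach]
    simp [this]
  | succ j ih =>
    have hsub : ball r (j + 1) A ⊆ upn r (nbr r (ball r j A)) := by
      intro x hx
      obtain ⟨a, ha, z, hz, y, hzy, hxy⟩ := mem_ball.mp hx
      exact mem_upn.mpr ⟨y, mem_nbr.mpr ⟨z, mem_ball.mpr ⟨a, ha, hz⟩, hzy⟩, hxy⟩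
    calc (ball r (j + 1) A).card ≤ (upn r (nbr r (ball r j A))).card := Finset.card_le_card hsub
      _ ≤ (nbr r (ball r j A)).card * n := h.card_upn_le _
      _ ≤ ((ball r j A).card * n) * n := Nat.mul_le_mul_right _ (h.card_nbr_le _)
      _ ≤ ((A.card * (n * n) ^ j) * n) * n := by gcongr
      _ = A.card * (n * n) ^ (j + 1) := by ring

lemma linked_skeleton (h : LayerGraph r n) (hn : 0 < n) {F U : Finset X}
    (hF : Linked (Adj2 r) F) (hU : U ⊆ F) (hnear : ∀ x ∈ F, ∃ u ∈ U, Reach r 3 x u) :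
    Linked (Reach r 7) U := by
  choose! near hnU hnR using hnear
  intro u hu u' hu'
  have key : ∀ z, Relation.ReflTransGen (fun a b => a ∈ F ∧ b ∈ F ∧ Adj2 r a b) u z → z ∈ F →
      Relation.ReflTransGen (fun a b => a ∈ U ∧ b ∈ U ∧ Reach r 7 a b) u (near z) := by
    intro z hz
    induction hz with
    | refl =>
      intro hz
      exact Relation.ReflTransGen.single
        ⟨hu, hnU u hz, h.reach_mono hn (by norm_num) (hnR u hz)⟩
    | @tail b c _ hbc ih =>
      intro hc
      refine (ih hbc.1).tail ⟨hnU b hbc.1, hnU c hc, ?_⟩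
      exact ((hnR b hbc.1).symm.add hbc.2.2.reach).add (hnR c hc)
  refine (key u' (hF u (hU hu) u' (hU hu')) (hU hu')).tail
    ⟨hnU u' (hU hu'), hu', h.reach_mono hn (by norm_num) (hnR u' (hU hu')).symm⟩

/-- A small set of centres close to every vertex of `F`. -/
lemma exists_centers (h : LayerGraph r n) (hn : 0 < n) {F A : Finset X} {G : Finset Y}
    (hG : G = nbr r F) (hA : A = inner r G) (φ M t : ℝ) (hφ0 : 0 ≤ φ) (hφ : φ ≤ n / 8)
    (hM0 : 0 < M) (hM : M ≤ φ * (n / 2 - 1)) (ht : t = G.card - A.card) :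
    ∃ P ⊆ F, (P.card : ℝ) ≤ G.card / M + 4 * t / n ∧ ∀ x ∈ F, ∃ u ∈ P, Reach r 3 x u := by
  classical
  have hn' : (0 : ℝ) < n := by exact_mod_cast hn
  have hFA : F ⊆ A := by rw [hA, hG]; exact subset_inner_nbr F
  have hNA : nbr r A = G := by rw [hA, hG]; exact nbr_inner_nbr F
  obtain ⟨bad, hbaddef⟩ : ∃ bad, bad = G.filter fun y => ((up r y ∩ A).card : ℝ) ≤ φ := ⟨_, rfl⟩
  have hbad : (bad.card : ℝ) ≤ 2 * t := by
    rw [ht, hA]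
    refine h.card_bad_le hn G φ hφ bad ?_ ?_
    · rw [hbaddef]; exact Finset.filter_subset _ _
    · intro y hy
      rw [hbaddef] at hy
      rw [← hA]
      exact (Finset.mem_filter.mp hy).2
  have hn2 : 0 ≤ (n : ℝ) / 2 - 1 := by
    by_contra! hc
    nlinarith
  have hWM : ∀ y, φ < ((up r y ∩ A).card : ℝ) → M ≤ (nbr r (up r y ∩ A)).card := by
    intro y hy
    have h2 := h.card_second_nbr (up r y ∩ A) y Finset.inter_subset_left
    refine hM.trans (le_trans ?_ h2)
    gcongr
  obtain ⟨B, hBdef⟩ : ∃ B : X → Finset Y, ∀ x, B x = nbr r (upn r (dn r x) ∩ A) :=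
    ⟨_, fun _ => rfl⟩
  obtain ⟨μ, hμdef⟩ : ∃ μ : Y → ℝ, ∀ y, μ y = 1 / M + if y ∈ bad then 2 / (n : ℝ) else 0 :=
    ⟨_, fun _ => rfl⟩
  have hμM : ∀ y, 1 / M ≤ μ y := by
    intro y
    rw [hμdef]
    have : (0 : ℝ) ≤ 2 / n := by positivity
    split_ifs <;> linarith
  have hM1 : (0 : ℝ) ≤ 1 / M := by positivity
  have hμ0 : ∀ y, 0 ≤ μ y := fun y => hM1.trans (hμM y)
  have hBone : ∀ x ∈ F, 1 ≤ ∑ y ∈ B x, μ y := by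
    intro x hx
    rw [hBdef]
    by_cases hgx : ∃ y ∈ dn r x, φ < ((up r y ∩ A).card : ℝ)
    · obtain ⟨y, hyx, hyg⟩ := hgx
      have hsub : nbr r (up r y ∩ A) ⊆ nbr r (upn r (dn r x) ∩ A) := by
        refine nbr_mono ?_
        intro z hz
        rw [Finset.mem_inter] at hz ⊢
        exact ⟨mem_upn.mpr ⟨y, hyx, mem_up.mp hz.1⟩, hz.2⟩
      calc (1 : ℝ) = M * (1 / M) := (mul_one_div_cancel hM0.ne').symm
        _ ≤ (nbr r (up r y ∩ A)).card * (1 / M) := mul_le_mul_of_nonneg_right (hWM y hyg) hM1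
        _ = (nbr r (up r y ∩ A)).card • (1 / M) := (nsmul_eq_mul _ _).symm
        _ ≤ ∑ z ∈ nbr r (up r y ∩ A), μ z := Finset.card_nsmul_le_sum _ _ _ fun z _ => hμM z
        _ ≤ _ := Finset.sum_le_sum_of_subset_of_nonneg hsub fun y _ _ => hμ0 y
    · push Not at hgx
      have hxA := hFA hx
      have hbadx : ∀ y ∈ dn r x, y ∈ bad := by
        intro y hy
        have hyG : y ∈ G := by
          rw [hA] at hxA
          exact mem_inner.mp hxA hy
        rw [hbaddef]
        exact Finset.mem_filter.mpr ⟨hyG, hgx y hy⟩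
      have hsub : dn r x ⊆ nbr r (upn r (dn r x) ∩ A) := by
        intro y hy
        exact mem_nbr.mpr ⟨x, Finset.mem_inter.mpr ⟨mem_upn.mpr ⟨y, hy, mem_dn.mp hy⟩, hxA⟩,
          mem_dn.mp hy⟩
      calc (1 : ℝ) = n / 2 * (2 / n) := by field_simp
        _ ≤ (dn r x).card * (2 / n) := by gcongr; exact h.deg_lower x
        _ = (dn r x).card • (2 / (n : ℝ)) := (nsmul_eq_mul _ _).symm
        _ ≤ ∑ z ∈ dn r x, μ z := by
            refine Finset.card_nsmul_le_sum _ _ _ fun z hz => ?_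
            rw [hμdef, if_pos (hbadx z hz)]
            linarith
        _ ≤ _ := Finset.sum_le_sum_of_subset_of_nonneg hsub fun y _ _ => hμ0 y
  obtain ⟨P, hPF, hPcard, hPnear⟩ := exists_packing F G B μ hμ0
    (fun x _ => by rw [hBdef, ← hNA]; exact nbr_mono Finset.inter_subset_right) hBone
  refine ⟨P, hPF, hPcard.trans ?_, ?_⟩
  · simp only [hμdef]
    have hbG : G ∩ bad = bad := by
      rw [Finset.inter_eq_right, hbaddef]
      exact Finset.filter_subset _ _
    rw [Finset.sum_add_distrib, ← Finset.sum_filter, Finset.filter_mem_eq_inter,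
      hbG, Finset.sum_const, Finset.sum_const, nsmul_eq_mul, nsmul_eq_mul]
    have : (bad.card : ℝ) * (2 / n) ≤ 2 * t * (2 / n) := by gcongr
    calc _ ≤ G.card * (1 / M) + 2 * t * (2 / n) := by linarith
      _ = _ := by ring
  · intro x hx
    obtain ⟨u, hu, hd⟩ := hPnear x hx
    rw [Finset.not_disjoint_iff] at hd
    obtain ⟨z, hzx, hzu⟩ := hd
    rw [hBdef] at hzx hzu
    obtain ⟨x₁, hx₁, hx₁z⟩ := mem_nbr.mp hzx
    obtain ⟨x₂, hx₂, hx₂z⟩ := mem_nbr.mp hzu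
    obtain ⟨y₁, hy₁, hx₁y₁⟩ := mem_upn.mp (Finset.mem_inter.mp hx₁).1
    obtain ⟨y₂, hy₂, hx₂y₂⟩ := mem_upn.mp (Finset.mem_inter.mp hx₂).1
    have a1 : Adj2 r x x₁ := ⟨y₁, mem_dn.mp hy₁, hx₁y₁⟩
    have a2 : Adj2 r x₁ x₂ := ⟨z, hx₁z, hx₂z⟩
    have a3 : Adj2 r x₂ u := ⟨y₂, hx₂y₂, mem_dn.mp hy₂⟩
    exact ⟨u, hu, (a1.reach.add a2.reach).add a3.reach⟩

/-- A sparse subset of `G` whose upper neighbourhood inside `A` sees almost all edges. -/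
lemma exists_certificate (h : LayerGraph r n) (hn : 0 < n) {F A : Finset X} {G : Finset Y}
    (hG : G = nbr r F) (hA : A = inner r G) (φ p M t C : ℝ) (hφ0 : 0 ≤ φ) (hφ : φ ≤ n / 8)
    (hp0 : 0 ≤ p) (hp1 : p ≤ 1) (hM0 : 0 < M) (hM : M ≤ φ * (n / 2 - 1))
    (ht : t = G.card - A.card)
    (hC : C = p * (G.card + n * t) + n * (G.card * Real.exp (-(p * M)))) :
    ∃ T ⊆ G, (T.card : ℝ) ≤ C ∧ ((upn r T \ A).card : ℝ) ≤ C ∧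
      ∑ x ∈ A, ((dn r x \ nbr r (upn r T ∩ A)).card : ℝ) ≤ 2 * t * φ + C := by
  classical
  have hn' : (0 : ℝ) < n := by exact_mod_cast hn
  have hbd : ∑ y ∈ G, ((up r y \ A).card : ℝ) ≤ n * t := by
    have := h.boundary_le hn F
    rwa [← hG, ← hA, ← ht] at this
  have hNA : nbr r A = G := by rw [hA, hG]; exact nbr_inner_nbr F
  obtain ⟨bad, hbaddef⟩ : ∃ bad, bad = G.filter fun y => ((up r y ∩ A).card : ℝ) ≤ φ := ⟨_, rfl⟩
  obtain ⟨good, hgooddef⟩ : ∃ good, good = G.filter fun y => ¬ ((up r y ∩ A).card : ℝ) ≤ φ :=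
    ⟨_, rfl⟩
  have hbad : (bad.card : ℝ) ≤ 2 * t := by
    rw [ht, hA]
    refine h.card_bad_le hn G φ hφ bad ?_ ?_
    · rw [hbaddef]; exact Finset.filter_subset _ _
    · intro y hy
      rw [hbaddef] at hy
      rw [← hA]
      exact (Finset.mem_filter.mp hy).2
  have hn2 : 0 ≤ (n : ℝ) / 2 - 1 := by
    by_contra! hc
    nlinarith
  have hWM : ∀ y ∈ good, M ≤ (nbr r (up r y ∩ A)).card := by
    intro y hy
    rw [hgooddef, Finset.mem_filter, not_le] at hy
    have h2 := h.card_second_nbr (up r y ∩ A) y Finset.inter_subset_left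
    refine hM.trans (le_trans ?_ h2)
    gcongr
    exact hy.2.le
  obtain ⟨T, hTG, hT⟩ := exists_sparse_hitting G good (fun y => nbr r (up r y ∩ A))
    (fun y => 1 + ((up r y \ A).card : ℝ)) p n M hp0 hp1 hn'.le
    (fun y _ => by rw [← hNA]; exact nbr_mono Finset.inter_subset_right) hWM
  obtain ⟨unc, huncdef⟩ : ∃ unc, unc = good.filter fun y => Disjoint T (nbr r (up r y ∩ A)) :=
    ⟨_, rfl⟩
  have hT1 : (T.card + ∑ y ∈ T, ((up r y \ A).card : ℝ)) + n * (unc.card : ℝ) ≤ C := by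
    have e0 : (T.card : ℝ) + ∑ y ∈ T, ((up r y \ A).card : ℝ)
        = ∑ y ∈ T, (1 + ((up r y \ A).card : ℝ)) := by
      rw [Finset.sum_add_distrib, Finset.sum_const, nsmul_eq_mul, mul_one]
    rw [e0, huncdef]
    refine hT.trans ?_
    rw [hC]
    have e1 : ∑ y ∈ G, (1 + ((up r y \ A).card : ℝ)) ≤ G.card + n * t := by
      rw [Finset.sum_add_distrib, Finset.sum_const, nsmul_eq_mul, mul_one]
      linarith
    have e2 : (good.card : ℝ) ≤ G.card := by
      rw [hgooddef]
      exact_mod_cast Finset.card_le_card (Finset.filter_subset _ _)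
    gcongr
  have hRcard : ((upn r T \ A).card : ℝ) ≤ ∑ y ∈ T, ((up r y \ A).card : ℝ) := by
    have : upn r T \ A ⊆ T.biUnion fun y => up r y \ A := by
      intro x hx
      rw [Finset.mem_sdiff, mem_upn] at hx
      obtain ⟨⟨y, hy, hxy⟩, hxA⟩ := hx
      exact Finset.mem_biUnion.mpr ⟨y, hy, Finset.mem_sdiff.mpr ⟨mem_up.mpr hxy, hxA⟩⟩
    exact_mod_cast (Finset.card_le_card this).trans Finset.card_biUnion_le
  have hsum0 : 0 ≤ ∑ y ∈ T, ((up r y \ A).card : ℝ) :=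
    Finset.sum_nonneg fun _ _ => Nat.cast_nonneg _
  have hunc0 : (0 : ℝ) ≤ n * (unc.card : ℝ) := mul_nonneg hn'.le (Nat.cast_nonneg _)
  have hT0 : (0 : ℝ) ≤ T.card := Nat.cast_nonneg _
  refine ⟨T, hTG, by linarith, by linarith, ?_⟩
  obtain ⟨F', hF'⟩ : ∃ F', F' = nbr r (upn r T ∩ A) := ⟨_, rfl⟩
  rw [← hF']
  have e1 : ∑ x ∈ A, ((dn r x \ F').card : ℝ) = ∑ y ∈ G \ F', ((up r y ∩ A).card : ℝ) := by
    have := sum_swap (r := r) (fun _ _ => (1 : ℝ)) A (G \ F')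
    simp only [Finset.sum_const, nsmul_eq_mul, mul_one] at this
    rw [← this]
    refine Finset.sum_congr rfl fun x hx => ?_
    congr 2
    rw [hA] at hx
    ext y
    have hxy : y ∈ dn r x → y ∈ G := fun hy => mem_inner.mp hx hy
    simp only [Finset.mem_sdiff, Finset.mem_inter]
    tauto
  have hsub : G \ F' ⊆ bad ∪ unc := by
    intro y hy
    rw [Finset.mem_sdiff] at hy
    rw [Finset.mem_union]
    by_cases hyb : ((up r y ∩ A).card : ℝ) ≤ φ
    · left
      rw [hbaddef]
      exact Finset.mem_filter.mpr ⟨hy.1, hyb⟩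
    · right
      rw [huncdef, hgooddef]
      refine Finset.mem_filter.mpr ⟨Finset.mem_filter.mpr ⟨hy.1, hyb⟩, ?_⟩
      rw [Finset.disjoint_left]
      intro z hzT hzW
      obtain ⟨x, hx, hxz⟩ := mem_nbr.mp hzW
      rw [Finset.mem_inter, mem_up] at hx
      rw [hF'] at hy
      exact hy.2 (mem_nbr.mpr ⟨x, Finset.mem_inter.mpr ⟨mem_upn.mpr ⟨z, hzT, hxz⟩, hx.2⟩, hx.1⟩)
  rw [e1]
  have hdisj : Disjoint bad unc := by
    rw [hbaddef, huncdef, hgooddef]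
    exact (Finset.disjoint_filter_filter_not _ _ _).mono_right (Finset.filter_subset _ _)
  have b1 : ∑ y ∈ bad, ((up r y ∩ A).card : ℝ) ≤ bad.card * φ := by
    rw [← nsmul_eq_mul]
    refine Finset.sum_le_card_nsmul _ _ _ fun y hy => ?_
    rw [hbaddef] at hy
    exact (Finset.mem_filter.mp hy).2
  have b2 : ∑ y ∈ unc, ((up r y ∩ A).card : ℝ) ≤ unc.card * n := by
    rw [← nsmul_eq_mul]
    refine Finset.sum_le_card_nsmul _ _ _ fun y _ => ?_
    exact_mod_cast (Finset.card_le_card Finset.inter_subset_left).trans (h.up_upper y)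
  have b3 : (bad.card : ℝ) * φ ≤ 2 * t * φ := mul_le_mul_of_nonneg_right hbad hφ0
  calc ∑ y ∈ G \ F', ((up r y ∩ A).card : ℝ)
      ≤ ∑ y ∈ bad ∪ unc, ((up r y ∩ A).card : ℝ) :=
        Finset.sum_le_sum_of_subset_of_nonneg hsub fun _ _ _ => Nat.cast_nonneg _
    _ = ∑ y ∈ bad, ((up r y ∩ A).card : ℝ) + ∑ y ∈ unc, ((up r y ∩ A).card : ℝ) :=
        Finset.sum_union hdisj
    _ ≤ 2 * t * φ + C := by linarith

/-- A small linked skeleton from which a linked set can be approximately recovered. -/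
lemma exists_skeleton (h : LayerGraph r n) (hn : 0 < n) {F : Finset X}
    (hF : Linked (Adj2 r) F) {x₀ : X} (hx₀ : x₀ ∈ F) (φ p M : ℝ) (hφ0 : 0 ≤ φ) (hφ : φ ≤ n / 8)
    (hp0 : 0 ≤ p) (hp1 : p ≤ 1) (hM0 : 0 < M) (hM : M ≤ φ * (n / 2 - 1)) (g t C : ℝ)
    (hg : g = (nbr r F).card) (ht : t = g - (inner r (nbr r F)).card)
    (hC : C = p * (g + n * t) + n * (g * Real.exp (-(p * M)))) :
    ∃ (U : Finset X) (T : Finset Y) (R : Finset X), x₀ ∈ U ∧ Linked (Reach r 7) U ∧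
      (U.card : ℝ) ≤ 1 + (g / M + 4 * t / n) + C ∧
      inner r (nbr r F) ⊆ ball r 4 U ∧
      T ⊆ nbr r U ∧ (T.card : ℝ) ≤ C ∧ R ⊆ upn r T ∧ (R.card : ℝ) ≤ C ∧
      nbr r (upn r T \ R) ⊆ nbr r F ∧
      ∑ x ∈ inner r (nbr r F), ((dn r x \ nbr r (upn r T \ R)).card : ℝ) ≤ 2 * t * φ + C := by
  classical
  rw [hg] at ht hC
  obtain ⟨P, hPF, hPcard, hPnear⟩ := h.exists_centers hn rfl rfl φ M t hφ0 hφ hM0 hM ht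
  obtain ⟨T, hTG, hTC, hRC, hsum⟩ :=
    h.exists_certificate hn rfl rfl φ p M t C hφ0 hφ hp0 hp1 hM0 hM ht hC
  have hchoose : ∀ y ∈ T, ∃ x ∈ F, r x y := fun y hy => mem_nbr.mp (hTG hy)
  have : Nonempty X := ⟨x₀⟩
  choose! ξ hξF hξr using hchoose
  obtain ⟨U, hUdef⟩ : ∃ U, U = insert x₀ (P ∪ T.image ξ) := ⟨_, rfl⟩
  have hUF : U ⊆ F := by
    rw [hUdef]
    refine Finset.insert_subset hx₀ (Finset.union_subset hPF ?_)
    intro x hx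
    obtain ⟨y, hy, rfl⟩ := Finset.mem_image.mp hx
    exact hξF y hy
  have hPU : P ⊆ U := by
    rw [hUdef]
    exact fun x hx => Finset.mem_insert_of_mem (Finset.mem_union_left _ hx)
  have hnear : ∀ x ∈ F, ∃ u ∈ U, Reach r 3 x u := by
    intro x hx
    obtain ⟨u, hu, hd⟩ := hPnear x hx
    exact ⟨u, hPU hu, hd⟩
  have hRT : upn r T \ (upn r T \ inner r (nbr r F)) = upn r T ∩ inner r (nbr r F) :=
    Finset.sdiff_sdiff_self_left _ _
  refine ⟨U, T, upn r T \ inner r (nbr r F), by rw [hUdef]; exact Finset.mem_insert_self _ _,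
    h.linked_skeleton hn hF hUF hnear, ?_, ?_, ?_, hTC, Finset.sdiff_subset, hRC, ?_, ?_⟩
  · have h1 : U.card ≤ (P.card + T.card) + 1 := by
      rw [hUdef]
      exact (Finset.card_insert_le _ _).trans (Nat.add_le_add_right
        ((Finset.card_union_le _ _).trans (Nat.add_le_add_left Finset.card_image_le _)) _)
    have h2 : (U.card : ℝ) ≤ (P.card + T.card) + 1 := by exact_mod_cast h1
    rw [hg]
    linarith
  · intro x hx
    obtain ⟨y, hy⟩ := h.exists_dn hn x
    obtain ⟨x', hx', hx'y⟩ := mem_nbr.mp (mem_inner.mp hx (mem_dn.mpr hy))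
    obtain ⟨u, hu, hur⟩ := hnear x' hx'
    exact mem_ball.mpr ⟨u, hu, hur.symm.add (Adj2.reach ⟨y, hx'y, hy⟩)⟩
  · intro y hy
    rw [hUdef]
    exact mem_nbr.mpr ⟨ξ y, Finset.mem_insert_of_mem (Finset.mem_union_right _
      (Finset.mem_image_of_mem _ hy)), hξr y hy⟩
  · rw [hRT]
    exact (nbr_mono Finset.inter_subset_right).trans (nbr_inner_subset _)
  · rw [hRT]
    exact hsum

end LayerGraph
end Bipartite

lemma card_biUnion_le_mul {ι κ : Type} [DecidableEq κ] (s : Finset ι) (f : ι → Finset κ) (a b : ℝ)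
    (hs : (s.card : ℝ) ≤ a) (hf : ∀ i ∈ s, ((f i).card : ℝ) ≤ b) (hb : 0 ≤ b) :
    ((s.biUnion f).card : ℝ) ≤ a * b := by
  calc ((s.biUnion f).card : ℝ) ≤ ∑ i ∈ s, ((f i).card : ℝ) := by
        exact_mod_cast Finset.card_biUnion_le
    _ ≤ s.card • b := Finset.sum_le_card_nsmul _ _ _ hf
    _ = s.card * b := nsmul_eq_mul _ _
    _ ≤ a * b := mul_le_mul_of_nonneg_right hs hb

lemma sum_biUnion_le {ι κ : Type} [DecidableEq κ] (s : Finset ι) (f : ι → Finset κ) (w : κ → ℝ)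
    (hw : ∀ k, 0 ≤ w k) : ∑ k ∈ s.biUnion f, w k ≤ ∑ i ∈ s, ∑ k ∈ f i, w k := by
  classical
  induction s using Finset.induction_on with
  | empty => simp
  | insert a s ha ih =>
    rw [Finset.biUnion_insert, Finset.sum_insert ha]
    have h1 := Finset.sum_union_inter (s₁ := f a) (s₂ := s.biUnion f) (f := w)
    have h2 : 0 ≤ ∑ k ∈ f a ∩ s.biUnion f, w k := Finset.sum_nonneg fun k _ => hw k
    linarith

section Bipartite
variable {X Y : Type} [Fintype X] [Fintype Y] {r : X → Y → Prop} [DecidableEq X] [DecidableEq Y]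

/-- The weight of the subsets of `S` is at most a little more than `2 ^ |S|`. -/
def Tame (m : Finset X → ℝ) (n : ℕ) : Prop :=
  (∀ F, 0 ≤ m F) ∧ m ∅ = 1 ∧
    ∀ S : Finset X, ∑ F ∈ S.powerset, m F ≤ 2 ^ S.card * Real.exp (S.card / (n : ℝ) ^ 2)

lemma Tame.sum_le_exp {m : Finset X → ℝ} {n : ℕ} (hm : Tame m n) (S : Finset X) :
    ∑ F ∈ S.powerset, m F ≤ Real.exp (S.card * (Real.log 2 + 1 / (n : ℝ) ^ 2)) := by
  refine (hm.2.2 S).trans (le_of_eq ?_)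
  rw [mul_add, Real.exp_add, mul_comm (S.card : ℝ) (Real.log 2), ← Real.rpow_def_of_pos two_pos,
    Real.rpow_natCast, mul_one_div]

lemma Tame.sum_le_of_cover {m : Finset X → ℝ} {n : ℕ} (hm : Tame m n)
    (𝓕 𝓢 : Finset (Finset X)) (b : ℝ) (hb : ∀ S ∈ 𝓢, (S.card : ℝ) ≤ b)
    (hcov : ∀ F ∈ 𝓕, ∃ S ∈ 𝓢, F ⊆ S) :
    ∑ F ∈ 𝓕, m F ≤ 𝓢.card * Real.exp (b * (Real.log 2 + 1 / (n : ℝ) ^ 2)) := by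
  have hl : 0 ≤ Real.log 2 + 1 / (n : ℝ) ^ 2 :=
    add_nonneg (Real.log_nonneg one_le_two) (by positivity)
  have hsub : 𝓕 ⊆ 𝓢.biUnion Finset.powerset := by
    intro F hF
    obtain ⟨S, hS, hFS⟩ := hcov F hF
    exact Finset.mem_biUnion.mpr ⟨S, hS, Finset.mem_powerset.mpr hFS⟩
  calc ∑ F ∈ 𝓕, m F ≤ ∑ F ∈ 𝓢.biUnion Finset.powerset, m F :=
        Finset.sum_le_sum_of_subset_of_nonneg hsub fun F _ _ => hm.1 F
    _ ≤ ∑ S ∈ 𝓢, ∑ F ∈ S.powerset, m F :=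
        sum_biUnion_le _ _ _ hm.1
    _ ≤ 𝓢.card • Real.exp (b * (Real.log 2 + 1 / (n : ℝ) ^ 2)) := by
        refine Finset.sum_le_card_nsmul _ _ _ fun S hS => (hm.sum_le_exp S).trans ?_
        exact Real.exp_le_exp.mpr (mul_le_mul_of_nonneg_right (hb S hS) hl)
    _ = _ := nsmul_eq_mul _ _

namespace LayerGraph
variable {n : ℕ}

lemma exp_neg_log_mul (hn : 0 < n) (k : ℕ) :
    Real.exp (-(k * Real.log n)) = 1 / (n : ℝ) ^ k := by
  have hn' : (0 : ℝ) < n := by exact_mod_cast hn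
  rw [Real.exp_neg, Real.exp_nat_mul, Real.exp_log hn', one_div]

open Classical in
/-- Linked sets of bounded size through a vertex. -/
noncomputable def skeletons (r : X → Y → Prop) (x₀ : X) (K : ℝ) : Finset (Finset X) :=
  Finset.univ.filter fun U => x₀ ∈ U ∧ Linked (Reach r 7) U ∧ (U.card : ℝ) ≤ K

lemma card_skeletons_le (h : LayerGraph r n) (hn : 2 ≤ n) (x₀ : X) (K : ℝ) (hK : 0 ≤ K) :
    ((skeletons r x₀ K).card : ℝ) ≤ Real.exp (28 * Real.log n * K) := by
  have hn' : (0 : ℝ) < n := by positivity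
  have h1 : (skeletons r x₀ K).card ≤ ((n * n) ^ 7) ^ (2 * ⌊K⌋₊) := by
    refine card_linked_le' (H := Reach r 7) (fun a b hab => hab.symm)
      (nb := fun x => ball r 7 {x}) (fun x y hxy => by simpa using hxy)
      (fun x => by simpa using h.card_ball_le 7 {x}) ?_ x₀ ⌊K⌋₊ _ ?_
    · calc 2 ≤ n := hn
        _ ≤ (n * n) ^ 7 := by
          rw [← pow_two, ← pow_mul]
          exact Nat.le_self_pow (by norm_num) n
    · intro U hU
      simp only [skeletons, Finset.mem_filter, Finset.mem_univ, true_and] at hU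
      exact ⟨hU.1, hU.2.1, Nat.le_floor hU.2.2⟩
  calc ((skeletons r x₀ K).card : ℝ) ≤ (((n * n) ^ 7) ^ (2 * ⌊K⌋₊) : ℕ) := by exact_mod_cast h1
    _ = (n : ℝ) ^ (28 * ⌊K⌋₊) := by push_cast; rw [← pow_two, ← pow_mul, ← pow_mul]; congr 1; ring
    _ = Real.exp ((28 * ⌊K⌋₊ : ℕ) * Real.log n) := by
        rw [Real.exp_nat_mul, Real.exp_log hn']
    _ ≤ _ := by
        apply Real.exp_le_exp.mpr
        push_cast
        have : (⌊K⌋₊ : ℝ) ≤ K := Nat.floor_le hK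
        have hl : 0 ≤ Real.log n := Real.log_natCast_nonneg n
        nlinarith [mul_le_mul_of_nonneg_right this hl]

open Classical in
/-- Subsets of bounded size. -/
noncomputable def smallSubsets {Z : Type} (Ω : Finset Z) (K : ℝ) : Finset (Finset Z) :=
  Ω.powerset.filter fun B => (B.card : ℝ) ≤ K

lemma mem_smallSubsets {Z : Type} {Ω : Finset Z} {K : ℝ} {B : Finset Z} :
    B ∈ smallSubsets Ω K ↔ B ⊆ Ω ∧ (B.card : ℝ) ≤ K := by
  simp [smallSubsets]

lemma card_smallSubsets_le {Z : Type} [DecidableEq Z] (hn : 0 < n) (k : ℕ) (Ω : Finset Z)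
    (K K' : ℝ) (hΩ : (Ω.card : ℝ) ≤ n ^ k * K') :
    ((smallSubsets Ω K).card : ℝ) ≤ Real.exp (K' + k * Real.log n * K) := by
  have hn' : (0 : ℝ) < n := by exact_mod_cast hn
  have hl : 0 ≤ Real.log n := Real.log_natCast_nonneg n
  refine (card_subsets_le Ω K (k * Real.log n) (by positivity) _
    fun B hB => mem_smallSubsets.mp hB).trans ?_
  apply Real.exp_le_exp.mpr
  rw [exp_neg_log_mul hn]
  have : 1 / (n : ℝ) ^ k * Ω.card ≤ K' := by
    rw [one_div_mul_eq_div, div_le_iff₀ (by positivity)]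
    linarith
  linarith

/-- The family of linked sets through `x₀` with prescribed sizes of neighbourhood and closure. -/
def IsFamily (r : X → Y → Prop) (x₀ : X) (g a : ℕ) (𝓕 : Finset (Finset X)) : Prop :=
  ∀ F ∈ 𝓕, x₀ ∈ F ∧ Linked (Adj2 r) F ∧ (nbr r F).card = g ∧ (inner r (nbr r F)).card = a

/-- Covering of a closed set by its skeleton data with few exceptional vertices. -/
lemma closure_cover (h : LayerGraph r n) (hn : 0 < n) {F : Finset X} {F' : Finset Y}
    (hF' : F' ⊆ nbr r F) (Ω : Finset X) (hΩ : inner r (nbr r F) ⊆ Ω) (ψ t E : ℝ)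
    (hψ0 : 0 < ψ) (hψ : ψ ≤ n / 4)
    (ht : t = (nbr r F).card - (inner r (nbr r F)).card)
    (hE : ∑ x ∈ inner r (nbr r F), ((dn r x \ F').card : ℝ) ≤ E) :
    ∃ Exc ⊆ Ω, (Exc.card : ℝ) ≤ E / ψ ∧
      F ⊆ (Ω.filter fun u => ((dn r u \ F').card : ℝ) ≤ ψ) ∪ Exc ∧
      (((Ω.filter fun u => ((dn r u \ F').card : ℝ) ≤ ψ) ∪ Exc).card : ℝ) ≤
        F'.card + 2 / n * (E + 4 * t * ψ) := by
  classical
  have hn' : (0 : ℝ) < n := by exact_mod_cast hn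
  have hbd := h.boundary_le hn F
  have hFA : F ⊆ inner r (nbr r F) := subset_inner_nbr F
  rw [← ht] at hbd
  obtain ⟨A, hA⟩ : ∃ A, A = inner r (nbr r F) := ⟨_, rfl⟩
  rw [← hA] at hΩ hbd hFA hE
  obtain ⟨Exc, hExc⟩ : ∃ Exc, Exc = A.filter fun u => ψ < ((dn r u \ F').card : ℝ) := ⟨_, rfl⟩
  have hExcA : Exc ⊆ A := by rw [hExc]; exact Finset.filter_subset _ _
  obtain ⟨S, hS⟩ : ∃ S, S = (Ω.filter fun u => ((dn r u \ F').card : ℝ) ≤ ψ) ∪ Exc := ⟨_, rfl⟩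
  have hAS : A ⊆ S := by
    intro x hx
    rw [hS, Finset.mem_union, hExc, Finset.mem_filter, Finset.mem_filter]
    rcases le_or_gt ((dn r x \ F').card : ℝ) ψ with h1 | h1
    · exact Or.inl ⟨hΩ hx, h1⟩
    · exact Or.inr ⟨hx, h1⟩
  have hSA : ∀ x ∈ S \ A, ((dn r x \ F').card : ℝ) ≤ ψ := by
    intro x hx
    rw [hS, Finset.mem_sdiff, Finset.mem_union, Finset.mem_filter] at hx
    rcases hx with ⟨h1 | h1, h2⟩
    · exact h1.2
    · exact absurd (hExcA h1) h2
  refine ⟨Exc, hExcA.trans hΩ, ?_, ?_, ?_⟩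
  · rw [le_div_iff₀ hψ0]
    refine le_trans ?_ hE
    calc (Exc.card : ℝ) * ψ = Exc.card • ψ := (nsmul_eq_mul _ _).symm
      _ ≤ ∑ x ∈ Exc, ((dn r x \ F').card : ℝ) := by
          refine Finset.card_nsmul_le_sum _ _ _ fun x hx => ?_
          rw [hExc, Finset.mem_filter] at hx
          exact hx.2.le
      _ ≤ _ := Finset.sum_le_sum_of_subset_of_nonneg hExcA fun _ _ _ => Nat.cast_nonneg _
  · rw [← hS]
    exact hFA.trans hAS
  · rw [← hS]
    have h4t : ((S \ A).card : ℝ) ≤ 4 * t := by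
      have e1 : ((S \ A).card : ℝ) * (n / 4) ≤ n * t := by
        refine le_trans ?_ hbd
        calc ((S \ A).card : ℝ) * (n / 4) = (S \ A).card • ((n : ℝ) / 4) := (nsmul_eq_mul _ _).symm
          _ ≤ ∑ x ∈ S \ A, ((dn r x ∩ nbr r F).card : ℝ) := by
              refine Finset.card_nsmul_le_sum _ _ _ fun x hx => ?_
              have a1 := hSA x hx
              have a2 : ((dn r x ∩ F').card : ℝ) + (dn r x \ F').card = (dn r x).card := by
                exact_mod_cast Finset.card_inter_add_card_sdiff (dn r x) F'
              have a3 := h.deg_lower x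
              have a4 : ((dn r x ∩ F').card : ℝ) ≤ (dn r x ∩ nbr r F).card := by
                exact_mod_cast Finset.card_le_card (Finset.inter_subset_inter_left hF')
              linarith
          _ = ∑ y ∈ nbr r F, ((up r y ∩ (S \ A)).card : ℝ) := by
              have := sum_swap (r := r) (fun _ _ => (1 : ℝ)) (S \ A) (nbr r F)
              simpa only [Finset.sum_const, nsmul_eq_mul, mul_one] using this
          _ ≤ _ := by
              refine Finset.sum_le_sum fun y _ => ?_
              have : up r y ∩ (S \ A) ⊆ up r y \ A := by
                intro x hx
                rw [Finset.mem_inter, Finset.mem_sdiff] at hx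
                exact Finset.mem_sdiff.mpr ⟨hx.1, hx.2.2⟩
              exact_mod_cast Finset.card_le_card this
      have : ((S \ A).card : ℝ) * (n / 4) = n * ((S \ A).card / 4) := by ring
      rw [this] at e1
      have := le_of_mul_le_mul_left e1 hn'
      linarith
    refine (h.card_le_of_missing hn S F').trans ?_
    have hsum : ∑ x ∈ S, ((dn r x \ F').card : ℝ) ≤ E + 4 * t * ψ := by
      rw [← Finset.sum_sdiff hAS]
      have : ∑ x ∈ S \ A, ((dn r x \ F').card : ℝ) ≤ (S \ A).card * ψ := by
        rw [← nsmul_eq_mul]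
        exact Finset.sum_le_card_nsmul _ _ _ hSA
      have h2 : ((S \ A).card : ℝ) * ψ ≤ 4 * t * ψ := mul_le_mul_of_nonneg_right h4t hψ0.le
      linarith
    gcongr

end LayerGraph
end Bipartite

section Bipartite
variable {X Y : Type} [Fintype X] [Fintype Y] {r : X → Y → Prop} [DecidableEq X] [DecidableEq Y]

namespace LayerGraph
variable {n : ℕ}

/-- Total weight of linked sets with prescribed parameters, via containers. -/
lemma container_sum (h : LayerGraph r n) (hn : 2 ≤ n) (x₀ : X) (g a : ℕ)
    (𝓕 : Finset (Finset X)) (h𝓕 : IsFamily r x₀ g a 𝓕) (m : Finset X → ℝ) (hm : Tame m n)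
    (φ ψ γ p M K t C : ℝ) (hφ0 : 0 ≤ φ) (hφ : φ ≤ n / 8) (hψ0 : 0 < ψ) (hψ : ψ ≤ n / 4)
    (hp0 : 0 ≤ p) (hp1 : p ≤ 1) (hM0 : 0 < M) (hM : M ≤ φ * (n / 2 - 1))
    (ht : t = g - a) (ht0 : 0 ≤ t)
    (hC : C = p * (g + n * t) + n * (g * Real.exp (-(p * M))))
    (hK1 : 1 + (g / M + 4 * t / n) + C ≤ K) (hK2 : (2 * t * φ + C) / ψ ≤ K) :
    ∑ F ∈ 𝓕, m F ≤
      Real.exp (30 * Real.log n * K + 3 * K + 9 * Real.log n * (γ * t)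
        + a * (Real.log 2 + 1 / (n : ℝ) ^ 2)) +
      Real.exp (38 * Real.log n * K + 3 * K +
        (g - γ * t + 2 / n * ((2 * t * φ + C) + 4 * t * ψ)) * (Real.log 2 + 1 / (n : ℝ) ^ 2)) := by
  classical
  have hn0 : 0 < n := by omega
  have hn' : (0 : ℝ) < n := by positivity
  have hl : 0 ≤ Real.log n := Real.log_natCast_nonneg n
  have hg0 : (0 : ℝ) ≤ g := Nat.cast_nonneg _
  have hC0 : 0 ≤ C := by rw [hC]; positivity
  have hCK : C ≤ K := by
    have : 0 ≤ g / M + 4 * t / n := by positivity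
    linarith
  have hK0 : 0 ≤ K := hC0.trans hCK
  obtain ⟨𝓒, h𝓒⟩ : ∃ 𝓒 : Finset (Finset X × Finset Y), 𝓒 =
      (skeletons r x₀ K).biUnion fun U => (smallSubsets (nbr r U) K).biUnion fun T =>
        (smallSubsets (upn r T) K).image fun R => (U, nbr r (upn r T \ R)) := ⟨_, rfl⟩
  have hcard : (𝓒.card : ℝ) ≤ Real.exp (28 * Real.log n * K) *
      (Real.exp (K + (1 : ℕ) * Real.log n * K) * Real.exp (K + (1 : ℕ) * Real.log n * K)) := by
    rw [h𝓒]
    refine card_biUnion_le_mul _ _ _ _ (h.card_skeletons_le hn x₀ K hK0) (fun U hU => ?_)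
      (by positivity)
    simp only [skeletons, Finset.mem_filter, Finset.mem_univ, true_and] at hU
    refine card_biUnion_le_mul _ _ _ _ (card_smallSubsets_le hn0 1 _ K K ?_) (fun T hT => ?_)
      (by positivity)
    · have : ((nbr r U).card : ℝ) ≤ U.card * n := by exact_mod_cast h.card_nbr_le U
      rw [pow_one]
      nlinarith [hU.2.2]
    · refine le_trans (by exact_mod_cast Finset.card_image_le)
        (card_smallSubsets_le hn0 1 _ K K ?_)
      have : ((upn r T).card : ℝ) ≤ T.card * n := by exact_mod_cast h.card_upn_le T
      rw [pow_one]
      nlinarith [(mem_smallSubsets.mp hT).2]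
  have hcode : ∀ F ∈ 𝓕, ∃ c ∈ 𝓒, c.2 ⊆ nbr r F ∧ inner r (nbr r F) ⊆ ball r 4 c.1 ∧
      ∑ x ∈ inner r (nbr r F), ((dn r x \ c.2).card : ℝ) ≤ 2 * t * φ + C := by
    intro F hF
    obtain ⟨f1, f2, f3, f4⟩ := h𝓕 F hF
    obtain ⟨U, T, R, u1, u2, u3, u4, u5, u6, u7, u8, u9, u10⟩ := h.exists_skeleton hn0 f2 f1 φ p M
      hφ0 hφ hp0 hp1 hM0 hM g t C (by rw [f3]) (by rw [f4, ht]) hC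
    refine ⟨(U, nbr r (upn r T \ R)), ?_, u9, u4, u10⟩
    rw [h𝓒, Finset.mem_biUnion]
    refine ⟨U, by simp only [skeletons, Finset.mem_filter, Finset.mem_univ, true_and]
                  exact ⟨u1, u2, u3.trans hK1⟩, ?_⟩
    rw [Finset.mem_biUnion]
    refine ⟨T, mem_smallSubsets.mpr ⟨u5, u6.trans hCK⟩, ?_⟩
    rw [Finset.mem_image]
    exact ⟨R, mem_smallSubsets.mpr ⟨u7, u8.trans hCK⟩, rfl⟩
  have hcU : ∀ c ∈ 𝓒, (c.1.card : ℝ) ≤ K := by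
    intro c hc
    rw [h𝓒, Finset.mem_biUnion] at hc
    obtain ⟨U, hU, hc⟩ := hc
    rw [Finset.mem_biUnion] at hc
    obtain ⟨T, _, hc⟩ := hc
    rw [Finset.mem_image] at hc
    obtain ⟨R, _, rfl⟩ := hc
    simp only [skeletons, Finset.mem_filter, Finset.mem_univ, true_and] at hU
    exact hU.2.2
  have hball : ∀ c ∈ 𝓒, ((ball r 4 c.1).card : ℝ) ≤ n ^ 8 * K := by
    intro c hc
    have h1 : ((ball r 4 c.1).card : ℝ) ≤ c.1.card * (n * n) ^ 4 := by
      exact_mod_cast h.card_ball_le 4 c.1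
    have h2 : (n : ℝ) ^ 8 = (n * n) ^ 4 := by ring
    rw [h2, mul_comm]
    exact h1.trans (mul_le_mul_of_nonneg_right (hcU c hc) (by positivity))
  -- containers of the first kind
  obtain ⟨𝓢₁, h𝓢₁⟩ : ∃ 𝓢₁ : Finset (Finset X), 𝓢₁ = (𝓒.biUnion fun c =>
      (smallSubsets (nbr r (ball r 4 c.1)) (γ * t)).image fun D => inner r (c.2 ∪ D)).filter
        fun S => (S.card : ℝ) ≤ a := ⟨_, rfl⟩
  have hcard₁ : (𝓢₁.card : ℝ) ≤ Real.exp (28 * Real.log n * K) *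
      (Real.exp (K + (1 : ℕ) * Real.log n * K) * Real.exp (K + (1 : ℕ) * Real.log n * K)) *
      Real.exp (K + (9 : ℕ) * Real.log n * (γ * t)) := by
    rw [h𝓢₁]
    refine le_trans (by exact_mod_cast Finset.card_filter_le _ _)
      (card_biUnion_le_mul _ _ _ _ hcard (fun c hc => ?_) (by positivity))
    refine le_trans (by exact_mod_cast Finset.card_image_le)
        (card_smallSubsets_le hn0 9 _ (γ * t) K ?_)
    have h1 : ((nbr r (ball r 4 c.1)).card : ℝ) ≤ (ball r 4 c.1).card * n := by
      exact_mod_cast h.card_nbr_le _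
    calc _ ≤ _ := h1
      _ ≤ (n ^ 8 * K) * n := mul_le_mul_of_nonneg_right (hball c hc) hn'.le
      _ = _ := by ring
  obtain ⟨𝓢₂, h𝓢₂⟩ : ∃ 𝓢₂ : Finset (Finset X), 𝓢₂ = (𝓒.biUnion fun c =>
      (smallSubsets (ball r 4 c.1) K).image fun E =>
        ((ball r 4 c.1).filter fun u => ((dn r u \ c.2).card : ℝ) ≤ ψ) ∪ E).filter
        fun S => (S.card : ℝ) ≤ g - γ * t + 2 / n * ((2 * t * φ + C) + 4 * t * ψ) := ⟨_, rfl⟩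
  have hcard₂ : (𝓢₂.card : ℝ) ≤ Real.exp (28 * Real.log n * K) *
      (Real.exp (K + (1 : ℕ) * Real.log n * K) * Real.exp (K + (1 : ℕ) * Real.log n * K)) *
      Real.exp (K + (8 : ℕ) * Real.log n * K) := by
    rw [h𝓢₂]
    refine le_trans (by exact_mod_cast Finset.card_filter_le _ _)
      (card_biUnion_le_mul _ _ _ _ hcard (fun c hc => ?_) (by positivity))
    exact le_trans (by exact_mod_cast Finset.card_image_le)
        (card_smallSubsets_le hn0 8 _ K K (hball c hc))
  obtain ⟨𝓕₁, h𝓕₁⟩ : ∃ 𝓕₁ : Finset (Finset X), 𝓕₁ = 𝓕.filter fun F => ∃ S ∈ 𝓢₁, F ⊆ S := ⟨_, rfl⟩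
  obtain ⟨𝓕₂, h𝓕₂⟩ : ∃ 𝓕₂ : Finset (Finset X), 𝓕₂ = 𝓕.filter fun F => ¬ ∃ S ∈ 𝓢₁, F ⊆ S :=
    ⟨_, rfl⟩
  have hsplit : ∑ F ∈ 𝓕, m F = ∑ F ∈ 𝓕₁, m F + ∑ F ∈ 𝓕₂, m F := by
    rw [h𝓕₁, h𝓕₂]
    exact (Finset.sum_filter_add_sum_filter_not _ _ _).symm
  have hs₁ := hm.sum_le_of_cover 𝓕₁ 𝓢₁ a
    (fun S hS => by rw [h𝓢₁] at hS; exact (Finset.mem_filter.mp hS).2)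
    (fun F hF => by rw [h𝓕₁] at hF; exact (Finset.mem_filter.mp hF).2)
  have hs₂ := hm.sum_le_of_cover 𝓕₂ 𝓢₂ (g - γ * t + 2 / n * ((2 * t * φ + C) + 4 * t * ψ))
    (fun S hS => by rw [h𝓢₂] at hS; exact (Finset.mem_filter.mp hS).2) (by
      intro F hF
      rw [h𝓕₂, Finset.mem_filter] at hF
      obtain ⟨hF, hno⟩ := hF
      obtain ⟨f1, f2, f3, f4⟩ := h𝓕 F hF
      obtain ⟨c, hc, c1, c2, c3⟩ := hcode F hF
      have hDcard : ((nbr r F \ c.2).card : ℝ) = g - c.2.card := by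
        have := Finset.card_sdiff_add_card_eq_card c1
        rw [f3] at this
        rw [← this]
        push_cast
        ring
      have hlt : (c.2.card : ℝ) ≤ g - γ * t := by
        by_contra! hcon
        refine hno ⟨inner r (nbr r F), ?_, subset_inner_nbr F⟩
        rw [h𝓢₁, Finset.mem_filter, Finset.mem_biUnion]
        refine ⟨⟨c, hc, Finset.mem_image.mpr ⟨nbr r F \ c.2, mem_smallSubsets.mpr ⟨?_, ?_⟩, ?_⟩⟩,
          by rw [f4]⟩
        · refine Finset.sdiff_subset.trans ?_
          exact nbr_mono ((subset_inner_nbr F).trans c2)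
        · linarith
        · rw [Finset.union_sdiff_of_subset c1]
      obtain ⟨E, e1, e2, e3, e4⟩ := h.closure_cover hn0 c1 _ c2 ψ t _ hψ0 hψ
        (by rw [f3, f4, ht]) c3
      refine ⟨_, ?_, e3⟩
      rw [h𝓢₂, Finset.mem_filter, Finset.mem_biUnion]
      refine ⟨⟨c, hc, Finset.mem_image.mpr ⟨E, mem_smallSubsets.mpr ⟨e1, e2.trans hK2⟩, rfl⟩⟩, ?_⟩
      linarith)
  rw [hsplit]
  refine add_le_add (hs₁.trans ?_) (hs₂.trans ?_)
  · refine (mul_le_mul_of_nonneg_right hcard₁ (Real.exp_nonneg _)).trans (le_of_eq ?_)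
    rw [← Real.exp_add, ← Real.exp_add, ← Real.exp_add, ← Real.exp_add]
    congr 1
    push_cast
    ring
  · refine (mul_le_mul_of_nonneg_right hcard₂ (Real.exp_nonneg _)).trans (le_of_eq ?_)
    rw [← Real.exp_add, ← Real.exp_add, ← Real.exp_add, ← Real.exp_add]
    congr 1
    push_cast
    ring

end LayerGraph
end Bipartite

section Bipartite
variable {X Y : Type} [Fintype X] [Fintype Y] {r : X → Y → Prop} [DecidableEq X] [DecidableEq Y]

namespace LayerGraph
variable {n : ℕ}

set_option maxHeartbeats 1000000 in
/-- Total weight of large linked sets with prescribed parameters. -/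
lemma large_sum (h : LayerGraph r n) (ρ : ℝ) (hρ : ρ ^ 8 = n) (hL1 : 1 ≤ Real.log n)
    (hρL : 10 ^ 6 * Real.log n ^ 2 ≤ ρ) (x₀ : X) (g a : ℕ)
    (𝓕 : Finset (Finset X)) (h𝓕 : IsFamily r x₀ g a 𝓕) (m : Finset X → ℝ) (hm : Tame m n)
    (hg : 16 * n ^ 2 ≤ g) :
    ∑ F ∈ 𝓕, m F ≤ 2 * Real.exp (g * Real.log 2 - g / (32 * n * ρ)) := by
  rcases 𝓕.eq_empty_or_nonempty with rfl | ⟨F, hF⟩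
  · simp only [Finset.sum_empty]; positivity
  obtain ⟨f1, f2, f3, f4⟩ := h𝓕 F hF
  obtain ⟨L, hL⟩ : ∃ L, L = Real.log n := ⟨_, rfl⟩
  rw [← hL] at hL1 hρL
  have hρ6 : 10 ^ 6 ≤ ρ := by nlinarith
  have hρ0 : 0 < ρ := by linarith
  have hρ1 : 1 ≤ ρ := by linarith
  have hnρ : ρ ≤ n := by rw [← hρ]; exact le_self_pow₀ hρ1 (by norm_num)
  have hn2 : 2 ≤ n := by
    have : (2 : ℝ) ≤ n := by linarith
    exact_mod_cast this
  have hn' : (0 : ℝ) < n := by linarith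
  obtain ⟨t, ht⟩ : ∃ t : ℝ, t = g - a := ⟨_, rfl⟩
  have hgt : (g : ℝ) ≤ 16 * n * t := by
    have := h.expand (inner r (nbr r F))
    rw [nbr_inner_nbr, f3, f4] at this
    rwa [ht]
  have htn : (n : ℝ) ≤ t := by
    have h1 : (16 * n ^ 2 : ℝ) ≤ g := by exact_mod_cast hg
    have h2 : 16 * (n : ℝ) * n ≤ 16 * n * t := by nlinarith
    exact le_of_mul_le_mul_left h2 (by positivity)
  have ht0 : 0 < t := by linarith
  have hρ2 : 0 < ρ ^ 2 := by positivity
  have hLρ : L ≤ ρ / 10 ^ 6 := by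
    rw [le_div_iff₀ (by positivity)]
    nlinarith
  -- parameters
  obtain ⟨M, hM⟩ : ∃ M : ℝ, M = ρ ^ 2 * n / 4 := ⟨_, rfl⟩
  have hM0 : 0 < M := by rw [hM]; positivity
  obtain ⟨p, hp⟩ : ∃ p : ℝ, p = 10 * L / M := ⟨_, rfl⟩
  have hpM : p * M = (10 : ℕ) * Real.log n := by
    rw [hp, div_mul_cancel₀ _ hM0.ne', hL]
    norm_num
  obtain ⟨C, hC⟩ : ∃ C : ℝ, C = p * (g + n * t) + n * (g * Real.exp (-(p * M))) := ⟨_, rfl⟩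
  obtain ⟨w, hw⟩ : ∃ w : ℝ, w = t / ρ ^ 2 := ⟨_, rfl⟩
  have hw0 : 0 < w := by rw [hw]; positivity
  have htw : t = w * ρ ^ 2 := by rw [hw]; field_simp
  have hn8 : (n : ℝ) = ρ ^ 8 := hρ.symm
  have h28 : ρ ^ 2 ≤ ρ ^ 8 := pow_le_pow_right₀ hρ1 (by norm_num)
  have hCle : C ≤ 700 * L * w := by
    have e1 : p * (g + n * t) ≤ 680 * L * w := by
      calc p * (g + n * t) ≤ p * (17 * n * t) := by
            apply mul_le_mul_of_nonneg_left _ (by rw [hp]; positivity)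
            linarith
        _ = 680 * L * w := by rw [hp, hM, hw]; field_simp; norm_num
    have e2 : n * (g * Real.exp (-(p * M))) ≤ 16 * w := by
      rw [hpM, exp_neg_log_mul (by omega)]
      calc (n : ℝ) * (g * (1 / n ^ 10)) ≤ n * ((16 * n * t) * (1 / n ^ 10)) := by gcongr
        _ = 16 * (t / n ^ 8) := by field_simp
        _ ≤ 16 * (t / ρ ^ 2) := by
            gcongr
            calc ρ ^ 2 ≤ n := by rw [hn8]; exact h28
              _ ≤ (n : ℝ) ^ 8 := le_self_pow₀ (by linarith) (by norm_num)
        _ = 16 * w := by rw [hw]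
    rw [hC]
    nlinarith
  have hC0 : 0 ≤ C := by rw [hC]; rw [hp]; positivity
  have hK1 : 1 + (g / M + 4 * t / n) + C ≤ 1000 * L * w := by
    have e1 : 1 ≤ w := by
      rw [hw, one_le_div hρ2]
      exact (h28.trans hn8.symm.le).trans htn
    have e2 : g / M ≤ 64 * w := by
      rw [div_le_iff₀ hM0]
      refine hgt.trans (le_of_eq ?_)
      rw [hM, htw]; ring
    have e3 : 4 * t / n ≤ 4 * w := by
      rw [hw, ← mul_div_assoc]
      gcongr
      rw [hn8]; exact h28
    nlinarith
  have hK2 : (2 * t * ρ ^ 2 + C) / ρ ^ 6 ≤ 1000 * L * w := by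
    rw [div_le_iff₀ (by positivity), htw]
    have h46 : ρ ^ 4 ≤ ρ ^ 6 := pow_le_pow_right₀ hρ1 (by norm_num)
    have h16 : 1 ≤ ρ ^ 6 := one_le_pow₀ hρ1
    have a1 : 2 * (w * ρ ^ 2) * ρ ^ 2 ≤ 2 * w * ρ ^ 6 := by
      have : w * ρ ^ 4 ≤ w * ρ ^ 6 := mul_le_mul_of_nonneg_left h46 hw0.le
      nlinarith
    have hLw : 0 ≤ L * w := by positivity
    have a2 : C ≤ 700 * L * w * ρ ^ 6 := by
      have : L * w * 1 ≤ L * w * ρ ^ 6 := mul_le_mul_of_nonneg_left h16 hLw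
      linarith
    have a3 : 2 * w * ρ ^ 6 ≤ 2 * L * w * ρ ^ 6 := by
      have : 1 * (w * ρ ^ 6) ≤ L * (w * ρ ^ 6) := mul_le_mul_of_nonneg_right hL1 (by positivity)
      linarith
    have a4 : 0 ≤ L * w * ρ ^ 6 := by positivity
    linarith
  have key := h.container_sum hn2 x₀ g a 𝓕 h𝓕 m hm (ρ ^ 2) (ρ ^ 6) (1 / ρ) p M (1000 * L * w) t C
    hρ2.le ?_ (by positivity) ?_ (by rw [hp]; positivity) ?_ hM0 ?_ ht ht0.le hC hK1 hK2
  · rw [← hL] at key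
    have hlog2 : Real.log 2 ≤ 0.6931471808 := Real.log_two_lt_d9.le
    have hlog2' : 0.6931471803 ≤ Real.log 2 := Real.log_two_gt_d9.le
    have hgn : g / (n : ℝ) ^ 2 ≤ 16 * w := by
      rw [div_le_iff₀ (by positivity)]
      refine hgt.trans ?_
      rw [htw]
      have : ρ ^ 2 ≤ n := by rw [hn8]; exact h28
      have := mul_le_mul_of_nonneg_left this (show 0 ≤ 16 * n * w by positivity)
      linarith
    have hLLw : L ^ 2 * w ≤ t / ρ / 10 ^ 6 := by
      rw [htw, div_div, le_div_iff₀ (by positivity)]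
      have := mul_le_mul_of_nonneg_right hρL (show 0 ≤ w * ρ by positivity)
      linarith
    have hLw : L * w ≤ t / ρ / 10 ^ 6 := by
      have h1 : L * w * 1 ≤ L * w * L := mul_le_mul_of_nonneg_left hL1 (by positivity)
      have h2 : L * w * L = L ^ 2 * w := by ring
      linarith
    have hww : w ≤ t / ρ / 10 ^ 6 := by
      have h1 : 1 * w ≤ L * w := mul_le_mul_of_nonneg_right hL1 hw0.le
      linarith
    have hLtρ : L * (t / ρ) ≤ t / 10 ^ 6 := by
      have := mul_le_mul_of_nonneg_right hLρ (show 0 ≤ t / ρ by positivity)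
      refine this.trans (le_of_eq ?_)
      field_simp
    have htρ : t / ρ ≤ t / 10 ^ 6 := by gcongr
    have htg : (g : ℝ) / (32 * n * ρ) ≤ t / ρ / 2 := by
      rw [div_div, div_le_div_iff₀ (by positivity) (by positivity)]
      have := mul_le_mul_of_nonneg_right hgt (show 0 ≤ ρ * 2 by positivity)
      linarith
    have hinv : 1 / ρ * t = t / ρ := by ring
    have hn2' : (1 : ℝ) / n ^ 2 ≤ 1 := by
      rw [div_le_one (by positivity)]
      exact one_le_pow₀ (by linarith)
    refine key.trans ?_
    rw [two_mul (Real.exp _)]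
    refine add_le_add (Real.exp_le_exp.mpr ?_) (Real.exp_le_exp.mpr ?_)
    · have ha : (a : ℝ) = g - t := by rw [ht]; ring
      have e1 : (a : ℝ) * (Real.log 2 + 1 / (n : ℝ) ^ 2) ≤ g * Real.log 2 - t * Real.log 2 + 16 * w := by
        have : (a : ℝ) * (1 / (n : ℝ) ^ 2) ≤ g / (n : ℝ) ^ 2 := by
          rw [mul_one_div]
          have hag : (a : ℝ) ≤ g := by linarith
          exact div_le_div_of_nonneg_right hag (by positivity)
        have h2 : (a : ℝ) * Real.log 2 = g * Real.log 2 - t * Real.log 2 := by rw [ha]; ring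
        rw [mul_add]
        linarith
      rw [hinv]
      have e2 : t * 0.6931471803 ≤ t * Real.log 2 := mul_le_mul_of_nonneg_left hlog2' ht0.le
      have e3 : 30 * L * (1000 * L * w) = 30000 * (L ^ 2 * w) := by ring
      have e4 : 9 * L * (t / ρ) = 9 * (L * (t / ρ)) := by ring
      have e5 : 3 * (1000 * L * w) = 3000 * (L * w) := by ring
      rw [e3, e4, e5]
      linarith
    · have b1 : 2 / n * ((2 * t * ρ ^ 2 + C) + 4 * t * ρ ^ 6) ≤ 20 * w + 1400 * (L * w) := by
        have c1 : 2 * t * ρ ^ 2 ≤ 2 * (w * n) := by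
          rw [htw, hn8]
          have : ρ ^ 4 ≤ ρ ^ 8 := pow_le_pow_right₀ hρ1 (by norm_num)
          have := mul_le_mul_of_nonneg_left this hw0.le
          linarith
        have c2 : 4 * t * ρ ^ 6 = 4 * (w * n) := by rw [htw, hn8]; ring
        have c3 : C ≤ 700 * (L * w) * n := by
          have : L * w * 1 ≤ L * w * n :=
            mul_le_mul_of_nonneg_left (by linarith) (by positivity)
          linarith
        rw [c2]
        calc 2 / n * ((2 * t * ρ ^ 2 + C) + 4 * (w * n))
            ≤ 2 / n * ((2 * (w * n) + 700 * (L * w) * n) + 4 * (w * n)) := by gcongr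
          _ = 12 * w + 1400 * (L * w) := by field_simp; ring
          _ ≤ _ := by linarith
      obtain ⟨β, hβ⟩ : ∃ β, β = 2 / n * ((2 * t * ρ ^ 2 + C) + 4 * t * ρ ^ 6) := ⟨_, rfl⟩
      rw [← hβ] at b1 ⊢
      rw [hinv]
      have hβ0 : 0 ≤ β := by rw [hβ]; positivity
      have d1 : (g - t / ρ + β) * (Real.log 2 + 1 / (n : ℝ) ^ 2)
          ≤ g * Real.log 2 - t / ρ * Real.log 2 + 16 * w + 2 * β := by
        have d2 : (g : ℝ) * (1 / (n : ℝ) ^ 2) ≤ 16 * w := by rw [mul_one_div]; exact hgn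
        have d3 : 0 ≤ t / ρ * (1 / (n : ℝ) ^ 2) := by positivity
        have d4 : β * (Real.log 2 + 1 / (n : ℝ) ^ 2) ≤ β * 2 := by
          gcongr
          linarith
        linarith
      have e2 : t / ρ * 0.6931471803 ≤ t / ρ * Real.log 2 :=
        mul_le_mul_of_nonneg_left hlog2' (by positivity)
      have e3 : 38 * L * (1000 * L * w) = 38000 * (L ^ 2 * w) := by ring
      have e5 : 3 * (1000 * L * w) = 3000 * (L * w) := by ring
      rw [e3, e5]
      linarith [show 0 ≤ t / ρ by positivity]
  · rw [hn8]
    have : ρ ^ 8 = ρ ^ 2 * ρ ^ 6 := by ring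
    have h16 : 8 ≤ ρ ^ 6 := (by linarith : 8 ≤ ρ).trans (le_self_pow₀ hρ1 (by norm_num))
    nlinarith
  · rw [hn8]
    have : ρ ^ 8 = ρ ^ 6 * ρ ^ 2 := by ring
    have h16 : 4 ≤ ρ ^ 2 := (by linarith : 4 ≤ ρ).trans (le_self_pow₀ hρ1 (by norm_num))
    have : 0 < ρ ^ 6 := by positivity
    nlinarith
  · rw [hp, div_le_one hM0, hM]
    have : 1 ≤ ρ ^ 2 := one_le_pow₀ hρ1
    nlinarith
  · rw [hM]
    nlinarith

end LayerGraph
end Bipartite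

lemma sum_le_card_mul_of_fibers {ι κ : Type} [DecidableEq κ] (s : Finset ι) (T : Finset κ)
    (key : ι → κ) (hkey : ∀ i ∈ s, key i ∈ T) (f : ι → ℝ) (B : ℝ)
    (hB : ∀ k ∈ T, ∑ i ∈ s with key i = k, f i ≤ B) : ∑ i ∈ s, f i ≤ T.card * B := by
  rw [← Finset.sum_fiberwise_of_maps_to hkey, ← nsmul_eq_mul]
  exact Finset.sum_le_card_nsmul _ _ _ hB

lemma half_pow_le (g : ℕ) (G : ℝ) (h : G ≤ g) : (1 / 2 : ℝ) ^ g ≤ (1 / 2 : ℝ) ^ G := by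
  rw [← Real.rpow_natCast]
  exact Real.rpow_le_rpow_of_exponent_ge (by norm_num) (by norm_num) h

section Bipartite
variable {X Y : Type} [Fintype X] [Fintype Y] {r : X → Y → Prop} [DecidableEq X] [DecidableEq Y]

lemma Tame.le_exp {m : Finset X → ℝ} {n : ℕ} (hm : Tame m n) (F : Finset X) :
    m F ≤ 2 ^ F.card * Real.exp (F.card / (n : ℝ) ^ 2) :=
  (Finset.single_le_sum (f := m) (fun G _ => hm.1 G) (Finset.mem_powerset_self F)).trans
    (hm.2.2 F)

lemma Tame.le_four_pow {m : Finset X → ℝ} {n : ℕ} (hm : Tame m n) (hn : 2 ≤ n) (F : Finset X) :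
    m F ≤ 4 ^ F.card := by
  refine (hm.le_exp F).trans ?_
  have h4 : (4 : ℝ) ^ F.card = 2 ^ F.card * 2 ^ F.card := by rw [← mul_pow]; norm_num
  rw [h4]
  gcongr
  have h2 : (2 : ℝ) ^ F.card = Real.exp (F.card * Real.log 2) := by
    rw [Real.exp_nat_mul, Real.exp_log two_pos]
  rw [h2]
  apply Real.exp_le_exp.mpr
  rw [div_eq_mul_one_div]
  gcongr
  have hn' : (2 : ℝ) ≤ n := by exact_mod_cast hn
  have : (1 : ℝ) / n ^ 2 ≤ 1 / 2 ^ 2 := by gcongr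
  have := Real.log_two_gt_d9
  norm_num at *
  linarith

lemma Tame.singleton_le {m : Finset X → ℝ} {n : ℕ} (hm : Tame m n) (hn : 2 ≤ n) (x : X) :
    m {x} ≤ 1 + 4 / (n : ℝ) ^ 2 := by
  have h1 := hm.2.2 {x}
  have hps : ({x} : Finset X).powerset = {∅, {x}} := by
    ext S; simp [Finset.subset_singleton_iff]
  rw [hps, Finset.sum_pair (by simp), hm.2.1] at h1
  have hn' : (2 : ℝ) ≤ n := by exact_mod_cast hn
  have h2 : (1 : ℝ) / n ^ 2 ≤ 1 := by
    rw [div_le_one (by positivity)]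
    nlinarith
  have h3 : Real.exp (1 / (n : ℝ) ^ 2) ≤ 1 + 2 * (1 / (n : ℝ) ^ 2) := by
    have h4 := Real.abs_exp_sub_one_le (x := 1 / (n : ℝ) ^ 2) (by
      rw [abs_of_nonneg (by positivity)]; exact h2)
    rw [abs_of_nonneg (a := 1 / (n : ℝ) ^ 2) (by positivity)] at h4
    linarith [le_abs_self (Real.exp (1 / (n : ℝ) ^ 2) - 1)]
  simp only [Finset.card_singleton, pow_one, Nat.cast_one] at h1
  have h5 : 4 / (n : ℝ) ^ 2 = 4 * (1 / (n : ℝ) ^ 2) := by ring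
  linarith

namespace LayerGraph
variable {n : ℕ}

lemma nbr_lower_small (h : LayerGraph r n) (F : Finset X) :
    (F.card : ℝ) * (n / 2 - F.card) ≤ (nbr r F).card := by
  induction F using Finset.induction_on with
  | empty => simp
  | insert x F hx ih =>
    rw [Finset.card_insert_of_notMem hx]
    have h1 : nbr r F ∪ dn r x ⊆ nbr r (insert x F) := by
      intro y hy
      rw [Finset.mem_union, mem_nbr, mem_dn] at hy
      rw [mem_nbr]
      rcases hy with ⟨z, hz, hzy⟩ | hy
      · exact ⟨z, Finset.mem_insert_of_mem hz, hzy⟩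
      · exact ⟨x, Finset.mem_insert_self _ _, hy⟩
    have h2 : (nbr r F ∩ dn r x).card ≤ F.card := by
      have : nbr r F ∩ dn r x ⊆ F.biUnion fun z => dn r x ∩ dn r z := by
        intro y hy
        rw [Finset.mem_inter, mem_nbr] at hy
        obtain ⟨⟨z, hz, hzy⟩, hxy⟩ := hy
        exact Finset.mem_biUnion.mpr ⟨z, hz, Finset.mem_inter.mpr ⟨hxy, mem_dn.mpr hzy⟩⟩
      refine (Finset.card_le_card this).trans ?_
      have := Finset.card_biUnion_le_card_mul F (fun z => dn r x ∩ dn r z) 1 fun z hz =>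
        h.codeg x z (by rintro rfl; exact hx hz)
      simpa using this
    have h3 := Finset.card_le_card h1
    have h4 := Finset.card_union_add_card_inter (nbr r F) (dn r x)
    have h5 : ((nbr r F).card : ℝ) + (dn r x).card ≤ (nbr r (insert x F)).card + F.card := by
      exact_mod_cast (by omega : (nbr r F).card + (dn r x).card ≤ (nbr r (insert x F)).card + F.card)
    have h6 := h.deg_lower x
    push_cast
    nlinarith

lemma card_linked_family_le (h : LayerGraph r n) (x₀ : X) (s : ℕ)
    (𝓕 : Finset (Finset X)) (h𝓕 : ∀ U ∈ 𝓕, x₀ ∈ U ∧ Linked (Adj2 r) U ∧ U.card = s) :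
    𝓕.card ≤ (n * n) ^ (2 * (s - 1)) := by
  refine card_linked_le (H := Adj2 r) (fun a b hab => hab.symm)
      (nb := fun x => ball r 1 {x}) (fun x y hxy => ?_)
      (fun x => ?_) x₀ s 𝓕 h𝓕
  · simpa using hxy.reach
  · simpa using h.card_ball_le 1 {x}

/-- Weight of the linked sets of a given size whose neighbourhoods are at least `s * c`. -/
lemma fiber_sum_le (h : LayerGraph r n) (hn : 2 ≤ n) (x₀ : X) (s : ℕ) (c : ℝ)
    (𝓕 : Finset (Finset X)) (m : Finset X → ℝ) (hm : Tame m n)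
    (h𝓕 : ∀ U ∈ 𝓕, x₀ ∈ U ∧ Linked (Adj2 r) U ∧ U.card = s ∧ s * c ≤ (nbr r U).card) :
    ∑ F ∈ 𝓕, m F * (1 / 2 : ℝ) ^ (nbr r F).card ≤ (4 * n ^ 4 * (1 / 2 : ℝ) ^ c) ^ s := by
  have hcard := h.card_linked_family_le x₀ s 𝓕 fun U hU => ⟨(h𝓕 U hU).1, (h𝓕 U hU).2.1, (h𝓕 U hU).2.2.1⟩
  have hcard' : (𝓕.card : ℝ) ≤ (n ^ 4) ^ s := by
    calc (𝓕.card : ℝ) ≤ ((n * n) ^ (2 * (s - 1)) : ℕ) := by exact_mod_cast hcard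
      _ ≤ ((n * n) ^ (2 * s) : ℕ) := by
          exact_mod_cast Nat.pow_le_pow_right (by positivity) (by omega)
      _ = _ := by push_cast; rw [← pow_two, ← pow_mul, ← pow_mul]; congr 1; ring
  have hterm : ∀ F ∈ 𝓕, m F * (1 / 2 : ℝ) ^ (nbr r F).card ≤ 4 ^ s * ((1 / 2 : ℝ) ^ c) ^ s := by
    intro F hF
    obtain ⟨_, _, h3, h4⟩ := h𝓕 F hF
    have e1 := hm.le_four_pow hn F
    rw [h3] at e1
    have e2 := half_pow_le _ _ h4
    rw [mul_comm (s : ℝ) c, Real.rpow_mul_natCast (by norm_num)] at e2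
    exact mul_le_mul e1 e2 (by positivity) (by positivity)
  calc _ ≤ 𝓕.card • (4 ^ s * ((1 / 2 : ℝ) ^ c) ^ s) := Finset.sum_le_card_nsmul _ _ _ hterm
    _ = 𝓕.card * (4 ^ s * ((1 / 2 : ℝ) ^ c) ^ s) := nsmul_eq_mul _ _
    _ ≤ (n ^ 4) ^ s * (4 ^ s * ((1 / 2 : ℝ) ^ c) ^ s) := by gcongr
    _ = _ := by rw [mul_pow, mul_pow]; ring

end LayerGraph
end Bipartite

/-- The numerical inequalities satisfied by all large `n`. -/
structure BigEnough (n : ℕ) : Prop where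
  two_le : 2 ≤ n
  one_le_log : 1 ≤ Real.log n
  log_le : 10 ^ 6 * Real.log n ^ 2 ≤ (n : ℝ) ^ (1 / 8 : ℝ)
  small : 4 * (n : ℝ) ^ 4 * (1 / 2 : ℝ) ^ (7 * (n : ℝ) / 16) ≤ (1 / 2 : ℝ) ^ (2 * (n : ℝ) / 5)
  medium : 4 * (n : ℝ) ^ 4 * (1 / 2 : ℝ) ^ ((n : ℝ) / (20 * Real.logb 2 n) - 1) ≤ (1 / 2 : ℝ) ^ 32
  total : (n + 1) * ((1 / 2 : ℝ) ^ (2 * (n : ℝ) / 5)) ^ 2 + ((n : ℝ) ^ 10 + 1) * (1 / 2 : ℝ) ^ (2 * n)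
    + (3 ^ n + 1) ^ 2 * (2 * Real.exp (-((n : ℝ) ^ 8 / 64))) ≤ (1 / 2 : ℝ) ^ (3 * (n : ℝ) / 4)

section Bipartite
variable {X Y : Type} [Fintype X] [Fintype Y] {r : X → Y → Prop} [DecidableEq X] [DecidableEq Y]

open Classical in
/-- Total weight of the linked sets containing a vertex. -/
noncomputable def linkedSum (r : X → Y → Prop) (m : Finset X → ℝ) (x₀ : X) : ℝ :=
  ∑ F ∈ Finset.univ.filter fun F : Finset X => x₀ ∈ F ∧ Linked (Adj2 r) F,
    m F * (1 / 2 : ℝ) ^ (nbr r F).card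

namespace LayerGraph
variable {n : ℕ}

lemma card_le_card_nbr (h : LayerGraph r n) (hn : 0 < n) (F : Finset X) :
    F.card ≤ (nbr r F).card := by
  have h1 := h.expand F
  have h2 : (0 : ℝ) ≤ (nbr r F).card := Nat.cast_nonneg _
  have h3 : (0 : ℝ) < 16 * n := by positivity
  have h4 : (0 : ℝ) ≤ (nbr r F).card - F.card := by
    by_contra! hc
    nlinarith
  have : (F.card : ℝ) ≤ (nbr r F).card := by linarith
  exact_mod_cast this

lemma nbr_lower_medium (h : LayerGraph r n) (hn : 2 ≤ n) (F : Finset X) (hF : 0 < F.card)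
    (hle : F.card + (nbr r F).card ≤ n ^ 10) :
    (F.card : ℝ) * (n / (20 * Real.logb 2 n) - 1) ≤ (nbr r F).card := by
  have hn' : (2 : ℝ) ≤ n := by exact_mod_cast hn
  have hl : 0 < Real.logb 2 n := Real.logb_pos (by norm_num) (by linarith)
  have h1 := h.edges F
  have h2 : (F.card : ℝ) * (n / 2) ≤ ∑ x ∈ F, ((dn r x).card : ℝ) := by
    rw [← nsmul_eq_mul]
    exact Finset.card_nsmul_le_sum _ _ _ fun x _ => h.deg_lower x
  have hs : (1 : ℝ) ≤ F.card := by exact_mod_cast hF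
  have hpos : (0 : ℝ) < F.card + (nbr r F).card := by positivity
  have h3 : Real.logb 2 (F.card + (nbr r F).card) ≤ 10 * Real.logb 2 n := by
    have : Real.logb 2 ((n : ℝ) ^ 10) = 10 * Real.logb 2 n := by
      rw [Real.logb_pow]; norm_num
    rw [← this]
    refine Real.logb_le_logb_of_le (by norm_num) hpos ?_
    exact_mod_cast hle
  have h4 : (F.card : ℝ) * (n / 2) ≤ (F.card + (nbr r F).card) * (10 * Real.logb 2 n) :=
    h2.trans (h1.trans (mul_le_mul_of_nonneg_left h3 hpos.le))
  have h5 : (F.card : ℝ) * (n / (20 * Real.logb 2 n)) ≤ F.card + (nbr r F).card := by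
    rw [← mul_div_assoc, div_le_iff₀ (by positivity)]
    linarith
  linarith

/-- Linked sets through a vertex are dominated by the singleton. -/
theorem linkedSum_le (h : LayerGraph r n) (hb : BigEnough n) (hY : Fintype.card Y ≤ 3 ^ n)
    (m : Finset X → ℝ) (hm : Tame m n) (x₀ : X) :
    linkedSum r m x₀ ≤ (1 + 4 / (n : ℝ) ^ 2) * (1 / 2 : ℝ) ^ (dn r x₀).card
      + (1 / 2 : ℝ) ^ (3 * (n : ℝ) / 4) := by
  classical
  have hn := hb.two_le
  have hn0 : 0 < n := by omega
  have hn' : (2 : ℝ) ≤ n := by exact_mod_cast hn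
  obtain ⟨f, hf⟩ : ∃ f : Finset X → ℝ, ∀ F, f F = m F * (1 / 2 : ℝ) ^ (nbr r F).card :=
    ⟨_, fun _ => rfl⟩
  have hf0 : ∀ F, 0 ≤ f F := fun F => by rw [hf]; exact mul_nonneg (hm.1 F) (by positivity)
  obtain ⟨𝓛, h𝓛⟩ : ∃ 𝓛 : Finset (Finset X), 𝓛 = Finset.univ.filter fun F : Finset X =>
    x₀ ∈ F ∧ Linked (Adj2 r) F := ⟨_, rfl⟩
  have hmem : ∀ F ∈ 𝓛, x₀ ∈ F ∧ Linked (Adj2 r) F := fun F hF => by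
    rw [h𝓛, Finset.mem_filter] at hF; exact hF.2
  have hL : linkedSum r m x₀ = ∑ F ∈ 𝓛, f F := by
    rw [linkedSum, h𝓛]
    exact Finset.sum_congr (by congr) fun F _ => (hf F).symm
  have s1 := Finset.sum_filter_add_sum_filter_not 𝓛 (fun F => F.card ≤ 1) f
  have s2 := Finset.sum_filter_add_sum_filter_not (𝓛.filter fun F => ¬ F.card ≤ 1)
    (fun F => 16 * F.card ≤ n) f
  have s3 := Finset.sum_filter_add_sum_filter_not
    ((𝓛.filter fun F => ¬ F.card ≤ 1).filter fun F => ¬ 16 * F.card ≤ n)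
    (fun F => F.card + (nbr r F).card ≤ n ^ 10) f
  have b1 : ∑ F ∈ 𝓛.filter (fun F => F.card ≤ 1), f F
      ≤ (1 + 4 / (n : ℝ) ^ 2) * (1 / 2 : ℝ) ^ (dn r x₀).card := by
    have hsub : 𝓛.filter (fun F => F.card ≤ 1) ⊆ {{x₀}} := by
      intro F hF
      rw [Finset.mem_filter] at hF
      rw [Finset.mem_singleton]
      refine Finset.eq_singleton_iff_unique_mem.mpr ⟨(hmem F hF.1).1, fun y hy => ?_⟩
      exact Finset.card_le_one.mp hF.2 y hy x₀ (hmem F hF.1).1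
    refine (Finset.sum_le_sum_of_subset_of_nonneg hsub fun F _ _ => hf0 F).trans ?_
    have : nbr r {x₀} = dn r x₀ := by ext y; simp
    rw [Finset.sum_singleton, hf, this]
    gcongr
    exact hm.singleton_le hn x₀
  have b2 : ∑ F ∈ (𝓛.filter fun F => ¬ F.card ≤ 1).filter (fun F => 16 * F.card ≤ n), f F
      ≤ (n + 1) * ((1 / 2 : ℝ) ^ (2 * (n : ℝ) / 5)) ^ 2 := by
    have := sum_le_card_mul_of_fibers
      ((𝓛.filter fun F => ¬ F.card ≤ 1).filter (fun F => 16 * F.card ≤ n)) (Finset.range (n + 1))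
      Finset.card (fun F hF => by
        rw [Finset.mem_filter] at hF; rw [Finset.mem_range]; omega) f
      (((1 / 2 : ℝ) ^ (2 * (n : ℝ) / 5)) ^ 2) (fun s _ => ?_)
    · simpa using this
    · rcases lt_or_ge 1 s with hs | hs
      · simp only [hf]
        refine (h.fiber_sum_le hn x₀ s (7 * n / 16) _ m hm fun F hF => ?_).trans ?_
        · simp only [Finset.mem_filter] at hF
          obtain ⟨⟨⟨hF, _⟩, h16⟩, rfl⟩ := hF
          refine ⟨(hmem F hF).1, (hmem F hF).2, rfl, le_trans ?_ (h.nbr_lower_small F)⟩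
          gcongr
          have : (16 * F.card : ℝ) ≤ n := by exact_mod_cast h16
          linarith
        · refine (pow_le_pow_left₀ (by positivity) hb.small s).trans ?_
          exact pow_le_pow_of_le_one (by positivity)
            (Real.rpow_le_one (by norm_num) (by norm_num) (by positivity)) hs
      · rw [Finset.sum_eq_zero]
        · positivity
        · intro F hF
          simp only [Finset.mem_filter] at hF
          omega
  have b3 : ∑ F ∈ ((𝓛.filter fun F => ¬ F.card ≤ 1).filter fun F => ¬ 16 * F.card ≤ n).filter
      (fun F => F.card + (nbr r F).card ≤ n ^ 10), f F
      ≤ ((n : ℝ) ^ 10 + 1) * (1 / 2 : ℝ) ^ (2 * n) := by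
    have := sum_le_card_mul_of_fibers
      (((𝓛.filter fun F => ¬ F.card ≤ 1).filter fun F => ¬ 16 * F.card ≤ n).filter
      (fun F => F.card + (nbr r F).card ≤ n ^ 10)) (Finset.range (n ^ 10 + 1))
      Finset.card (fun F hF => by
        rw [Finset.mem_filter] at hF; rw [Finset.mem_range]; omega) f
      ((1 / 2 : ℝ) ^ (2 * n)) (fun s _ => ?_)
    · simpa using this
    · rcases lt_or_ge n (16 * s) with hs | hs
      · simp only [hf]
        refine (h.fiber_sum_le hn x₀ s (n / (20 * Real.logb 2 n) - 1) _ m hm fun F hF => ?_).trans ?_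
        · simp only [Finset.mem_filter] at hF
          obtain ⟨⟨⟨⟨hF, h1⟩, h16⟩, h10⟩, rfl⟩ := hF
          exact ⟨(hmem F hF).1, (hmem F hF).2, rfl, h.nbr_lower_medium hn F (by omega) h10⟩
        · refine (pow_le_pow_left₀ (by positivity) hb.medium s).trans ?_
          rw [← pow_mul]
          exact pow_le_pow_of_le_one (by norm_num) (by norm_num) (by omega)
      · rw [Finset.sum_eq_zero]
        · positivity
        · intro F hF
          simp only [Finset.mem_filter] at hF
          omega
  have b4 : ∑ F ∈ ((𝓛.filter fun F => ¬ F.card ≤ 1).filter fun F => ¬ 16 * F.card ≤ n).filter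
      (fun F => ¬ F.card + (nbr r F).card ≤ n ^ 10), f F
      ≤ (3 ^ n + 1) ^ 2 * (2 * Real.exp (-((n : ℝ) ^ 8 / 64))) := by
    have hgY : ∀ F : Finset X, (nbr r F).card ≤ 3 ^ n := fun F =>
      (Finset.card_le_univ _).trans hY
    have := sum_le_card_mul_of_fibers
      (((𝓛.filter fun F => ¬ F.card ≤ 1).filter fun F => ¬ 16 * F.card ≤ n).filter
      (fun F => ¬ F.card + (nbr r F).card ≤ n ^ 10))
      (Finset.range (3 ^ n + 1) ×ˢ Finset.range (3 ^ n + 1))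
      (fun F => ((nbr r F).card, (inner r (nbr r F)).card)) (fun F _ => by
        have h1 := hgY F
        have h2 := h.card_le_card_nbr hn0 (inner r (nbr r F))
        rw [nbr_inner_nbr] at h2
        rw [Finset.mem_product, Finset.mem_range, Finset.mem_range]
        omega) f
      (2 * Real.exp (-((n : ℝ) ^ 8 / 64))) (fun k _ => ?_)
    · rw [Finset.card_product, Finset.card_range] at this
      push_cast at this
      rw [pow_two ((3 : ℝ) ^ n + 1)]
      exact this
    · obtain ⟨g, a⟩ := k
      rcases lt_or_ge (2 * g) (n ^ 10) with hg | hg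
      · rw [Finset.sum_eq_zero]
        · positivity
        · intro F hF
          simp only [Finset.mem_filter, Prod.mk.injEq] at hF
          have := h.card_le_card_nbr hn0 F
          omega
      · have hgn : 16 * n ^ 2 ≤ g := by
          have : 2 ^ 8 ≤ n ^ 8 := Nat.pow_le_pow_left hn 8
          have : n ^ 10 = n ^ 8 * n ^ 2 := by ring
          nlinarith
        have key := h.large_sum ((n : ℝ) ^ (1 / 8 : ℝ))
          (by rw [← Real.rpow_natCast, ← Real.rpow_mul (by positivity)]; norm_num)
          hb.one_le_log hb.log_le x₀ g a
          (Finset.filter (fun F => ((nbr r F).card, (inner r (nbr r F)).card) = (g, a))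
            (((𝓛.filter fun F => ¬ F.card ≤ 1).filter fun F => ¬ 16 * F.card ≤ n).filter
              (fun F => ¬ F.card + (nbr r F).card ≤ n ^ 10))) (fun F hF => by
            simp only [Finset.mem_filter, Prod.mk.injEq] at hF
            exact ⟨(hmem F hF.1.1.1.1).1, (hmem F hF.1.1.1.1).2, hF.2.1, hF.2.2⟩) m hm hgn
        have hpow : (1 / 2 : ℝ) ^ g = Real.exp (-(g * Real.log 2)) := by
          rw [Real.exp_neg, Real.exp_nat_mul, Real.exp_log two_pos, one_div, inv_pow]
        calc _ = ∑ F ∈ Finset.filter (fun F => ((nbr r F).card, (inner r (nbr r F)).card) = (g, a))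
                (((𝓛.filter fun F => ¬ F.card ≤ 1).filter fun F => ¬ 16 * F.card ≤ n).filter
                  (fun F => ¬ F.card + (nbr r F).card ≤ n ^ 10)), m F * (1 / 2 : ℝ) ^ g := by
              refine Finset.sum_congr rfl fun F hF => ?_
              simp only [Finset.mem_filter, Prod.mk.injEq] at hF
              rw [hf, hF.2.1]
          _ ≤ (2 * Real.exp (g * Real.log 2 - g / (32 * n * (n : ℝ) ^ (1 / 8 : ℝ))))
                * (1 / 2 : ℝ) ^ g := by
              rw [← Finset.sum_mul]
              gcongr
          _ = 2 * Real.exp (-(g / (32 * n * (n : ℝ) ^ (1 / 8 : ℝ)))) := by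
              rw [hpow, mul_assoc, ← Real.exp_add]
              congr 2
              ring
          _ ≤ _ := by
              refine mul_le_mul_of_nonneg_left (Real.exp_le_exp.mpr (neg_le_neg ?_)) (by norm_num)
              have hρ : (n : ℝ) ^ (1 / 8 : ℝ) ≤ n := by
                conv_rhs => rw [← Real.rpow_one (n : ℝ)]
                exact Real.rpow_le_rpow_of_exponent_le (by linarith) (by norm_num)
              rw [div_le_div_iff₀ (by norm_num) (by positivity)]
              have hg' : (n : ℝ) ^ 10 ≤ 2 * g := by exact_mod_cast hg
              calc (n : ℝ) ^ 8 * (32 * n * (n : ℝ) ^ (1 / 8 : ℝ))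
                  ≤ (n : ℝ) ^ 8 * (32 * n * n) := by gcongr
                _ = 32 * (n : ℝ) ^ 10 := by ring
                _ ≤ _ := by linarith
  have := hb.total
  rw [hL]
  linarith

end LayerGraph
end Bipartite

lemma eventually_pow_mul_half_rpow_le {c ε : ℝ} (hc : 0 < c) (hε : 0 < ε) (k : ℕ) :
    ∀ᶠ n : ℕ in atTop, (n : ℝ) ^ k * (1 / 2 : ℝ) ^ (c * (n : ℝ)) ≤ ε := by
  have hr0 : (0 : ℝ) < (1 / 2 : ℝ) ^ c := by positivity
  have hr1 : (1 / 2 : ℝ) ^ c < 1 := Real.rpow_lt_one (by norm_num) (by norm_num) hc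
  have := tendsto_pow_const_mul_const_pow_of_abs_lt_one k
    (show |(1 / 2 : ℝ) ^ c| < 1 by rwa [abs_of_pos hr0])
  filter_upwards [this.eventually_le_const hε] with n hn
  rwa [Real.rpow_mul (by norm_num), Real.rpow_natCast]

lemma eventually_mul_log_sq_le {c : ℝ} (hc : 0 < c) (K : ℝ) :
    ∀ᶠ n : ℕ in atTop, K * Real.log n ^ 2 ≤ (n : ℝ) ^ c := by
  have h := (Real.isLittleO_pow_log_id_atTop (n := 2)).comp_tendsto
    (tendsto_rpow_atTop hc)
  have h2 := (h.bound (show (0 : ℝ) < c ^ 2 / (|K| + 1) by positivity))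
  have h3 := tendsto_natCast_atTop_atTop (R := ℝ) |>.eventually h2
  filter_upwards [h3, eventually_ge_atTop 1] with n hn hn1
  have hnpos : (0 : ℝ) < n := by exact_mod_cast hn1
  simp only [Function.comp, id, Real.log_rpow hnpos, Real.norm_eq_abs] at hn
  rw [abs_of_nonneg (by positivity), abs_of_pos (Real.rpow_pos_of_pos hnpos c), mul_pow,
    div_mul_eq_mul_div, le_div_iff₀ (by positivity), mul_assoc] at hn
  have h4 := le_of_mul_le_mul_left hn (by positivity)
  refine le_trans ?_ h4
  rw [mul_comm]
  gcongr
  linarith [le_abs_self K]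

lemma half_rpow_eq_exp (x : ℝ) : (1 / 2 : ℝ) ^ x = Real.exp (-(x * Real.log 2)) := by
  rw [Real.rpow_def_of_pos (by norm_num), one_div, Real.log_inv]
  ring_nf

lemma medium_bound {n : ℕ} (h2 : 2 ≤ n) (hlog : 1 ≤ Real.log n)
    (hle : 10 ^ 6 * Real.log n ^ 2 ≤ (n : ℝ) ^ (1 / 8 : ℝ)) :
    4 * (n : ℝ) ^ 4 * (1 / 2 : ℝ) ^ ((n : ℝ) / (20 * Real.logb 2 n) - 1) ≤ (1 / 2 : ℝ) ^ 32 := by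
  have hn : (2 : ℝ) ≤ n := by exact_mod_cast h2
  have hnpos : (0 : ℝ) < n := by linarith
  have l2 : 0.69 < Real.log 2 := lt_trans (by norm_num) Real.log_two_gt_d9
  have l2' : Real.log 2 < 0.7 := lt_trans Real.log_two_lt_d9 (by norm_num)
  obtain ⟨L, hL⟩ : ∃ L, L = Real.logb 2 n := ⟨_, rfl⟩
  have hlogL : Real.log n = L * Real.log 2 := by
    rw [hL, Real.logb, div_mul_cancel₀ _ (by linarith)]
  have hL1 : 1 ≤ L := by
    by_contra! hc
    nlinarith
  have hn1 : (n : ℝ) ^ (1 / 8 : ℝ) ≤ n := by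
    conv_rhs => rw [← Real.rpow_one (n : ℝ)]
    exact Real.rpow_le_rpow_of_exponent_le (by linarith) (by norm_num)
  have hLn : 1000 * L ^ 2 ≤ n := by
    refine le_trans ?_ (hle.trans hn1)
    rw [hlogL, mul_pow]
    have : (0.69 : ℝ) ^ 2 ≤ Real.log 2 ^ 2 := by gcongr
    nlinarith [sq_nonneg L]
  have key : 35 + 4 * L ≤ n / (20 * L) := by
    rw [le_div_iff₀ (by positivity)]
    nlinarith
  rw [← hL]
  have e1 : (n : ℝ) ^ 4 = (1 / 2 : ℝ) ^ (-(4 * L)) := by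
    rw [half_rpow_eq_exp, ← Real.exp_log (pow_pos hnpos 4), Real.log_pow, hlogL]
    push_cast
    ring_nf
  have e2 : (4 : ℝ) = (1 / 2 : ℝ) ^ (-2 : ℝ) := by
    rw [Real.rpow_neg (by norm_num)]; norm_num
  have e3 : (1 / 2 : ℝ) ^ 32 = (1 / 2 : ℝ) ^ (32 : ℝ) := by
    rw [← Real.rpow_natCast]; norm_num
  rw [e1, e3]
  nth_rewrite 1 [e2]
  rw [← Real.rpow_add (by norm_num), ← Real.rpow_add (by norm_num)]
  exact Real.rpow_le_rpow_of_exponent_ge (by norm_num) (by norm_num) (by linarith)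

lemma eventually_exp_term_le :
    ∀ᶠ n : ℕ in atTop, (3 ^ n + 1) ^ 2 * (2 * Real.exp (-((n : ℝ) ^ 8 / 64)))
      ≤ (1 / 4 : ℝ) * (1 / 2 : ℝ) ^ (3 * (n : ℝ) / 4) := by
  filter_upwards [eventually_ge_atTop 4] with n hn
  have hn' : (4 : ℝ) ≤ n := by exact_mod_cast hn
  have h1 : ((3 : ℝ) ^ n + 1) ^ 2 ≤ Real.exp (6 * n) := by
    have : ((3 : ℝ) ^ n + 1) ≤ Real.exp (3 * n) := by
      have h3 : (3 : ℝ) ≤ Real.exp 2 := by linarith [Real.add_one_le_exp 2]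
      have h5 : (3 : ℝ) ^ n + 1 ≤ 3 ^ n * 2 := by
        linarith [one_le_pow₀ (M₀ := ℝ) (a := 3) (n := n) (by norm_num)]
      have h6 : (3 : ℝ) ^ n ≤ Real.exp (n * 2) := by
        rw [Real.exp_nat_mul]
        gcongr
      have h7 : (2 : ℝ) ≤ Real.exp n := by linarith [Real.add_one_le_exp (n : ℝ)]
      calc (3 : ℝ) ^ n + 1 ≤ Real.exp (n * 2) * Real.exp n := h5.trans (by gcongr)
        _ = _ := by rw [← Real.exp_add]; ring_nf
    calc ((3 : ℝ) ^ n + 1) ^ 2 ≤ Real.exp (3 * n) ^ 2 := by gcongr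
      _ = _ := by rw [← Real.exp_nat_mul]; push_cast; ring_nf
  have h2 : (2 : ℝ) ≤ Real.exp 1 := by linarith [Real.add_one_le_exp 1]
  have h4 : (1 / 4 : ℝ) = (1 / 2 : ℝ) ^ (2 : ℝ) := by norm_num
  have l2' : Real.log 2 < 0.7 := lt_trans Real.log_two_lt_d9 (by norm_num)
  have l2 : 0 < Real.log 2 := Real.log_pos (by norm_num)
  rw [h4, half_rpow_eq_exp, half_rpow_eq_exp]
  calc _ ≤ Real.exp (6 * n) * (Real.exp 1 * Real.exp (-((n : ℝ) ^ 8 / 64))) := by gcongr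
    _ = Real.exp (6 * n + 1 - (n : ℝ) ^ 8 / 64) := by
      rw [← Real.exp_add, ← Real.exp_add]; ring_nf
    _ ≤ Real.exp (-(2 * Real.log 2) + -(3 * n / 4 * Real.log 2)) := by
      refine Real.exp_le_exp.mpr ?_
      have : (4 : ℝ) ^ 7 * n ≤ (n : ℝ) ^ 8 := by
        rw [pow_succ (n : ℝ) 7]
        gcongr
      nlinarith
    _ = _ := by rw [Real.exp_add]

theorem eventually_bigEnough : ∀ᶠ n : ℕ in atTop, BigEnough n := by
  have hlog : ∀ᶠ n : ℕ in atTop, 1 ≤ Real.log n :=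
    (Real.tendsto_log_atTop.comp tendsto_natCast_atTop_atTop).eventually_ge_atTop 1
  filter_upwards [eventually_ge_atTop 2, hlog,
    eventually_mul_log_sq_le (show (0 : ℝ) < 1 / 8 by norm_num) (10 ^ 6),
    eventually_pow_mul_half_rpow_le (show (0 : ℝ) < 3 / 80 by norm_num)
      (show (0 : ℝ) < 1 / 4 by norm_num) 4,
    eventually_pow_mul_half_rpow_le (show (0 : ℝ) < 1 / 20 by norm_num)
      (show (0 : ℝ) < 1 / 8 by norm_num) 1,
    eventually_pow_mul_half_rpow_le (show (0 : ℝ) < 5 / 4 by norm_num)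
      (show (0 : ℝ) < 1 / 8 by norm_num) 10,
    eventually_exp_term_le] with n h2 hl hle hs ht1 ht2 ht3
  have hn : (2 : ℝ) ≤ n := by exact_mod_cast h2
  refine ⟨h2, hl, hle, ?_, medium_bound h2 hl hle, ?_⟩
  · have : (1 / 2 : ℝ) ^ (7 * (n : ℝ) / 16)
        = (1 / 2 : ℝ) ^ (3 / 80 * (n : ℝ)) * (1 / 2 : ℝ) ^ (2 * (n : ℝ) / 5) := by
      rw [← Real.rpow_add (by norm_num)]; ring_nf
    rw [this, ← mul_assoc]
    refine mul_le_of_le_one_left (by positivity) ?_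
    linarith
  · have e1 : ((1 / 2 : ℝ) ^ (2 * (n : ℝ) / 5)) ^ 2
        = (1 / 2 : ℝ) ^ (1 / 20 * (n : ℝ)) * (1 / 2 : ℝ) ^ (3 * (n : ℝ) / 4) := by
      rw [← Real.rpow_natCast, ← Real.rpow_mul (by norm_num), ← Real.rpow_add (by norm_num)]
      push_cast
      ring_nf
    have e2 : (1 / 2 : ℝ) ^ (2 * n)
        = (1 / 2 : ℝ) ^ (5 / 4 * (n : ℝ)) * (1 / 2 : ℝ) ^ (3 * (n : ℝ) / 4) := by
      rw [← Real.rpow_natCast, ← Real.rpow_add (by norm_num)]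
      push_cast
      ring_nf
    rw [e1, e2]
    obtain ⟨P, hP⟩ : ∃ P, P = (1 / 2 : ℝ) ^ (3 * (n : ℝ) / 4) := ⟨_, rfl⟩
    obtain ⟨A, hA⟩ : ∃ A, A = (1 / 2 : ℝ) ^ (1 / 20 * (n : ℝ)) := ⟨_, rfl⟩
    obtain ⟨B, hB⟩ : ∃ B, B = (1 / 2 : ℝ) ^ (5 / 4 * (n : ℝ)) := ⟨_, rfl⟩
    have hP0 : 0 ≤ P := by rw [hP]; positivity
    have hA0 : 0 ≤ A := by rw [hA]; positivity
    have hB0 : 0 ≤ B := by rw [hB]; positivity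
    rw [← hP] at ht3 ⊢
    rw [← hA] at ht1 ⊢
    rw [← hB] at ht2 ⊢
    have k1 : (n + 1) * A ≤ 1 / 4 := by
      rw [pow_one] at ht1
      nlinarith
    have k2 : ((n : ℝ) ^ 10 + 1) * B ≤ 1 / 4 := by
      have : (1 : ℝ) ≤ (n : ℝ) ^ 10 := one_le_pow₀ (by linarith)
      nlinarith
    have k3 := mul_le_mul_of_nonneg_right k1 hP0
    have k4 := mul_le_mul_of_nonneg_right k2 hP0
    linarith

/-- The poset `[3]^n`. -/
abbrev Cube (n : ℕ) := Fin n → Fin 3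

section Cube
variable {n k : ℕ}

/-- The rank of an element: the sum of its coordinates. -/
def rk (x : Cube n) : ℕ := ∑ i, (x i : ℕ)

/-- The layer of rank `k`. -/
abbrev Lay (n k : ℕ) := {x : Cube n // rk x = k}

/-- The order relation between consecutive layers. -/
def below (n k : ℕ) : Lay n (k + 1) → Lay n k → Prop := fun x y => y.1 ≤ x.1

/-- The number of coordinates equal to `c`. -/
def cnt (x : Cube n) (c : Fin 3) : ℕ := (Finset.univ.filter fun i => x i = c).card

lemma sum_update_add (g : Fin 3 → ℕ) (x : Cube n) (i : Fin n) (c : Fin 3) :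
    ∑ j, g (Function.update x i c j) + g (x i) = ∑ j, g (x j) + g c := by
  rw [← Finset.add_sum_erase _ _ (Finset.mem_univ i),
    ← Finset.add_sum_erase Finset.univ (fun j => g (x j)) (Finset.mem_univ i)]
  have : ∑ j ∈ Finset.univ.erase i, g (Function.update x i c j)
      = ∑ j ∈ Finset.univ.erase i, g (x j) :=
    Finset.sum_congr rfl fun j hj => by
      rw [Function.update_of_ne (Finset.ne_of_mem_erase hj)]
  rw [this, Function.update_self]
  ring

lemma rk_update (x : Cube n) (i : Fin n) (c : Fin 3) :
    rk (Function.update x i c) + (x i : ℕ) = rk x + (c : ℕ) :=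
  sum_update_add (fun a => (a : ℕ)) x i c

lemma cnt_eq_sum (x : Cube n) (c : Fin 3) : cnt x c = ∑ i, if x i = c then 1 else 0 := by
  rw [cnt, Finset.card_filter]

lemma cnt_update (x : Cube n) (i : Fin n) (c d : Fin 3) :
    cnt (Function.update x i c) d + (if x i = d then 1 else 0)
      = cnt x d + (if c = d then 1 else 0) := by
  rw [cnt_eq_sum, cnt_eq_sum]
  exact sum_update_add (fun a => if a = d then 1 else 0) x i c

lemma cnt_add (x : Cube n) : cnt x 0 + cnt x 1 + cnt x 2 = n := by
  rw [cnt_eq_sum, cnt_eq_sum, cnt_eq_sum, ← Finset.sum_add_distrib, ← Finset.sum_add_distrib]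
  rw [Finset.sum_congr rfl (g := fun _ => 1)]
  · simp
  · intro i _
    generalize x i = a
    revert a
    decide

lemma rk_eq_cnt (x : Cube n) : rk x = cnt x 1 + 2 * cnt x 2 := by
  rw [rk, cnt_eq_sum, cnt_eq_sum, Finset.mul_sum, ← Finset.sum_add_distrib]
  refine Finset.sum_congr rfl fun i _ => ?_
  generalize x i = a
  revert a
  decide

lemma rk_mono {x y : Cube n} (h : x ≤ y) : rk x ≤ rk y :=
  Finset.sum_le_sum fun i _ => Fin.le_def.mp (h i)

lemma eq_of_le_of_rk_le {x y : Cube n} (h : x ≤ y) (hr : rk y ≤ rk x) : x = y := by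
  have h1 : ∀ i ∈ Finset.univ, (x i : ℕ) ≤ (y i : ℕ) := fun i _ => Fin.le_def.mp (h i)
  have h2 := (Finset.sum_eq_sum_iff_of_le h1).mp (le_antisymm (rk_mono h) hr)
  funext i
  exact Fin.ext (h2 i (Finset.mem_univ i))

lemma exists_lt_of_le_of_ne {x y : Cube n} (h : y ≤ x) (hne : y ≠ x) : ∃ i, y i < x i := by
  by_contra! hc
  exact hne (le_antisymm h hc)

lemma exists_update_of_cover {x y : Cube n} (h : y ≤ x) (hr : rk x = rk y + 1) :
    ∃ i, (x i : ℕ) = y i + 1 ∧ y = Function.update x i (y i) ∧ x = Function.update y i (x i) := by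
  obtain ⟨i, hi⟩ := exists_lt_of_le_of_ne h (by rintro rfl; omega)
  have hle : Function.update y i (x i) ≤ x := by
    intro j
    rcases eq_or_ne j i with rfl | hj
    · simp
    · rw [Function.update_of_ne hj]; exact h j
  have h1 := rk_update y i (x i)
  have h2 := Fin.lt_def.mp hi
  have h3 := eq_of_le_of_rk_le hle (by omega)
  rw [h3] at h1
  refine ⟨i, by omega, ?_, h3.symm⟩
  rw [← h3]
  simp

lemma val_sub_one {a : Fin 3} (h : a ≠ 0) : ((a - 1 : Fin 3) : ℕ) + 1 = a := by
  revert a; decide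

lemma val_add_one {a : Fin 3} (h : a ≠ 2) : ((a + 1 : Fin 3) : ℕ) = a + 1 := by
  revert a; decide

lemma update_le {x : Cube n} {i : Fin n} {c : Fin 3} (h : c ≤ x i) : Function.update x i c ≤ x := by
  intro j
  rcases eq_or_ne j i with rfl | hj
  · simpa using h
  · rw [Function.update_of_ne hj]

lemma le_update {x : Cube n} {i : Fin n} {c : Fin 3} (h : x i ≤ c) : x ≤ Function.update x i c := by
  intro j
  rcases eq_or_ne j i with rfl | hj
  · simpa using h
  · rw [Function.update_of_ne hj]

lemma rk_dec (x : Lay n (k + 1)) {i : Fin n} (hi : x.1 i ≠ 0) :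
    rk (Function.update x.1 i (x.1 i - 1)) = k := by
  have h1 := rk_update x.1 i (x.1 i - 1)
  have h2 := val_sub_one hi
  have h3 := x.2
  omega

lemma rk_inc (y : Lay n k) {i : Fin n} (hi : y.1 i ≠ 2) :
    rk (Function.update y.1 i (y.1 i + 1)) = k + 1 := by
  have h1 := rk_update y.1 i (y.1 i + 1)
  have h2 := val_add_one hi
  have h3 := y.2
  omega

lemma sum_dn (x : Lay n (k + 1)) (f : Cube n → ℝ) :
    ∑ y ∈ dn (below n k) x, f y.1
      = ∑ i ∈ Finset.univ.filter (fun i => x.1 i ≠ 0), f (Function.update x.1 i (x.1 i - 1)) := by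
  symm
  refine Finset.sum_bij
    (fun i hi => ⟨Function.update x.1 i (x.1 i - 1), rk_dec x (Finset.mem_filter.mp hi).2⟩)
    ?_ ?_ ?_ ?_
  · intro i hi
    have hi := (Finset.mem_filter.mp hi).2
    rw [mem_dn]
    refine update_le (Fin.le_def.mpr ?_)
    have := val_sub_one hi
    omega
  · intro i hi j hj hij
    have hi := (Finset.mem_filter.mp hi).2
    by_contra hne
    have h1 := congrFun (congrArg Subtype.val hij) i
    simp only [Function.update_self, Function.update_of_ne hne] at h1
    have := val_sub_one hi
    rw [h1] at this
    omega
  · intro y hy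
    rw [mem_dn] at hy
    obtain ⟨i, h1, h2, -⟩ := exists_update_of_cover hy (by rw [x.2, y.2])
    have hi : x.1 i ≠ 0 := by
      intro h0
      rw [h0] at h1
      simp at h1
    refine ⟨i, by simp [hi], ?_⟩
    apply Subtype.ext
    dsimp only
    rw [show x.1 i - 1 = y.1 i from ?_, ← h2]
    apply Fin.ext
    have := val_sub_one hi
    omega
  · intro i hi
    rfl

lemma sum_up (y : Lay n k) (f : Cube n → ℝ) :
    ∑ x ∈ up (below n k) y, f x.1
      = ∑ i ∈ Finset.univ.filter (fun i => y.1 i ≠ 2), f (Function.update y.1 i (y.1 i + 1)) := by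
  symm
  refine Finset.sum_bij
    (fun i hi => ⟨Function.update y.1 i (y.1 i + 1), rk_inc y (Finset.mem_filter.mp hi).2⟩)
    ?_ ?_ ?_ ?_
  · intro i hi
    have hi := (Finset.mem_filter.mp hi).2
    rw [mem_up]
    refine le_update (Fin.le_def.mpr ?_)
    have := val_add_one hi
    omega
  · intro i hi j hj hij
    have hi := (Finset.mem_filter.mp hi).2
    by_contra hne
    have h1 := congrFun (congrArg Subtype.val hij) i
    simp only [Function.update_self, Function.update_of_ne hne] at h1
    have := val_add_one hi
    rw [h1] at this
    omega
  · intro x hx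
    rw [mem_up] at hx
    obtain ⟨i, h1, -, h2⟩ := exists_update_of_cover hx (by rw [x.2, y.2])
    have hi : y.1 i ≠ 2 := by
      intro h0
      rw [h0] at h1
      have := (x.1 i).2
      simp at h1
      omega
    refine ⟨i, by simp [hi], ?_⟩
    apply Subtype.ext
    dsimp only
    rw [show y.1 i + 1 = x.1 i from ?_, ← h2]
    apply Fin.ext
    have := val_add_one hi
    omega
  · intro i hi
    rfl

lemma sum_filter_ne_zero (x : Cube n) (g : Fin n → ℝ) (a b : ℝ) (ha : ∀ i, x i = 1 → g i = a)
    (hb : ∀ i, x i = 2 → g i = b) :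
    ∑ i ∈ Finset.univ.filter (fun i => x i ≠ 0), g i = cnt x 1 * a + cnt x 2 * b := by
  rw [cnt_eq_sum, cnt_eq_sum, Finset.sum_filter]
  push_cast
  rw [Finset.sum_mul, Finset.sum_mul, ← Finset.sum_add_distrib]
  refine Finset.sum_congr rfl fun i _ => ?_
  have h3 : x i = 0 ∨ x i = 1 ∨ x i = 2 := by
    generalize x i = c; revert c; decide
  rcases h3 with h | h | h
  · simp [h]
  · simp [h, ha i h]
  · simp [h, hb i h]

lemma sum_filter_ne_two (x : Cube n) (g : Fin n → ℝ) (a b : ℝ) (ha : ∀ i, x i = 0 → g i = a)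
    (hb : ∀ i, x i = 1 → g i = b) :
    ∑ i ∈ Finset.univ.filter (fun i => x i ≠ 2), g i = cnt x 0 * a + cnt x 1 * b := by
  rw [cnt_eq_sum, cnt_eq_sum, Finset.sum_filter]
  push_cast
  rw [Finset.sum_mul, Finset.sum_mul, ← Finset.sum_add_distrib]
  refine Finset.sum_congr rfl fun i _ => ?_
  have h3 : x i = 0 ∨ x i = 1 ∨ x i = 2 := by
    generalize x i = c; revert c; decide
  rcases h3 with h | h | h
  · simp [h, ha i h]
  · simp [h, hb i h]
  · simp [h]

lemma card_dn (x : Lay n (k + 1)) : (dn (below n k) x).card = cnt x.1 1 + cnt x.1 2 := by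
  have h := sum_dn x (fun _ => 1)
  rw [sum_filter_ne_zero x.1 _ 1 1 (fun _ _ => rfl) (fun _ _ => rfl)] at h
  simp only [Finset.sum_const, nsmul_eq_mul, mul_one] at h
  exact_mod_cast h

lemma card_up (y : Lay n k) : (up (below n k) y).card = cnt y.1 0 + cnt y.1 1 := by
  have h := sum_up y (fun _ => 1)
  rw [sum_filter_ne_two y.1 _ 1 1 (fun _ _ => rfl) (fun _ _ => rfl)] at h
  simp only [Finset.sum_const, nsmul_eq_mul, mul_one] at h
  exact_mod_cast h

lemma cnt_zero_anti {x y : Cube n} (h : y ≤ x) : cnt x 0 ≤ cnt y 0 := by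
  refine Finset.card_le_card fun i hi => ?_
  simp only [Finset.mem_filter, Finset.mem_univ, true_and] at hi ⊢
  have := h i
  rw [hi] at this
  exact Fin.le_zero_iff.mp this

end Cube

section Edges
variable {n : ℕ}

lemma mul_logb_add_le {a b : ℝ} (ha : 1 ≤ a) (hab : a ≤ b) :
    a * Real.logb 2 a + b * Real.logb 2 b + a ≤ (a + b) * Real.logb 2 (a + b) := by
  have h1 : Real.logb 2 a + 1 ≤ Real.logb 2 (a + b) := by
    have : Real.logb 2 a + 1 = Real.logb 2 (a * 2) := by
      rw [Real.logb_mul (by linarith) (by norm_num), Real.logb_self_eq_one (by norm_num)]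
    rw [this]
    exact Real.logb_le_logb_of_le (by norm_num) (by linarith) (by linarith)
  have h2 : Real.logb 2 b ≤ Real.logb 2 (a + b) :=
    Real.logb_le_logb_of_le (by norm_num) (by linarith) (by linarith)
  nlinarith

open Classical in
/-- The covering pairs inside a set. -/
noncomputable def coverPairs (W : Finset (Cube n)) : Finset (Cube n × Cube n) :=
  (W ×ˢ W).filter fun p => p.1 ≤ p.2 ∧ rk p.2 = rk p.1 + 1

lemma mem_coverPairs {W : Finset (Cube n)} {p : Cube n × Cube n} :
    p ∈ coverPairs W ↔ p.1 ∈ W ∧ p.2 ∈ W ∧ p.1 ≤ p.2 ∧ rk p.2 = rk p.1 + 1 := by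
  simp [coverPairs, and_assoc]

/-- Covering pairs separated by a threshold in a coordinate form a matching. -/
lemma cover_cross_eq {u v : Cube n} (h : u ≤ v) (hr : rk v = rk u + 1) {i : Fin n} {c : Fin 3}
    (hu : u i ≤ c) (hv : c < v i) :
    v = Function.update u i (u i + 1) ∧ u = Function.update v i (v i - 1) := by
  obtain ⟨j, h1, h2, h3⟩ := exists_update_of_cover h hr
  have hji : j = i := by
    by_contra hne
    rw [h3, Function.update_of_ne (Ne.symm hne)] at hv
    exact absurd hv (not_lt.mpr hu)
  subst hji
  have e1 : u j + 1 = v j := by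
    apply Fin.ext
    rw [val_add_one, h1]
    intro h0
    rw [h0] at h1
    have := (v j).2
    simp at h1
    omega
  refine ⟨by rw [e1]; exact h3, ?_⟩
  rw [← e1, add_sub_cancel_right]
  exact h2

/-- An edge-isoperimetric inequality for the Hasse diagram of `[3]^n`. -/
theorem card_coverPairs_le (W : Finset (Cube n)) :
    ((coverPairs W).card : ℝ) ≤ W.card * Real.logb 2 W.card := by
  classical
  induction hN : W.card using Nat.strong_induction_on generalizing W with
  | _ N ih =>
    rcases le_or_gt N 1 with hle | hgt
    · have h0 : coverPairs W = ∅ := by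
        rw [Finset.eq_empty_iff_forall_notMem]
        rintro ⟨u, v⟩ hp
        rw [mem_coverPairs] at hp
        have huv : u = v := Finset.card_le_one.mp (by omega) u hp.1 v hp.2.1
        have h : rk v = rk u + 1 := hp.2.2.2
        rw [huv] at h
        omega
      rw [h0]
      interval_cases N <;> simp
    · obtain ⟨u₀, hu₀, v₀, hv₀, hne⟩ := Finset.one_lt_card.mp (by omega : 1 < W.card)
      obtain ⟨i, hi⟩ := Function.ne_iff.mp hne
      obtain ⟨c, s, hs, t, ht, hsc, hct⟩ : ∃ c : Fin 3, ∃ s ∈ W, ∃ t ∈ W, s i ≤ c ∧ c < t i := by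
        rcases lt_or_gt_of_ne hi with h | h
        · exact ⟨u₀ i, u₀, hu₀, v₀, hv₀, le_rfl, h⟩
        · exact ⟨v₀ i, v₀, hv₀, u₀, hu₀, le_rfl, h⟩
      obtain ⟨W1, hW1⟩ : ∃ W1, W1 = W.filter (fun w => w i ≤ c) := ⟨_, rfl⟩
      obtain ⟨W2, hW2⟩ : ∃ W2, W2 = W.filter (fun w => ¬ w i ≤ c) := ⟨_, rfl⟩
      obtain ⟨C, hC⟩ : ∃ C, C = (coverPairs W).filter (fun p => p.1 i ≤ c ∧ c < p.2 i) := ⟨_, rfl⟩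
      have hcard : W1.card + W2.card = N := by
        rw [hW1, hW2, Finset.card_filter_add_card_filter_not, hN]
      have h1 : 1 ≤ W1.card := Finset.card_pos.mpr ⟨s, by rw [hW1]; simp [hs, hsc]⟩
      have h2 : 1 ≤ W2.card := Finset.card_pos.mpr ⟨t, by rw [hW2]; simp [ht, hct]⟩
      have hsub : coverPairs W ⊆ (coverPairs W1 ∪ coverPairs W2) ∪ C := by
        rintro ⟨u, v⟩ hp
        have hp' := mem_coverPairs.mp hp
        have hle : u i ≤ v i := hp'.2.2.1 i
        simp only [Finset.mem_union, mem_coverPairs, hC, Finset.mem_filter, hW1, hW2, hp', hp,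
          true_and, and_true]
        rcases le_or_gt (u i) c with h | h
        · rcases le_or_gt (v i) c with h' | h'
          · exact Or.inl (Or.inl ⟨h, h'⟩)
          · exact Or.inr ⟨h, h'⟩
        · exact Or.inl (Or.inr ⟨not_le.mpr h, not_le.mpr (h.trans_le hle)⟩)
      have hC1 : C.card ≤ W1.card := by
        refine Finset.card_le_card_of_injOn Prod.fst ?_ ?_
        · intro p hp
          have hp : p ∈ C := hp
          rw [hC, Finset.mem_filter, mem_coverPairs] at hp
          change p.1 ∈ W1
          rw [hW1, Finset.mem_filter]
          exact ⟨hp.1.1, hp.2.1⟩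
        · rintro ⟨u, v⟩ hp ⟨u', v'⟩ hp' heq
          have hp : (u, v) ∈ C := hp
          have hp' : (u', v') ∈ C := hp'
          rw [hC, Finset.mem_filter, mem_coverPairs] at hp hp'
          have e1 := (cover_cross_eq hp.1.2.2.1 hp.1.2.2.2 hp.2.1 hp.2.2).1
          have e2 := (cover_cross_eq hp'.1.2.2.1 hp'.1.2.2.2 hp'.2.1 hp'.2.2).1
          dsimp only at heq e1 e2
          rw [e1, e2, heq]
      have hC2 : C.card ≤ W2.card := by
        refine Finset.card_le_card_of_injOn Prod.snd ?_ ?_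
        · intro p hp
          have hp : p ∈ C := hp
          rw [hC, Finset.mem_filter, mem_coverPairs] at hp
          change p.2 ∈ W2
          rw [hW2, Finset.mem_filter]
          exact ⟨hp.1.2.1, not_le.mpr hp.2.2⟩
        · rintro ⟨u, v⟩ hp ⟨u', v'⟩ hp' heq
          have hp : (u, v) ∈ C := hp
          have hp' : (u', v') ∈ C := hp'
          rw [hC, Finset.mem_filter, mem_coverPairs] at hp hp'
          have e1 := (cover_cross_eq hp.1.2.2.1 hp.1.2.2.2 hp.2.1 hp.2.2).2
          have e2 := (cover_cross_eq hp'.1.2.2.1 hp'.1.2.2.2 hp'.2.1 hp'.2.2).2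
          dsimp only at heq e1 e2
          rw [e1, e2, heq]
      have i1 := ih W1.card (by omega) W1 rfl
      have i2 := ih W2.card (by omega) W2 rfl
      have hle : ((coverPairs W).card : ℝ) ≤ (coverPairs W1).card + (coverPairs W2).card + C.card := by
        have := (Finset.card_le_card hsub).trans (Finset.card_union_le _ _)
        have h' := Finset.card_union_le (coverPairs W1) (coverPairs W2)
        exact_mod_cast this.trans (by omega)
      have h1' : (1 : ℝ) ≤ W1.card := by exact_mod_cast h1
      have h2' : (1 : ℝ) ≤ W2.card := by exact_mod_cast h2
      have hC1' : (C.card : ℝ) ≤ W1.card := by exact_mod_cast hC1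
      have hC2' : (C.card : ℝ) ≤ W2.card := by exact_mod_cast hC2
      have hN' : (N : ℝ) = W1.card + W2.card := by exact_mod_cast hcard.symm
      rw [hN']
      rcases le_total (W1.card : ℝ) W2.card with h | h
      · have := mul_logb_add_le h1' h
        linarith
      · have := mul_logb_add_le h2' h
        rw [add_comm (W1.card : ℝ)]
        linarith

end Edges

section Expansion
variable {n k : ℕ}

lemma recv_bound {n a o b : ℕ} (hsum : a + o + b = n) (hab : a ≤ b) (hn : 16 ≤ n) :
    (a : ℝ) * ((1 + b / (n : ℝ) ^ 2) / (n - a + 1)) + o * ((1 - (o - 1) / (n : ℝ) ^ 2) / (n - a))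
      ≤ 1 - 1 / (16 * n) := by
  have hn' : (16 : ℝ) ≤ n := by exact_mod_cast hn
  have hs : (a : ℝ) + o + b = n := by exact_mod_cast hsum
  have ha0 : (0 : ℝ) ≤ a := Nat.cast_nonneg _
  have hb0 : (0 : ℝ) ≤ b := Nat.cast_nonneg _
  have ho0 : (0 : ℝ) ≤ o := Nat.cast_nonneg _
  have hab' : (a : ℝ) ≤ b := by exact_mod_cast hab
  obtain ⟨D, hD⟩ : ∃ D : ℝ, D = n - a := ⟨_, rfl⟩
  have hDpos : 0 < D := by linarith
  have hDn : D ≤ n := by linarith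
  have hnpos : (0 : ℝ) < n := by linarith
  rw [← hD]
  have key : (a : ℝ) * ((1 + b / (n : ℝ) ^ 2) / (D + 1)) + o * ((1 - (o - 1) / (n : ℝ) ^ 2) / D)
      = 1 - (b - a) / D - a / (D + 1) * (1 / D - b / (n : ℝ) ^ 2)
        - o * (o - 1) / ((n : ℝ) ^ 2 * D) := by
    have ho : (o : ℝ) = D - b := by linarith
    rw [ho]
    field_simp
    ring
  rw [key]
  have T1 : (0 : ℝ) ≤ (b - a) / D := div_nonneg (by linarith) hDpos.le
  have hdiff : (0 : ℝ) ≤ 1 / D - b / (n : ℝ) ^ 2 := by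
    rw [sub_nonneg, div_le_div_iff₀ (by positivity) hDpos]
    nlinarith
  have T2 : (0 : ℝ) ≤ a / (D + 1) * (1 / D - b / (n : ℝ) ^ 2) :=
    mul_nonneg (by positivity) hdiff
  have T3 : (0 : ℝ) ≤ o * (o - 1) / ((n : ℝ) ^ 2 * D) := by
    refine div_nonneg ?_ (by positivity)
    rcases Nat.eq_zero_or_pos o with h | h
    · rw [h]; simp
    · have : (1 : ℝ) ≤ o := by exact_mod_cast h
      exact mul_nonneg ho0 (by linarith)
  rcases eq_or_lt_of_le hab with h | h
  · subst h
    rcases le_or_gt (n : ℝ) (8 * a) with h8 | h8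
    · have e1 : (1 / 8 : ℝ) ≤ a / (D + 1) := by
        rw [div_le_div_iff₀ (by norm_num) (by linarith)]
        linarith
      have e2 : (1 / (2 * n) : ℝ) ≤ 1 / D - a / (n : ℝ) ^ 2 := by
        have f1 : (1 / n : ℝ) ≤ 1 / D := one_div_le_one_div_of_le hDpos hDn
        have f2 : (a : ℝ) / (n : ℝ) ^ 2 ≤ 1 / (2 * n) := by
          rw [div_le_div_iff₀ (by positivity) (by positivity)]
          nlinarith
        have f3 : (1 / n : ℝ) = 1 / (2 * n) + 1 / (2 * n) := by
          field_simp
          norm_num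
        linarith
      have e3 := mul_le_mul e1 e2 (by positivity) (by positivity)
      have e4 : (1 / 8 : ℝ) * (1 / (2 * n)) = 1 / (16 * n) := by
        field_simp
        norm_num
      linarith
    · have ho : (3 / 4 : ℝ) * n ≤ o := by linarith
      have : (1 / (16 * n) : ℝ) ≤ o * (o - 1) / ((n : ℝ) ^ 2 * D) := by
        rw [div_le_div_iff₀ (by positivity) (by positivity)]
        have g1 : (n : ℝ) ^ 2 ≤ 16 * (o * (o - 1)) := by nlinarith
        have g2 : (n : ℝ) ^ 2 * D ≤ (n : ℝ) ^ 2 * n := by gcongr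
        nlinarith
      linarith
  · have hb' : (a : ℝ) + 1 ≤ b := by exact_mod_cast h
    have : (1 / (16 * n) : ℝ) ≤ (b - a) / D := by
      rw [div_le_div_iff₀ (by positivity) hDpos]
      nlinarith
    linarith

/-- Fractional matching weights between consecutive layers. -/
noncomputable def flow (x y : Cube n) : ℝ :=
  if cnt y 0 = cnt x 0 then (1 - cnt x 1 / (n : ℝ) ^ 2) / (cnt x 1 + cnt x 2)
  else (1 + cnt x 2 / (n : ℝ) ^ 2) / (cnt x 1 + cnt x 2)

lemma flow_nonneg (x y : Cube n) : 0 ≤ flow x y := by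
  rw [flow]
  split_ifs
  · refine div_nonneg ?_ (by positivity)
    have h := cnt_add x
    have h1 : (cnt x 1 : ℝ) ≤ n := by exact_mod_cast (by omega : cnt x 1 ≤ n)
    rcases Nat.eq_zero_or_pos n with h0 | h0
    · subst h0; simp
    · have h2 : (1 : ℝ) ≤ n := by exact_mod_cast h0
      rw [sub_nonneg, div_le_one (by positivity)]
      nlinarith
  · positivity

lemma sum_flow_dn (hn : 0 < n) (hk : n ≤ k) (x : Lay n (k + 1)) :
    ∑ y ∈ dn (below n k) x, flow x.1 y.1 = 1 := by
  rw [sum_dn x (fun y => flow x.1 y),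
    sum_filter_ne_zero x.1 _ ((1 + cnt x.1 2 / (n : ℝ) ^ 2) / (cnt x.1 1 + cnt x.1 2))
      ((1 - cnt x.1 1 / (n : ℝ) ^ 2) / (cnt x.1 1 + cnt x.1 2))]
  · have h1 := cnt_add x.1
    have h2 := rk_eq_cnt x.1
    have h3 := x.2
    have h4 : (0 : ℝ) < cnt x.1 1 + cnt x.1 2 := by
      exact_mod_cast (by omega : 0 < cnt x.1 1 + cnt x.1 2)
    have h5 : (0 : ℝ) < n := by exact_mod_cast hn
    field_simp
    ring
  · intro i hi
    rw [flow, if_neg]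
    have := cnt_update x.1 i (x.1 i - 1) 0
    rw [hi] at this ⊢
    simp at this ⊢
    omega
  · intro i hi
    rw [flow, if_pos]
    have := cnt_update x.1 i (x.1 i - 1) 0
    rw [hi] at this ⊢
    simpa using this

lemma sum_flow_up (hn : 16 ≤ n) (hk : n ≤ k) (y : Lay n k) :
    ∑ x ∈ up (below n k) y, flow x.1 y.1 ≤ 1 - 1 / (16 * n) := by
  have h1 := cnt_add y.1
  have h2 := rk_eq_cnt y.1
  have h3 := y.2
  refine le_trans (le_of_eq ?_) (recv_bound h1 (by omega) hn)
  have h1' : (cnt y.1 1 : ℝ) + cnt y.1 2 = n - cnt y.1 0 := by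
    have : (cnt y.1 0 : ℝ) + cnt y.1 1 + cnt y.1 2 = n := by exact_mod_cast h1
    linarith
  rw [sum_up y (fun x => flow x y.1)]
  apply sum_filter_ne_two
  · intro i hi
    have e0 := cnt_update y.1 i (y.1 i + 1) 0
    have e1 := cnt_update y.1 i (y.1 i + 1) 1
    have e2 := cnt_update y.1 i (y.1 i + 1) 2
    rw [hi] at e0 e1 e2 ⊢
    simp at e0 e1 e2 ⊢
    rw [flow, if_neg (by omega), e1, e2, ← h1']
    push_cast
    ring
  · intro i hi
    have e0 := cnt_update y.1 i (y.1 i + 1) 0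
    have e1 := cnt_update y.1 i (y.1 i + 1) 1
    have e2 := cnt_update y.1 i (y.1 i + 1) 2
    rw [hi] at e0 e1 e2 ⊢
    simp [show (1 : Fin 3) + 1 = 2 from rfl] at e0 e1 e2 ⊢
    rw [flow, if_pos (by omega), ← e1, e2, ← h1', ← e1]
    push_cast
    ring

lemma layer_expand (hn : 16 ≤ n) (hk : n ≤ k) (A : Finset (Lay n (k + 1))) :
    ((nbr (below n k) A).card : ℝ)
      ≤ 16 * n * ((nbr (below n k) A).card - A.card) := by
  have hnpos : (0 : ℝ) < n := by exact_mod_cast (by omega : 0 < n)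
  have h1 : (A.card : ℝ) ≤ (nbr (below n k) A).card * (1 - 1 / (16 * n)) := by
    calc (A.card : ℝ) = ∑ x ∈ A, ∑ y ∈ dn (below n k) x ∩ nbr (below n k) A, flow x.1 y.1 := by
          rw [Finset.cast_card]
          refine Finset.sum_congr rfl fun x hx => ?_
          have hsub : dn (below n k) x ⊆ nbr (below n k) A := mem_inner.mp (subset_inner_nbr A hx)
          rw [Finset.inter_eq_left.mpr hsub]
          exact (sum_flow_dn (by omega) hk x).symm
      _ = ∑ y ∈ nbr (below n k) A, ∑ x ∈ up (below n k) y ∩ A, flow x.1 y.1 :=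
          LayerGraph.sum_swap (r := below n k) (fun x y => flow x.1 y.1) A (nbr (below n k) A)
      _ ≤ ∑ y ∈ nbr (below n k) A, (1 - 1 / (16 * n) : ℝ) := by
          refine Finset.sum_le_sum fun y _ => ?_
          refine le_trans ?_ (sum_flow_up hn hk y)
          exact Finset.sum_le_sum_of_subset_of_nonneg Finset.inter_subset_left
            fun _ _ _ => flow_nonneg _ _
      _ = _ := by rw [Finset.sum_const, nsmul_eq_mul]
  obtain ⟨g, hg⟩ : ∃ g : ℝ, g = (nbr (below n k) A).card := ⟨_, rfl⟩
  rw [← hg] at h1 ⊢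
  have h2 : g / (16 * n) ≤ g - A.card := by
    have : g * (1 - 1 / (16 * n)) = g - g / (16 * n) := by ring
    linarith
  rw [div_le_iff₀ (by positivity)] at h2
  linarith

lemma layer_edges (A : Finset (Lay n (k + 1))) :
    ∑ x ∈ A, ((dn (below n k) x).card : ℝ) ≤ (A.card + (nbr (below n k) A).card)
      * Real.logb 2 (A.card + (nbr (below n k) A).card) := by
  classical
  have hdisj : Disjoint (A.image Subtype.val) ((nbr (below n k) A).image Subtype.val) := by
    rw [Finset.disjoint_left]
    intro z hz hz'
    obtain ⟨x, -, rfl⟩ := Finset.mem_image.mp hz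
    obtain ⟨y, -, hy⟩ := Finset.mem_image.mp hz'
    have h1 := x.2
    have h2 := y.2
    rw [hy] at h2
    omega
  have hcard : (A.image Subtype.val ∪ (nbr (below n k) A).image Subtype.val).card
      = A.card + (nbr (below n k) A).card := by
    rw [Finset.card_union_of_disjoint hdisj, Finset.card_image_of_injective _ Subtype.val_injective,
      Finset.card_image_of_injective _ Subtype.val_injective]
  have h := card_coverPairs_le (A.image Subtype.val ∪ (nbr (below n k) A).image Subtype.val)
  rw [hcard] at h
  push_cast at h
  refine le_trans ?_ h
  have : (A.sigma fun x => dn (below n k) x).card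
      ≤ (coverPairs (A.image Subtype.val ∪ (nbr (below n k) A).image Subtype.val)).card := by
    refine Finset.card_le_card_of_injOn (fun p => (p.2.1, p.1.1)) ?_ ?_
    · rintro ⟨x, y⟩ hp
      have hp : (⟨x, y⟩ : Sigma _) ∈ A.sigma fun x => dn (below n k) x := hp
      rw [Finset.mem_sigma, mem_dn] at hp
      change _ ∈ coverPairs _
      rw [mem_coverPairs]
      refine ⟨?_, ?_, hp.2, by rw [x.2, y.2]⟩
      · exact Finset.mem_union_right _ (Finset.mem_image_of_mem _ (mem_nbr.mpr ⟨x, hp.1, hp.2⟩))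
      · exact Finset.mem_union_left _ (Finset.mem_image_of_mem _ hp.1)
    · rintro ⟨x, y⟩ _ ⟨x', y'⟩ _ heq
      simp only [Prod.mk.injEq] at heq
      have e1 := Subtype.ext heq.1
      have e2 := Subtype.ext heq.2
      subst e1 e2
      rfl
  rw [Finset.card_sigma] at this
  exact_mod_cast this

lemma layer_codeg (x x' : Lay n (k + 1)) (hne : x ≠ x') :
    (dn (below n k) x ∩ dn (below n k) x').card ≤ 1 := by
  rw [Finset.card_le_one]
  have key : ∀ y ∈ dn (below n k) x ∩ dn (below n k) x', y.1 = x.1 ⊓ x'.1 := by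
    intro y hy
    rw [Finset.mem_inter, mem_dn, mem_dn] at hy
    refine eq_of_le_of_rk_le (le_inf hy.1 hy.2) ?_
    by_contra! hlt
    have h1 : x.1 ⊓ x'.1 = x.1 := eq_of_le_of_rk_le inf_le_left (by
      have := x.2; have := y.2; omega)
    have h2 : x.1 = x'.1 := eq_of_le_of_rk_le (inf_eq_left.mp h1) (by rw [x.2, x'.2])
    exact hne (Subtype.ext h2)
  intro a ha b hb
  exact Subtype.ext ((key a ha).trans (key b hb).symm)

theorem layerGraph_below (hn : 16 ≤ n) (hk : n ≤ k) : LayerGraph (below n k) n where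
  deg_lower x := by
    have h1 := cnt_add x.1
    have h2 := rk_eq_cnt x.1
    have h3 := x.2
    rw [card_dn]
    have : n ≤ 2 * (cnt x.1 1 + cnt x.1 2) := by omega
    rw [div_le_iff₀ (by norm_num)]
    push_cast
    have : (n : ℝ) ≤ 2 * (cnt x.1 1 + cnt x.1 2) := by exact_mod_cast this
    linarith
  deg_upper x := by
    have := cnt_add x.1
    rw [card_dn]
    omega
  up_upper y := by
    have := cnt_add y.1
    rw [card_up]
    omega
  up_le_dn x y hxy := by
    have h1 := cnt_add x.1
    have h2 := cnt_add y.1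
    have h3 := rk_eq_cnt y.1
    have h4 := y.2
    have h5 := cnt_zero_anti hxy
    rw [card_dn, card_up]
    omega
  codeg := layer_codeg
  expand := layer_expand hn hk
  edges := layer_edges

lemma card_lay_le : Fintype.card (Lay n k) ≤ 3 ^ n := by
  refine (Fintype.card_subtype_le _).trans ?_
  simp

end Expansion

section Peel
variable {X Y : Type} [Fintype X] [Fintype Y] [DecidableEq X] [DecidableEq Y] {r : X → Y → Prop}

/-- Weights that are submultiplicative over sets with disjoint neighbourhoods. -/
def Submult (r : X → Y → Prop) (m : Finset X → ℝ) : Prop :=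
  ∀ C F : Finset X, Disjoint C F → (∀ a ∈ C, ∀ b ∈ F, ¬ Adj2 r a b) → m (C ∪ F) ≤ m C * m F

/-- The total weight of subsets of `D`. -/
noncomputable def partZ (r : X → Y → Prop) (m : Finset X → ℝ) (D : Finset X) : ℝ :=
  ∑ F ∈ D.powerset, m F * (1 / 2 : ℝ) ^ (nbr r F).card

open Classical in
/-- The component of `x` inside `F`. -/
noncomputable def comp (r : X → Y → Prop) (F : Finset X) (x : X) : Finset X :=
  F.filter fun z => Relation.ReflTransGen (fun a b => a ∈ F ∧ b ∈ F ∧ Adj2 r a b) x z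

lemma mem_comp {F : Finset X} {x z : X} : z ∈ comp r F x ↔
    z ∈ F ∧ Relation.ReflTransGen (fun a b => a ∈ F ∧ b ∈ F ∧ Adj2 r a b) x z := by
  simp [comp]

lemma comp_subset (F : Finset X) (x : X) : comp r F x ⊆ F := fun _ hz => (mem_comp.mp hz).1

lemma self_mem_comp {F : Finset X} {x : X} (hx : x ∈ F) : x ∈ comp r F x :=
  mem_comp.mpr ⟨hx, Relation.ReflTransGen.refl⟩

lemma mem_comp_of_adj {F : Finset X} {x a b : X} (ha : a ∈ comp r F x) (hb : b ∈ F)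
    (h : Adj2 r a b) : b ∈ comp r F x :=
  mem_comp.mpr ⟨hb, (mem_comp.mp ha).2.tail ⟨(mem_comp.mp ha).1, hb, h⟩⟩

lemma linked_comp (F : Finset X) (x : X) : Linked (Adj2 r) (comp r F x) := by
  have key : ∀ z, z ∈ comp r F x → Relation.ReflTransGen
      (fun a b => a ∈ comp r F x ∧ b ∈ comp r F x ∧ Adj2 r a b) x z := by
    intro z hz
    have hz' := (mem_comp.mp hz).2
    clear hz
    induction hz' with
    | refl => exact Relation.ReflTransGen.refl
    | tail hab hbc ih =>
      refine ih.tail ⟨mem_comp.mpr ⟨hbc.1, hab⟩, mem_comp.mpr ⟨hbc.2.1, hab.tail hbc⟩, hbc.2.2⟩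
  intro y hy z hz
  refine Relation.ReflTransGen.trans ?_ (key z hz)
  have : Std.Symm (fun a b => a ∈ comp r F x ∧ b ∈ comp r F x ∧ Adj2 r a b) :=
    ⟨fun a b h => ⟨h.2.1, h.1, h.2.2.symm⟩⟩
  exact Relation.ReflTransGen.stdSymm.symm _ _ (key y hy)

lemma nbr_union (C F : Finset X) : nbr r (C ∪ F) = nbr r C ∪ nbr r F := by
  ext y
  simp only [mem_nbr, Finset.mem_union]
  constructor
  · rintro ⟨x, h | h, hxy⟩
    · exact Or.inl ⟨x, h, hxy⟩
    · exact Or.inr ⟨x, h, hxy⟩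
  · rintro (⟨x, h, hxy⟩ | ⟨x, h, hxy⟩)
    · exact ⟨x, Or.inl h, hxy⟩
    · exact ⟨x, Or.inr h, hxy⟩

lemma card_nbr_union {C F : Finset X} (h : ∀ a ∈ C, ∀ b ∈ F, ¬ Adj2 r a b) :
    (nbr r (C ∪ F)).card = (nbr r C).card + (nbr r F).card := by
  rw [nbr_union, Finset.card_union_of_disjoint]
  rw [Finset.disjoint_left]
  intro y hy hy'
  obtain ⟨a, ha, hay⟩ := mem_nbr.mp hy
  obtain ⟨b, hb, hby⟩ := mem_nbr.mp hy'
  exact h a ha b hb ⟨y, hay, hby⟩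

lemma partZ_insert_le {m : Finset X → ℝ} (hm0 : ∀ F, 0 ≤ m F) (hm : Submult r m) {D : Finset X}
    {x : X} (hx : x ∉ D) : partZ r m (insert x D) ≤ partZ r m D * (1 + linkedSum r m x) := by
  classical
  have hnn : ∀ F, 0 ≤ m F * (1 / 2 : ℝ) ^ (nbr r F).card := fun F => mul_nonneg (hm0 F) (by positivity)
  have hsplit := Finset.sum_filter_add_sum_filter_not (insert x D).powerset (fun F => x ∈ F)
    (fun F => m F * (1 / 2 : ℝ) ^ (nbr r F).card)
  have h2 : (insert x D).powerset.filter (fun F => x ∉ F) = D.powerset := by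
    ext F
    rw [Finset.mem_filter, Finset.mem_powerset, Finset.mem_powerset]
    constructor
    · rintro ⟨h, hxF⟩
      exact (Finset.subset_insert_iff_of_notMem hxF).mp h
    · intro h
      exact ⟨h.trans (Finset.subset_insert _ _), fun hxF => hx (h hxF)⟩
  have h1 : ∑ F ∈ (insert x D).powerset.filter (fun F => x ∈ F), m F * (1 / 2 : ℝ) ^ (nbr r F).card
      ≤ linkedSum r m x * partZ r m D := by
    rw [linkedSum, partZ, Finset.sum_mul_sum, ← Finset.sum_product']
    calc _ ≤ ∑ F ∈ (insert x D).powerset.filter (fun F => x ∈ F),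
          (m (comp r F x) * (1 / 2 : ℝ) ^ (nbr r (comp r F x)).card) *
          (m (F \ comp r F x) * (1 / 2 : ℝ) ^ (nbr r (F \ comp r F x)).card) := by
          refine Finset.sum_le_sum fun F _ => ?_
          have hno : ∀ a ∈ comp r F x, ∀ b ∈ F \ comp r F x, ¬ Adj2 r a b := by
            intro a ha b hb hab
            rw [Finset.mem_sdiff] at hb
            exact hb.2 (mem_comp_of_adj ha hb.1 hab)
          have e1 := hm _ _ Finset.disjoint_sdiff hno
          have e2 := card_nbr_union hno
          rw [Finset.union_sdiff_of_subset (comp_subset F x)] at e1 e2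
          rw [e2, pow_add]
          calc _ ≤ (m (comp r F x) * m (F \ comp r F x)) * _ :=
                mul_le_mul_of_nonneg_right e1 (by positivity)
            _ = _ := by ring
      _ = ∑ p ∈ ((insert x D).powerset.filter (fun F => x ∈ F)).image
            (fun F => (comp r F x, F \ comp r F x)),
          (m p.1 * (1 / 2 : ℝ) ^ (nbr r p.1).card) * (m p.2 * (1 / 2 : ℝ) ^ (nbr r p.2).card) := by
          rw [Finset.sum_image]
          intro F _ F' _ heq
          simp only [Prod.mk.injEq] at heq
          calc F = comp r F x ∪ F \ comp r F x :=
                (Finset.union_sdiff_of_subset (comp_subset F x)).symm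
            _ = comp r F' x ∪ F' \ comp r F' x := by rw [heq.2, heq.1]
            _ = F' := Finset.union_sdiff_of_subset (comp_subset F' x)
      _ ≤ _ := by
          refine Finset.sum_le_sum_of_subset_of_nonneg ?_ fun p _ _ => mul_nonneg (hnn _) (hnn _)
          intro p hp
          obtain ⟨F, hF, rfl⟩ := Finset.mem_image.mp hp
          rw [Finset.mem_filter, Finset.mem_powerset] at hF
          rw [Finset.mem_product, Finset.mem_filter, Finset.mem_powerset]
          refine ⟨⟨Finset.mem_univ _, self_mem_comp hF.2, linked_comp F x⟩, ?_⟩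
          intro z hz
          rw [Finset.mem_sdiff] at hz
          rcases Finset.mem_insert.mp (hF.1 hz.1) with h | h
          · subst h
            exact absurd (self_mem_comp hF.2) hz.2
          · exact h
  rw [h2] at hsplit
  have : partZ r m (insert x D) = _ := hsplit.symm
  rw [this]
  change _ + partZ r m D ≤ _
  linarith

theorem partZ_le_exp {m : Finset X → ℝ} (hm0 : ∀ F, 0 ≤ m F) (hm1 : m ∅ = 1) (hm : Submult r m)
    (D : Finset X) : partZ r m D ≤ Real.exp (∑ x ∈ D, linkedSum r m x) := by
  induction D using Finset.induction_on with
  | empty =>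
    have : nbr r ∅ = ∅ := by ext; simp
    simp [partZ, hm1, this]
  | insert x D hx ih =>
    refine (partZ_insert_le hm0 hm hx).trans ?_
    rw [Finset.sum_insert hx, Real.exp_add, mul_comm (Real.exp _)]
    have h0 : 0 ≤ linkedSum r m x :=
      Finset.sum_nonneg fun F _ => mul_nonneg (hm0 F) (by positivity)
    refine mul_le_mul ih ?_ (by linarith) (Real.exp_pos _).le
    linarith [Real.add_one_le_exp (linkedSum r m x)]

end Peel

section Shadow
variable {n k : ℕ}

open Classical in
/-- The elements of rank `k` below some element of `B`. -/
noncomputable def sh (k : ℕ) (B : Finset (Cube n)) : Finset (Lay n k) :=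
  Finset.univ.filter fun x => ∃ b ∈ B, x.1 ≤ b

open Classical in
/-- The antichains all of whose elements have rank at least `k`. -/
noncomputable def highAC (n k : ℕ) : Finset (Finset (Cube n)) :=
  Finset.univ.filter fun B => IsAntichain (· ≤ ·) (B : Set (Cube n)) ∧ ∀ b ∈ B, k ≤ rk b

open Classical in
/-- The number of high antichains with a given shadow. -/
noncomputable def shadowCount (n k : ℕ) (F : Finset (Lay n k)) : ℝ :=
  ((highAC n k).filter fun B => sh k B = F).card

lemma mem_sh {B : Finset (Cube n)} {x : Lay n k} : x ∈ sh k B ↔ ∃ b ∈ B, x.1 ≤ b := by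
  simp [sh]

lemma mem_highAC {B : Finset (Cube n)} : B ∈ highAC n k ↔
    IsAntichain (· ≤ ·) (B : Set (Cube n)) ∧ ∀ b ∈ B, k ≤ rk b := by
  simp [highAC]

lemma highAC_subset {B B' : Finset (Cube n)} (hB : B ∈ highAC n k) (h : B' ⊆ B) :
    B' ∈ highAC n k := by
  rw [mem_highAC] at hB ⊢
  exact ⟨hB.1.subset (by exact_mod_cast h), fun b hb => hB.2 b (h hb)⟩

lemma exists_cover_above {y b : Cube n} (h : y ≤ b) (hr : rk y < rk b) :
    ∃ x, y ≤ x ∧ x ≤ b ∧ rk x = rk y + 1 := by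
  obtain ⟨i, hi⟩ := exists_lt_of_le_of_ne h (by rintro rfl; omega)
  have h2 : y i ≠ 2 := by
    intro h2
    rw [h2] at hi
    have := Fin.lt_def.mp hi
    have := (b i).2
    simp at *
    omega
  have h3 := val_add_one h2
  refine ⟨Function.update y i (y i + 1), le_update (Fin.le_def.mpr (by omega)), ?_, ?_⟩
  · intro j
    rcases eq_or_ne j i with rfl | hj
    · rw [Function.update_self]
      have := Fin.lt_def.mp hi
      exact Fin.le_def.mpr (by omega)
    · rw [Function.update_of_ne hj]
      exact h j
  · have := rk_update y i (y i + 1)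
    omega

lemma exists_rank_above {y b : Cube n} (h : y ≤ b) {j : ℕ} (hj : rk y ≤ j) (hjb : j ≤ rk b) :
    ∃ x, y ≤ x ∧ x ≤ b ∧ rk x = j := by
  induction j, hj using Nat.le_induction with
  | base => exact ⟨y, le_rfl, h, rfl⟩
  | succ j hj ih =>
    obtain ⟨x, h1, h2, h3⟩ := ih (by omega)
    obtain ⟨x', h4, h5, h6⟩ := exists_cover_above h2 (by omega)
    exact ⟨x', h1.trans h4, h5, by omega⟩

lemma exists_rank_below (b : Cube n) {j : ℕ} (hjb : j ≤ rk b) : ∃ x, x ≤ b ∧ rk x = j := by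
  have h0 : rk (0 : Cube n) = 0 := by simp [rk]
  obtain ⟨x, -, h1, h2⟩ := exists_rank_above (y := 0) (b := b) (fun i => Fin.zero_le _)
    (by omega : rk (0 : Cube n) ≤ j) hjb
  exact ⟨x, h1, h2⟩

lemma nbr_sh {B : Finset (Cube n)} (hB : B ∈ highAC n (k + 1)) :
    nbr (below n k) (sh (k + 1) B) = sh k B := by
  ext y
  rw [mem_nbr, mem_sh]
  constructor
  · rintro ⟨x, hx, hxy⟩
    obtain ⟨b, hb, hxb⟩ := mem_sh.mp hx
    exact ⟨b, hb, le_trans hxy hxb⟩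
  · rintro ⟨b, hb, hyb⟩
    have := (mem_highAC.mp hB).2 b hb
    obtain ⟨x, h1, h2, h3⟩ := exists_cover_above hyb (by rw [y.2]; omega)
    exact ⟨⟨x, by rw [h3, y.2]⟩, mem_sh.mpr ⟨b, hb, h2⟩, h1⟩

lemma sh_eq_empty {B : Finset (Cube n)} (hB : B ∈ highAC n k) : sh k B = ∅ ↔ B = ∅ := by
  constructor
  · intro h
    by_contra hne
    obtain ⟨b, hb⟩ := Finset.nonempty_iff_ne_empty.mpr hne
    obtain ⟨x, h1, h2⟩ := exists_rank_below b ((mem_highAC.mp hB).2 b hb)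
    have : (⟨x, h2⟩ : Lay n k) ∈ sh k B := mem_sh.mpr ⟨b, hb, h1⟩
    rw [h] at this
    simp at this
  · rintro rfl
    ext
    simp [mem_sh]

lemma shadowCount_nonneg (F : Finset (Lay n k)) : 0 ≤ shadowCount n k F := by
  rw [shadowCount]; positivity

lemma shadowCount_empty : shadowCount n k ∅ = 1 := by
  classical
  have h0 : (∅ : Finset (Cube n)) ∈ highAC n k := by simp [mem_highAC]
  rw [shadowCount, show ((highAC n k).filter fun B => sh k B = ∅) = {∅} from ?_]
  · simp
  · ext B
    rw [Finset.mem_filter, Finset.mem_singleton]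
    constructor
    · rintro ⟨h1, h2⟩
      exact (sh_eq_empty h1).mp h2
    · rintro rfl
      exact ⟨h0, (sh_eq_empty h0).mpr rfl⟩

/-- A step inside the down-set of `b` towards another element of rank `k + 1`. -/
lemma exists_swap {b : Cube n} (x x' : Lay n (k + 1)) (hx : x.1 ≤ b) (hx' : x'.1 ≤ b)
    (hne : x ≠ x') : ∃ z : Lay n (k + 1), z.1 ≤ b ∧ Adj2 (below n k) x z ∧
      rk (x.1 ⊓ x'.1) < rk (z.1 ⊓ x'.1) := by
  have hnle : ¬ x'.1 ≤ x.1 := fun h =>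
    hne (Subtype.ext (eq_of_le_of_rk_le h (by rw [x.2, x'.2])).symm)
  have hnle' : ¬ x.1 ≤ x'.1 := fun h =>
    hne (Subtype.ext (eq_of_le_of_rk_le h (by rw [x.2, x'.2])))
  rw [Pi.le_def] at hnle hnle'
  push Not at hnle hnle'
  obtain ⟨i, hi⟩ := hnle
  obtain ⟨l, hl⟩ := hnle'
  have hil : i ≠ l := by
    rintro rfl
    exact lt_asymm hi hl
  have hi' := Fin.lt_def.mp hi
  have hl' := Fin.lt_def.mp hl
  have hl0 : x.1 l ≠ 0 := by
    intro h
    rw [h] at hl'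
    simp at hl'
  have hi2 : x.1 i ≠ 2 := by
    intro h
    rw [h] at hi'
    have := (x'.1 i).2
    simp at hi'
    omega
  have v1 := val_sub_one hl0
  have v2 := val_add_one hi2
  obtain ⟨y, hy⟩ : ∃ y, y = Function.update x.1 l (x.1 l - 1) := ⟨_, rfl⟩
  have hyrk : rk y = k := by rw [hy]; exact rk_dec x hl0
  have hyi : y i = x.1 i := by rw [hy, Function.update_of_ne hil]
  have hyx : y ≤ x.1 := by
    rw [hy]
    exact update_le (Fin.le_def.mpr (by omega))
  have hzrk : rk (Function.update y i (y i + 1)) = k + 1 :=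
    rk_inc ⟨y, hyrk⟩ (show y i ≠ 2 by rw [hyi]; exact hi2)
  have hyz : y ≤ Function.update y i (y i + 1) :=
    le_update (Fin.le_def.mpr (by rw [hyi]; omega))
  refine ⟨⟨_, hzrk⟩, ?_, ⟨⟨y, hyrk⟩, hyx, hyz⟩, ?_⟩
  · intro j
    rcases eq_or_ne j i with rfl | hj
    · dsimp only
      rw [Function.update_self, hyi]
      exact (Fin.le_def.mpr (by omega) : x.1 j + 1 ≤ x'.1 j).trans (hx' j)
    · dsimp only
      rw [Function.update_of_ne hj]
      exact (hyx j).trans (hx j)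
  · have hle : x.1 ⊓ x'.1 ≤ Function.update y i (y i + 1) ⊓ x'.1 := by
      refine le_inf ?_ inf_le_right
      intro j
      rcases eq_or_ne j l with rfl | hj
      · rw [Function.update_of_ne hil.symm, hy, Function.update_self]
        refine (inf_le_right (a := x.1) (b := x'.1) j).trans (Fin.le_def.mpr (by omega))
      · refine (inf_le_left (a := x.1) (b := x'.1) j).trans ?_
        refine le_trans (le_of_eq ?_) (hyz j)
        rw [hy, Function.update_of_ne hj]
    by_contra! hge
    have heq := congrFun (eq_of_le_of_rk_le hle hge) i
    rw [Pi.inf_apply, Pi.inf_apply, Function.update_self, hyi] at heq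
    have h1 : x.1 i ⊓ x'.1 i = x.1 i := inf_eq_left.mpr hi.le
    have h2 : (x.1 i + 1) ⊓ x'.1 i = x.1 i + 1 := inf_eq_left.mpr (Fin.le_def.mpr (by omega))
    rw [h1, h2] at heq
    have := congrArg Fin.val heq
    omega

/-- The shadow of a single element is linked. -/
lemma path_below {b : Cube n} {F : Finset (Lay n (k + 1))}
    (hF : ∀ x : Lay n (k + 1), x.1 ≤ b → x ∈ F) (x x' : Lay n (k + 1)) (hx : x.1 ≤ b)
    (hx' : x'.1 ≤ b) :
    Relation.ReflTransGen (fun a c => a ∈ F ∧ c ∈ F ∧ Adj2 (below n k) a c) x x' := by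
  induction hd : rk x'.1 - rk (x.1 ⊓ x'.1) using Nat.strong_induction_on generalizing x with
  | _ d ih =>
    by_cases hne : x = x'
    · rw [hne]
    · obtain ⟨z, hz, hadj, hlt⟩ := exists_swap x x' hx hx' hne
      have := rk_mono (inf_le_right : z.1 ⊓ x'.1 ≤ x'.1)
      exact Relation.ReflTransGen.head ⟨hF x hx, hF z hz, hadj⟩ (ih _ (by omega) z hz rfl)

/-- A set closed under adjacency within the shadow of `B` meets the shadow of each element of `B`
trivially. -/
lemma sh_dichotomy {B : Finset (Cube n)} {C F : Finset (Lay n (k + 1))}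
    (hCF : sh (k + 1) B = C ∪ F) (hno : ∀ a ∈ C, ∀ b ∈ F, ¬ Adj2 (below n k) a b)
    {b : Cube n} (hb : b ∈ B) {x : Lay n (k + 1)} (hx : x.1 ≤ b) (hxC : x ∈ C)
    (x' : Lay n (k + 1)) (hx' : x'.1 ≤ b) : x' ∈ C := by
  have hpath := path_below (F := C ∪ F) (fun x hx => by
    rw [← hCF]; exact mem_sh.mpr ⟨b, hb, hx⟩) x x' hx hx'
  have key : ∀ z, Relation.ReflTransGen
      (fun a c => a ∈ C ∪ F ∧ c ∈ C ∪ F ∧ Adj2 (below n k) a c) x z → z ∈ C := by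
    intro z hz
    induction hz with
    | refl => exact hxC
    | tail _ h ih =>
      rcases Finset.mem_union.mp h.2.1 with h' | h'
      · exact h'
      · exact absurd h.2.2 (hno _ ih _ h')
  exact key x' hpath

lemma shadowCount_submult : Submult (below n k) (shadowCount n (k + 1)) := by
  classical
  intro C F hdisj hno
  rw [shadowCount, shadowCount, shadowCount, ← Nat.cast_mul, ← Finset.card_product, Nat.cast_le]
  refine Finset.card_le_card_of_injOn
    (fun B => (B.filter (fun b => ∃ x ∈ C, x.1 ≤ b), B.filter (fun b => ¬ ∃ x ∈ C, x.1 ≤ b))) ?_ ?_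
  · intro B hB
    have hB : B ∈ (highAC n (k + 1)).filter fun B => sh (k + 1) B = C ∪ F := hB
    rw [Finset.mem_filter] at hB
    rw [Finset.mem_coe]
    have hmem : ∀ x, x ∈ sh (k + 1) B ↔ x ∈ C ∪ F := fun x => by rw [hB.2]
    rw [Finset.mem_product, Finset.mem_filter, Finset.mem_filter]
    refine ⟨⟨highAC_subset hB.1 (Finset.filter_subset _ _), ?_⟩,
      ⟨highAC_subset hB.1 (Finset.filter_subset _ _), ?_⟩⟩
    · ext x
      rw [mem_sh]
      constructor
      · rintro ⟨b, hb, hxb⟩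
        obtain ⟨hbB, z, hz, hzb⟩ := Finset.mem_filter.mp hb
        exact sh_dichotomy hB.2 hno hbB hzb hz x hxb
      · intro hx
        obtain ⟨b, hb, hxb⟩ := mem_sh.mp ((hmem x).mpr (Finset.mem_union_left _ hx))
        exact ⟨b, Finset.mem_filter.mpr ⟨hb, x, hx, hxb⟩, hxb⟩
    · ext x
      rw [mem_sh]
      constructor
      · rintro ⟨b, hb, hxb⟩
        obtain ⟨hbB, hbC⟩ := Finset.mem_filter.mp hb
        rcases Finset.mem_union.mp ((hmem x).mp (mem_sh.mpr ⟨b, hbB, hxb⟩)) with h | h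
        · exact absurd ⟨x, h, hxb⟩ hbC
        · exact h
      · intro hx
        obtain ⟨b, hb, hxb⟩ := mem_sh.mp ((hmem x).mpr (Finset.mem_union_right _ hx))
        refine ⟨b, Finset.mem_filter.mpr ⟨hb, ?_⟩, hxb⟩
        rintro ⟨z, hz, hzb⟩
        exact Finset.disjoint_left.mp hdisj (sh_dichotomy hB.2 hno hb hzb hz x hxb) hx
  · intro B _ B' _ heq
    simp only [Prod.mk.injEq] at heq
    rw [← Finset.filter_union_filter_not_eq (fun b => ∃ x ∈ C, x.1 ≤ b) B,
      ← Finset.filter_union_filter_not_eq (fun b => ∃ x ∈ C, x.1 ≤ b) B', heq.1, heq.2]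

end Shadow

section TameShadows
variable {n k : ℕ}

/-- The numerical requirements on `n` for the counting argument. -/
structure Admissible (n : ℕ) : Prop where
  sixteen_le : 16 ≤ n
  big : BigEnough n
  weight : (1 + 4 / (n : ℝ) ^ 2) * (1 / 2 : ℝ) ^ ((n : ℝ) / 2) + (1 / 2 : ℝ) ^ (3 * (n : ℝ) / 4)
    ≤ 1 / (n : ℝ) ^ 2

theorem eventually_admissible : ∀ᶠ n : ℕ in atTop, Admissible n := by
  filter_upwards [eventually_ge_atTop 16, eventually_bigEnough,
    eventually_pow_mul_half_rpow_le (show (0 : ℝ) < 1 / 2 by norm_num)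
      (show (0 : ℝ) < 1 / 4 by norm_num) 2] with n h1 h2 h3
  refine ⟨h1, h2, ?_⟩
  have hn : (16 : ℝ) ≤ n := by exact_mod_cast h1
  have e1 : (1 / 2 : ℝ) ^ (3 * (n : ℝ) / 4) ≤ (1 / 2 : ℝ) ^ ((n : ℝ) / 2) :=
    Real.rpow_le_rpow_of_exponent_ge (by norm_num) (by norm_num) (by linarith)
  have e2 : (1 / 2 : ℝ) * n = n / 2 := by ring
  rw [e2] at h3
  have e3 : 4 / (n : ℝ) ^ 2 ≤ 1 := by
    rw [div_le_one (by positivity)]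
    nlinarith
  rw [le_div_iff₀ (by positivity)]
  have e4 : 0 ≤ (1 / 2 : ℝ) ^ ((n : ℝ) / 2) := by positivity
  calc _ ≤ ((1 + 1) * (1 / 2 : ℝ) ^ ((n : ℝ) / 2) + (1 / 2 : ℝ) ^ ((n : ℝ) / 2)) * (n : ℝ) ^ 2 := by
        gcongr
    _ ≤ 1 := by linarith

lemma sum_shadowCount (S : Finset (Lay n k)) : ∑ F ∈ S.powerset, shadowCount n k F
    = (((highAC n k).filter fun B => sh k B ⊆ S).card : ℝ) := by
  classical
  rw [Finset.card_eq_sum_card_fiberwise (f := sh k) (t := S.powerset)]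
  · push_cast
    refine Finset.sum_congr rfl fun F hF => ?_
    rw [shadowCount, Finset.filter_filter]
    congr 2
    refine Finset.filter_congr fun B _ => ?_
    constructor
    · intro h
      exact ⟨by rw [h]; exact Finset.mem_powerset.mp hF, h⟩
    · exact fun h => h.2
  · intro B hB
    have hB : B ∈ (highAC n k).filter fun B => sh k B ⊆ S := hB
    rw [Finset.mem_coe, Finset.mem_powerset]
    exact (Finset.mem_filter.mp hB).2

lemma sum_half_pow_eq_partZ (S : Finset (Lay n k)) :
    ∑ B ∈ (highAC n (k + 1)).filter (fun B => sh k B ⊆ S), (1 / 2 : ℝ) ^ (sh k B).card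
      = partZ (below n k) (shadowCount n (k + 1)) (inner (below n k) S) := by
  classical
  rw [partZ, ← Finset.sum_fiberwise_of_maps_to (g := sh (k + 1))
    (t := (inner (below n k) S).powerset)]
  · refine Finset.sum_congr rfl fun F hF => ?_
    rw [shadowCount, ← nsmul_eq_mul, ← Finset.sum_const, Finset.filter_filter]
    refine Finset.sum_congr ?_ fun B hB => ?_
    · refine Finset.filter_congr fun B hB => ?_
      constructor
      · exact fun h => h.2
      · intro h
        refine ⟨?_, h⟩
        rw [← nbr_sh hB, h]
        exact (nbr_mono (Finset.mem_powerset.mp hF)).trans (nbr_inner_subset S)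
    · rw [Finset.mem_filter] at hB
      rw [← hB.2, nbr_sh hB.1]
  · intro B hB
    rw [Finset.mem_filter] at hB
    rw [Finset.mem_powerset]
    intro x hx
    rw [mem_inner]
    refine Finset.Subset.trans ?_ hB.2
    rw [← nbr_sh hB.1]
    exact mem_inner.mp (subset_inner_nbr _ hx)

open Classical in
/-- The elements of rank `k` of a set. -/
noncomputable def layerPart (k : ℕ) (B : Finset (Cube n)) : Finset (Lay n k) :=
  Finset.univ.filter fun x => x.1 ∈ B

lemma mem_layerPart {B : Finset (Cube n)} {x : Lay n k} : x ∈ layerPart k B ↔ x.1 ∈ B := by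
  simp [layerPart]

lemma layerPart_disjoint_sh {A B : Finset (Cube n)} (hA : IsAntichain (· ≤ ·) (A : Set (Cube n)))
    (hB : B ⊆ A) (hrk : ∀ b ∈ B, k < rk b) : Disjoint (layerPart k A) (sh k B) := by
  rw [Finset.disjoint_left]
  intro x hx hx'
  obtain ⟨b, hb, hxb⟩ := mem_sh.mp hx'
  have hxA := mem_layerPart.mp hx
  have h1 := hrk b hb
  refine hA (by exact_mod_cast hxA) (by exact_mod_cast hB hb) ?_ hxb
  intro h
  rw [← h, x.2] at h1
  omega

lemma card_shadow_subset_le (S : Finset (Lay n k)) :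
    (((highAC n k).filter fun B => sh k B ⊆ S).card : ℝ) ≤ 2 ^ S.card *
      ∑ B ∈ (highAC n (k + 1)).filter (fun B => sh k B ⊆ S), (1 / 2 : ℝ) ^ (sh k B).card := by
  classical
  have hinj : ((highAC n k).filter fun B => sh k B ⊆ S).card ≤
      (((highAC n (k + 1)).filter (fun B => sh k B ⊆ S)).sigma
        fun B => (S \ sh k B).powerset).card := by
    refine Finset.card_le_card_of_injOn
      (fun B => ⟨B.filter (fun b => k < rk b), layerPart k B⟩) ?_ ?_
    · intro B hB
      have hB : B ∈ (highAC n k).filter fun B => sh k B ⊆ S := hB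
      rw [Finset.mem_filter] at hB
      have hsub : B.filter (fun b => k < rk b) ⊆ B := Finset.filter_subset _ _
      rw [Finset.mem_coe, Finset.mem_sigma, Finset.mem_filter, Finset.mem_powerset]
      refine ⟨⟨?_, ?_⟩, ?_⟩
      · rw [mem_highAC]
        exact ⟨(mem_highAC.mp (highAC_subset hB.1 hsub)).1, fun b hb => (Finset.mem_filter.mp hb).2⟩
      · refine Finset.Subset.trans ?_ hB.2
        intro x hx
        obtain ⟨b, hb, hxb⟩ := mem_sh.mp hx
        exact mem_sh.mpr ⟨b, hsub hb, hxb⟩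
      · rw [Finset.subset_sdiff]
        refine ⟨?_, layerPart_disjoint_sh (mem_highAC.mp hB.1).1 hsub
          fun b hb => (Finset.mem_filter.mp hb).2⟩
        intro x hx
        exact hB.2 (mem_sh.mpr ⟨x.1, mem_layerPart.mp hx, le_rfl⟩)
    · intro B hB B' hB' heq
      have hB : B ∈ (highAC n k).filter fun B => sh k B ⊆ S := hB
      have hB' : B' ∈ (highAC n k).filter fun B => sh k B ⊆ S := hB'
      rw [Finset.mem_filter, mem_highAC] at hB hB'
      simp only [Sigma.mk.injEq, heq_eq_eq] at heq
      ext b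
      have e1 := Finset.ext_iff.mp heq.1 b
      rw [Finset.mem_filter, Finset.mem_filter] at e1
      rcases lt_trichotomy (rk b) k with h | h | h
      · constructor
        · intro hb
          have := hB.1.2 b hb
          omega
        · intro hb
          have := hB'.1.2 b hb
          omega
      · have e2 := Finset.ext_iff.mp heq.2 ⟨b, h⟩
        rw [mem_layerPart, mem_layerPart] at e2
        exact e2
      · simpa [h] using e1
  refine (Nat.cast_le.mpr hinj).trans (le_of_eq ?_)
  rw [Finset.card_sigma, Finset.mul_sum]
  push_cast
  refine Finset.sum_congr rfl fun B hB => ?_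
  have hsub := (Finset.mem_filter.mp hB).2
  rw [Finset.card_powerset, ← Finset.card_sdiff_add_card_eq_card hsub]
  push_cast
  rw [pow_add, mul_assoc, ← mul_pow]
  norm_num

lemma linkedSum_le_of_tame (ha : Admissible n) (hk : n ≤ k)
    (ht : Tame (shadowCount n (k + 1)) n) (x : Lay n (k + 1)) :
    linkedSum (below n k) (shadowCount n (k + 1)) x
      ≤ (1 + 4 / (n : ℝ) ^ 2) * (1 / 2) ^ (dn (below n k) x).card
        + (1 / 2 : ℝ) ^ (3 * (n : ℝ) / 4) :=
  (layerGraph_below ha.sixteen_le hk).linkedSum_le ha.big card_lay_le _ ht x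

lemma tame_step (ha : Admissible n) (hk : n ≤ k) (ht : Tame (shadowCount n (k + 1)) n) :
    Tame (shadowCount n k) n := by
  have hG := layerGraph_below ha.sixteen_le hk
  have hn : 0 < n := by have := ha.sixteen_le; omega
  refine ⟨shadowCount_nonneg, shadowCount_empty, fun S => ?_⟩
  rw [sum_shadowCount]
  refine (card_shadow_subset_le S).trans ?_
  rw [sum_half_pow_eq_partZ]
  refine mul_le_mul_of_nonneg_left ?_ (by positivity)
  refine (partZ_le_exp shadowCount_nonneg shadowCount_empty shadowCount_submult _).trans ?_
  refine Real.exp_le_exp.mpr ?_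
  have hcard : ((inner (below n k) S).card : ℝ) ≤ S.card := by
    exact_mod_cast (hG.card_le_card_nbr hn _).trans (Finset.card_le_card (nbr_inner_subset S))
  calc _ ≤ ∑ x ∈ inner (below n k) S, (1 / (n : ℝ) ^ 2) := by
        refine Finset.sum_le_sum fun x _ => ?_
        refine (linkedSum_le_of_tame ha hk ht x).trans (le_trans ?_ ha.weight)
        have : (1 / 2 : ℝ) ^ (dn (below n k) x).card ≤ (1 / 2 : ℝ) ^ ((n : ℝ) / 2) := by
          rw [← Real.rpow_natCast]
          exact Real.rpow_le_rpow_of_exponent_ge (by norm_num) (by norm_num) (hG.deg_lower x)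
        gcongr
    _ = (inner (below n k) S).card * (1 / (n : ℝ) ^ 2) := by
        rw [Finset.sum_const, nsmul_eq_mul]
    _ ≤ S.card * (1 / (n : ℝ) ^ 2) := by gcongr
    _ = _ := by ring

lemma rk_le (x : Cube n) : rk x ≤ 2 * n := by
  have h1 := cnt_add x
  have h2 := rk_eq_cnt x
  omega

theorem tame_shadowCount (ha : Admissible n) {k : ℕ} (hk : n ≤ k) : Tame (shadowCount n k) n := by
  induction hd : 2 * n + 1 - k using Nat.strong_induction_on generalizing k with
  | _ d ih =>
    rcases le_or_gt k (2 * n) with h | h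
    · exact tame_step ha hk (ih _ (by omega) (by omega : n ≤ k + 1) rfl)
    · refine ⟨shadowCount_nonneg, shadowCount_empty, fun S => ?_⟩
      have : S = ∅ := by
        rw [Finset.eq_empty_iff_forall_notMem]
        intro x _
        have h1 := x.2
        have h2 := rk_le x.1
        omega
      subst this
      simp [shadowCount_empty]

/-- The partition function of the part above the middle layer. -/
noncomputable def upperZ (n : ℕ) : ℝ := ∑ B ∈ highAC n (n + 1), (1 / 2 : ℝ) ^ (sh n B).card

/-- The total weight of the layer above the middle one. -/
noncomputable def layerWeight (n : ℕ) : ℝ :=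
  ∑ x : Lay n (n + 1), (1 / 2 : ℝ) ^ (cnt x.1 1 + cnt x.1 2)

theorem upperZ_le (ha : Admissible n) : upperZ n ≤ Real.exp ((1 + 4 / (n : ℝ) ^ 2) * layerWeight n
    + 3 ^ n * (1 / 2 : ℝ) ^ (3 * (n : ℝ) / 4)) := by
  classical
  have h1 : upperZ n = partZ (below n n) (shadowCount n (n + 1)) (inner (below n n) Finset.univ) := by
    rw [← sum_half_pow_eq_partZ, Finset.filter_true_of_mem fun _ _ => Finset.subset_univ _, upperZ]
  rw [h1]
  refine (partZ_le_exp shadowCount_nonneg shadowCount_empty shadowCount_submult _).trans ?_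
  refine Real.exp_le_exp.mpr ?_
  have hu : inner (below n n) Finset.univ = Finset.univ := by ext; simp
  rw [hu]
  calc _ ≤ ∑ x : Lay n (n + 1), ((1 + 4 / (n : ℝ) ^ 2) * (1 / 2) ^ (cnt x.1 1 + cnt x.1 2)
        + (1 / 2 : ℝ) ^ (3 * (n : ℝ) / 4)) := by
        refine Finset.sum_le_sum fun x _ => ?_
        rw [← card_dn x]
        exact linkedSum_le_of_tame ha le_rfl (tame_shadowCount ha (by omega)) x
    _ = (1 + 4 / (n : ℝ) ^ 2) * layerWeight n
        + (Fintype.card (Lay n (n + 1))) * (1 / 2 : ℝ) ^ (3 * (n : ℝ) / 4) := by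
        rw [Finset.sum_add_distrib, ← Finset.mul_sum, layerWeight, Finset.sum_const, nsmul_eq_mul,
          Finset.card_univ]
    _ ≤ _ := by
        have : (Fintype.card (Lay n (n + 1)) : ℝ) ≤ 3 ^ n := by exact_mod_cast card_lay_le
        gcongr

end TameShadows

section Reverse
variable {n k : ℕ}

/-- The order-reversing involution. -/
def rv (x : Cube n) : Cube n := fun i => (x i).rev

lemma rv_rv (x : Cube n) : rv (rv x) = x := by
  funext i
  simp [rv]

lemma rv_injective : Function.Injective (rv (n := n)) := fun x y h => by
  rw [← rv_rv x, h, rv_rv]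

lemma rv_le_rv {x y : Cube n} : rv x ≤ rv y ↔ y ≤ x := by
  simp [rv, Pi.le_def, Fin.rev_le_rev]

lemma rv_le {x y : Cube n} : rv x ≤ y ↔ rv y ≤ x := by
  rw [← rv_le_rv, rv_rv]

lemma rk_rv (x : Cube n) : rk (rv x) + rk x = 2 * n := by
  rw [rk, rk, ← Finset.sum_add_distrib, Finset.sum_congr rfl (g := fun _ => 2)]
  · simp [mul_comm]
  · intro i _
    simp only [rv]
    generalize x i = a
    revert a
    decide

/-- The involution on the middle layer. -/
def rvMid (x : Lay n n) : Lay n n := ⟨rv x.1, by have := rk_rv x.1; have := x.2; omega⟩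

lemma rvMid_injective : Function.Injective (rvMid (n := n)) := fun _ _ h =>
  Subtype.ext (rv_injective (congrArg Subtype.val h))

lemma rvMid_rvMid (x : Lay n n) : rvMid (rvMid x) = x := Subtype.ext (rv_rv x.1)

lemma mem_image_rvMid {S : Finset (Lay n n)} {x : Lay n n} :
    x ∈ S.image rvMid ↔ rvMid x ∈ S := by
  rw [Finset.mem_image]
  constructor
  · rintro ⟨y, hy, rfl⟩
    rwa [rvMid_rvMid]
  · intro h
    exact ⟨_, h, rvMid_rvMid x⟩

/-- The antichain determines its upper, lower and middle parts injectively. -/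
theorem card_antichains_le :
    ((highAC n 0).card : ℝ) ≤ 2 ^ Fintype.card (Lay n n) * upperZ n ^ 2 := by
  classical
  have hinj : (highAC n 0).card ≤ (((highAC n (n + 1) ×ˢ highAC n (n + 1)).filter
      (fun p => Disjoint (sh n p.1) ((sh n p.2).image rvMid))).sigma
        fun p => (Finset.univ \ (sh n p.1 ∪ (sh n p.2).image rvMid)).powerset).card := by
    refine Finset.card_le_card_of_injOn
      (fun A => ⟨(A.filter (fun b => n < rk b), (A.filter (fun b => rk b < n)).image rv),
        layerPart n A⟩) ?_ ?_
    · intro A hA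
      have hA : A ∈ highAC n 0 := hA
      have hac := (mem_highAC.mp hA).1
      have hlow : ∀ x : Lay n n, x ∈ ((sh n ((A.filter (fun b => rk b < n)).image rv)).image rvMid) →
          ∃ a ∈ A, rk a < n ∧ a ≤ x.1 := by
        intro x hx
        obtain ⟨b, hb, hxb⟩ := mem_sh.mp (mem_image_rvMid.mp hx)
        obtain ⟨a, ha, rfl⟩ := Finset.mem_image.mp hb
        rw [Finset.mem_filter] at ha
        exact ⟨a, ha.1, ha.2, rv_le_rv.mp hxb⟩
      have hup : ∀ x : Lay n n, x ∈ sh n (A.filter (fun b => n < rk b)) →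
          ∃ a ∈ A, n < rk a ∧ x.1 ≤ a := by
        intro x hx
        obtain ⟨a, ha, hxa⟩ := mem_sh.mp hx
        rw [Finset.mem_filter] at ha
        exact ⟨a, ha.1, ha.2, hxa⟩
      rw [Finset.mem_coe, Finset.mem_sigma, Finset.mem_filter, Finset.mem_product,
        Finset.mem_powerset]
      refine ⟨⟨⟨?_, ?_⟩, ?_⟩, ?_⟩
      · rw [mem_highAC]
        exact ⟨(mem_highAC.mp (highAC_subset hA (Finset.filter_subset _ _))).1,
          fun b hb => (Finset.mem_filter.mp hb).2⟩
      · rw [mem_highAC]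
        constructor
        · intro b hb c hc hne hle
          obtain ⟨b', hb', rfl⟩ := Finset.mem_image.mp (Finset.mem_coe.mp hb)
          obtain ⟨c', hc', rfl⟩ := Finset.mem_image.mp (Finset.mem_coe.mp hc)
          rw [Finset.mem_filter] at hb' hc'
          exact hac (Finset.mem_coe.mpr hc'.1) (Finset.mem_coe.mpr hb'.1)
            (fun h => hne (by rw [h])) (rv_le_rv.mp hle)
        · intro b hb
          obtain ⟨b', hb', rfl⟩ := Finset.mem_image.mp hb
          have h1 := (Finset.mem_filter.mp hb').2
          have h2 := rk_rv b'
          omega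
      · rw [Finset.disjoint_left]
        intro x hx hx'
        obtain ⟨a, ha, har, hxa⟩ := hup x hx
        obtain ⟨c, hc, hcr, hxc⟩ := hlow x hx'
        exact hac (Finset.mem_coe.mpr hc) (Finset.mem_coe.mpr ha)
          (fun h => by rw [h] at hcr; omega) (hxc.trans hxa)
      · intro x hx
        have hxA := mem_layerPart.mp hx
        rw [Finset.mem_sdiff, Finset.mem_union]
        refine ⟨Finset.mem_univ _, ?_⟩
        rintro (h | h)
        · obtain ⟨a, ha, har, hxa⟩ := hup x h
          exact hac (Finset.mem_coe.mpr hxA) (Finset.mem_coe.mpr ha)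
            (fun h => by rw [← h, x.2] at har; omega) hxa
        · obtain ⟨a, ha, har, hxa⟩ := hlow x h
          exact hac (Finset.mem_coe.mpr ha) (Finset.mem_coe.mpr hxA)
            (fun h => by rw [h, x.2] at har; omega) hxa
    · intro A _ A' _ heq
      simp only [Sigma.mk.injEq, heq_eq_eq, Prod.mk.injEq] at heq
      have e2 := Finset.image_injective rv_injective heq.1.2
      ext a
      rcases lt_trichotomy (rk a) n with h | h | h
      · have := Finset.ext_iff.mp e2 a
        rw [Finset.mem_filter, Finset.mem_filter] at this
        simpa [h] using this
      · have e3 := Finset.ext_iff.mp heq.2 ⟨a, h⟩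
        rw [mem_layerPart, mem_layerPart] at e3
        exact e3
      · have := Finset.ext_iff.mp heq.1.1 a
        rw [Finset.mem_filter, Finset.mem_filter] at this
        simpa [h] using this
  refine (Nat.cast_le.mpr hinj).trans ?_
  rw [Finset.card_sigma, upperZ, pow_two, Finset.sum_mul_sum, ← Finset.sum_product', Finset.mul_sum]
  push_cast
  refine le_trans (le_of_eq ?_) (Finset.sum_le_sum_of_subset_of_nonneg (Finset.filter_subset
    (fun p => Disjoint (sh n p.1) ((sh n p.2).image rvMid)) _) fun p _ _ => by positivity)
  refine Finset.sum_congr rfl fun p hp => ?_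
  have hd := (Finset.mem_filter.mp hp).2
  have hc : (sh n p.1 ∪ (sh n p.2).image rvMid).card = (sh n p.1).card + (sh n p.2).card := by
    rw [Finset.card_union_of_disjoint hd, Finset.card_image_of_injective _ rvMid_injective]
  have hu := Finset.card_sdiff_add_card_eq_card
    (Finset.subset_univ (sh n p.1 ∪ (sh n p.2).image rvMid))
  rw [Finset.card_powerset, ← Finset.card_univ, ← hu, hc]
  push_cast
  rw [← pow_add, pow_add (2 : ℝ), mul_assoc, ← mul_pow]
  norm_num

end Reverse

section LowerBound
variable {n : ℕ}

/-- The weight of an element just above the middle layer. -/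
noncomputable def wt (x : Lay n (n + 1)) : ℝ := (1 / 2 : ℝ) ^ (cnt x.1 1 + cnt x.1 2)

lemma wt_pos (x : Lay n (n + 1)) : 0 < wt x := by rw [wt]; positivity

lemma wt_le (x : Lay n (n + 1)) : wt x ≤ (1 / 2 : ℝ) ^ ((n : ℝ) / 2) := by
  rw [wt, ← Real.rpow_natCast]
  refine Real.rpow_le_rpow_of_exponent_ge (by norm_num) (by norm_num) ?_
  have h1 := cnt_add x.1
  have h2 := rk_eq_cnt x.1
  have h3 := x.2
  have : n ≤ 2 * (cnt x.1 1 + cnt x.1 2) := by omega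
  have : (n : ℝ) ≤ 2 * (cnt x.1 1 + cnt x.1 2) := by exact_mod_cast this
  push_cast
  linarith

open Classical in
/-- The elements just above the middle layer lying above some reflected element of `Q`. -/
noncomputable def conflict (Q : Finset (Lay n (n + 1))) : Finset (Lay n (n + 1)) :=
  Finset.univ.filter fun x => ∃ q ∈ Q, rv q.1 ≤ x.1

lemma mem_conflict {Q : Finset (Lay n (n + 1))} {x : Lay n (n + 1)} :
    x ∈ conflict Q ↔ ∃ q ∈ Q, rv q.1 ≤ x.1 := by simp [conflict]

lemma card_conflict_le (Q : Finset (Lay n (n + 1))) : (conflict Q).card ≤ Q.card * n ^ 2 := by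
  classical
  have hsub : (conflict Q).image Subtype.val ⊆
      (Q ×ˢ (Finset.univ : Finset (Fin n × Fin n))).image (fun p =>
        Function.update (Function.update (rv p.1.1) p.2.1 (rv p.1.1 p.2.1 + 1)) p.2.2
          (Function.update (rv p.1.1) p.2.1 (rv p.1.1 p.2.1 + 1) p.2.2 + 1)) := by
    intro z hz
    obtain ⟨x, hx, rfl⟩ := Finset.mem_image.mp hz
    obtain ⟨q, hq, hqx⟩ := mem_conflict.mp hx
    have h1 := rk_rv q.1
    have h2 := q.2
    have h3 := x.2
    have step : ∀ {u v : Cube n}, u ≤ v → rk v = rk u + 1 →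
        ∃ i, v = Function.update u i (u i + 1) := by
      intro u v huv hr
      obtain ⟨i, e1, -, e2⟩ := exists_update_of_cover huv hr
      refine ⟨i, ?_⟩
      rw [show u i + 1 = v i from ?_]
      · exact e2
      · apply Fin.ext
        rw [val_add_one, e1]
        intro h0
        rw [h0] at e1
        have := (v i).2
        simp at e1
        omega
    obtain ⟨y, hy1, hy2, hy3⟩ := exists_cover_above hqx (by omega)
    obtain ⟨i, hi⟩ := step hy1 hy3
    obtain ⟨j, hj⟩ := step hy2 (by omega)
    rw [Finset.mem_image]
    refine ⟨(q, (i, j)), by simp [hq], ?_⟩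
    dsimp only
    rw [← hi, ← hj]
  have h := (Finset.card_le_card hsub).trans Finset.card_image_le
  rw [Finset.card_image_of_injective _ Subtype.val_injective, Finset.card_product,
    Finset.card_univ, Fintype.card_prod, Fintype.card_fin] at h
  rw [pow_two]
  exact h

lemma card_nbr_le_sum (P : Finset (Lay n (n + 1))) :
    (nbr (below n n) P).card ≤ ∑ x ∈ P, (cnt x.1 1 + cnt x.1 2) := by
  classical
  have : nbr (below n n) P = P.biUnion fun x => dn (below n n) x := by
    ext y
    simp
  rw [this]
  refine Finset.card_biUnion_le.trans (le_of_eq ?_)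
  exact Finset.sum_congr rfl fun x _ => card_dn x

open Classical in
/-- The antichain assembled from parts just above, just below and in the middle layer. -/
noncomputable def assemble (P Q : Finset (Lay n (n + 1))) (M : Finset (Lay n n)) :
    Finset (Cube n) :=
  P.image Subtype.val ∪ (Q.image fun q => rv q.1) ∪ M.image Subtype.val

lemma mem_assemble {P Q : Finset (Lay n (n + 1))} {M : Finset (Lay n n)} {a : Cube n} :
    a ∈ assemble P Q M ↔ (∃ x ∈ P, x.1 = a) ∨ (∃ q ∈ Q, rv q.1 = a) ∨ ∃ y ∈ M, y.1 = a := by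
  simp only [assemble, Finset.mem_union, Finset.mem_image, or_assoc]

lemma rk_rv_lay (q : Lay n (n + 1)) : rk (rv q.1) + 1 = n := by
  have h1 := rk_rv q.1
  have h2 := q.2
  omega

lemma assemble_mem {P Q : Finset (Lay n (n + 1))} {M : Finset (Lay n n)}
    (hPQ : Disjoint P (conflict Q)) (hMP : Disjoint M (nbr (below n n) P))
    (hMQ : Disjoint M ((nbr (below n n) Q).image rvMid)) : assemble P Q M ∈ highAC n 0 := by
  rw [mem_highAC]
  refine ⟨?_, fun _ _ => Nat.zero_le _⟩
  intro a ha b hb hne hle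
  have hlt : rk a < rk b := by
    by_contra! hge
    exact hne (eq_of_le_of_rk_le hle hge)
  rcases mem_assemble.mp (Finset.mem_coe.mp ha) with ⟨x, hx, rfl⟩ | ⟨q, hq, rfl⟩ | ⟨y, hy, rfl⟩ <;>
  rcases mem_assemble.mp (Finset.mem_coe.mp hb) with ⟨x', hx', rfl⟩ | ⟨q', hq', rfl⟩ | ⟨y', hy', rfl⟩
  · rw [x.2, x'.2] at hlt; omega
  · rw [x.2] at hlt; have := rk_rv_lay q'; omega
  · rw [x.2, y'.2] at hlt; omega
  · exact Finset.disjoint_left.mp hPQ hx' (mem_conflict.mpr ⟨q, hq, hle⟩)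
  · have := rk_rv_lay q; have := rk_rv_lay q'; omega
  · refine Finset.disjoint_left.mp hMQ hy' (mem_image_rvMid.mpr (mem_nbr.mpr ⟨q, hq, ?_⟩))
    exact rv_le.mp hle
  · exact Finset.disjoint_left.mp hMP hy (mem_nbr.mpr ⟨x', hx', hle⟩)
  · rw [y.2] at hlt; have := rk_rv_lay q'; omega
  · rw [y.2, y'.2] at hlt; omega

lemma assemble_upper {P Q : Finset (Lay n (n + 1))} {M : Finset (Lay n n)} {x : Lay n (n + 1)} :
    x.1 ∈ assemble P Q M ↔ x ∈ P := by
  rw [mem_assemble]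
  constructor
  · rintro (⟨x', hx', h⟩ | ⟨q, hq, h⟩ | ⟨y, hy, h⟩)
    · rwa [← Subtype.ext h]
    · have h1 := rk_rv_lay q
      rw [h, x.2] at h1
      omega
    · have h1 := y.2
      rw [h, x.2] at h1
      omega
  · exact fun h => Or.inl ⟨x, h, rfl⟩

lemma assemble_lower {P Q : Finset (Lay n (n + 1))} {M : Finset (Lay n n)} {q : Lay n (n + 1)} :
    rv q.1 ∈ assemble P Q M ↔ q ∈ Q := by
  rw [mem_assemble]
  have h0 := rk_rv_lay q
  constructor
  · rintro (⟨x', hx', h⟩ | ⟨q', hq', h⟩ | ⟨y, hy, h⟩)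
    · have h1 := x'.2
      rw [h] at h1
      omega
    · rwa [← Subtype.ext (rv_injective h)]
    · have h1 := y.2
      rw [h] at h1
      omega
  · exact fun h => Or.inr (Or.inl ⟨q, h, rfl⟩)

lemma assemble_mid {P Q : Finset (Lay n (n + 1))} {M : Finset (Lay n n)} {y : Lay n n} :
    y.1 ∈ assemble P Q M ↔ y ∈ M := by
  rw [mem_assemble]
  constructor
  · rintro (⟨x', hx', h⟩ | ⟨q', hq', h⟩ | ⟨y', hy', h⟩)
    · have h1 := x'.2
      rw [h, y.2] at h1
      omega
    · have h1 := rk_rv_lay q'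
      rw [h, y.2] at h1
      omega
    · rwa [← Subtype.ext h]
  · exact fun h => Or.inr (Or.inr ⟨y, h, rfl⟩)

lemma sum_le_card_antichains :
    2 ^ Fintype.card (Lay n n) * ∑ Q : Finset (Lay n (n + 1)),
      ∑ P ∈ (Finset.univ \ conflict Q).powerset, (∏ q ∈ Q, wt q) * ∏ x ∈ P, wt x
      ≤ ((highAC n 0).card : ℝ) := by
  classical
  have hinj : (((Finset.univ : Finset (Finset (Lay n (n + 1)))).sigma
        fun Q => (Finset.univ \ conflict Q).powerset).sigma fun p =>
        (Finset.univ \ (nbr (below n n) p.2 ∪ (nbr (below n n) p.1).image rvMid)).powerset).card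
      ≤ (highAC n 0).card := by
    refine Finset.card_le_card_of_injOn (fun p => assemble p.1.2 p.1.1 p.2) ?_ ?_
    · rintro ⟨⟨Q, P⟩, M⟩ hp
      rw [Finset.mem_coe, Finset.mem_sigma, Finset.mem_sigma, Finset.mem_powerset,
        Finset.mem_powerset, Finset.subset_sdiff, Finset.subset_sdiff, Finset.disjoint_union_right]
        at hp
      exact assemble_mem hp.1.2.2 hp.2.2.1 hp.2.2.2
    · rintro ⟨⟨Q, P⟩, M⟩ _ ⟨⟨Q', P'⟩, M'⟩ _ heq
      dsimp only at heq
      have e1 : P = P' := by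
        ext x
        rw [← assemble_upper (P := P) (Q := Q) (M := M), heq, assemble_upper]
      have e2 : Q = Q' := by
        ext x
        rw [← assemble_lower (P := P) (Q := Q) (M := M), heq, assemble_lower]
      have e3 : M = M' := by
        ext x
        rw [← assemble_mid (P := P) (Q := Q) (M := M), heq, assemble_mid]
      subst e1 e2 e3
      rfl
  refine le_trans ?_ (Nat.cast_le.mpr hinj)
  rw [Finset.card_sigma, Finset.sum_sigma, Finset.mul_sum]
  push_cast
  refine Finset.sum_le_sum fun Q _ => ?_
  rw [Finset.mul_sum]
  refine Finset.sum_le_sum fun P _ => ?_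
  have hwt : ∀ S : Finset (Lay n (n + 1)),
      ∏ x ∈ S, wt x = (1 / 2 : ℝ) ^ ∑ x ∈ S, (cnt x.1 1 + cnt x.1 2) := by
    intro S
    rw [← Finset.prod_pow_eq_pow_sum]
    rfl
  have hc : (nbr (below n n) P ∪ (nbr (below n n) Q).image rvMid).card ≤
      ∑ x ∈ Q, (cnt x.1 1 + cnt x.1 2) + ∑ x ∈ P, (cnt x.1 1 + cnt x.1 2) := by
    refine (Finset.card_union_le _ _).trans ?_
    rw [Finset.card_image_of_injective _ rvMid_injective, add_comm]
    exact add_le_add (card_nbr_le_sum Q) (card_nbr_le_sum P)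
  have hu := Finset.card_sdiff_add_card_eq_card
    (Finset.subset_univ (nbr (below n n) P ∪ (nbr (below n n) Q).image rvMid))
  rw [hwt, hwt, ← pow_add, Finset.card_powerset]
  calc _ ≤ (2 : ℝ) ^ Fintype.card (Lay n n) *
        (1 / 2) ^ (nbr (below n n) P ∪ (nbr (below n n) Q).image rvMid).card := by
        refine mul_le_mul_of_nonneg_left ?_ (by positivity)
        exact pow_le_pow_of_le_one (by norm_num) (by norm_num) hc
    _ = _ := by
        rw [← Finset.card_univ, ← hu]
        push_cast
        rw [pow_add, mul_assoc, ← mul_pow]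
        norm_num

/-- The correction from excluding conflicts between the two sides. -/
noncomputable def gap (n : ℕ) : ℝ := (n : ℝ) ^ 2 * (1 / 2 : ℝ) ^ ((n : ℝ) / 2)

lemma prod_mul_prod_le_card_antichains :
    2 ^ Fintype.card (Lay n n) * ((∏ x : Lay n (n + 1), (1 + wt x)) *
      ∏ x : Lay n (n + 1), (1 + Real.exp (-gap n) * wt x)) ≤ ((highAC n 0).card : ℝ) := by
  classical
  refine le_trans ?_ sum_le_card_antichains
  refine mul_le_mul_of_nonneg_left ?_ (by positivity)
  rw [Finset.prod_one_add (f := fun x => Real.exp (-gap n) * wt x), Finset.powerset_univ,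
    Finset.mul_sum]
  refine Finset.sum_le_sum fun Q _ => ?_
  rw [← Finset.mul_sum, ← Finset.prod_one_add, Finset.prod_mul_distrib, Finset.prod_const]
  have hsplit := Finset.prod_sdiff (f := fun x => 1 + wt x) (Finset.subset_univ (conflict Q))
  have hQ : ∏ x ∈ conflict Q, (1 + wt x) ≤ Real.exp (gap n) ^ Q.card := by
    calc ∏ x ∈ conflict Q, (1 + wt x) ≤ ∏ x ∈ conflict Q, Real.exp ((1 / 2 : ℝ) ^ ((n : ℝ) / 2)) := by
          refine Finset.prod_le_prod (fun x _ => by linarith [wt_pos x]) fun x _ => ?_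
          have := Real.add_one_le_exp ((1 / 2 : ℝ) ^ ((n : ℝ) / 2))
          linarith [wt_le x]
      _ = Real.exp ((conflict Q).card * (1 / 2 : ℝ) ^ ((n : ℝ) / 2)) := by
          rw [Finset.prod_const, Real.exp_nat_mul]
      _ ≤ Real.exp (Q.card * gap n) := by
          refine Real.exp_le_exp.mpr ?_
          rw [gap, ← mul_assoc]
          refine mul_le_mul_of_nonneg_right ?_ (by positivity)
          exact_mod_cast card_conflict_le Q
      _ = _ := by rw [Real.exp_nat_mul]
  have hS : 0 ≤ ∏ x ∈ Finset.univ \ conflict Q, (1 + wt x) :=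
    Finset.prod_nonneg fun x _ => by linarith [wt_pos x]
  have hQ0 : 0 ≤ ∏ q ∈ Q, wt q := Finset.prod_nonneg fun x _ => (wt_pos x).le
  have he : Real.exp (gap n) ^ Q.card * Real.exp (-gap n) ^ Q.card = 1 := by
    rw [← mul_pow, ← Real.exp_add]
    simp
  rw [← hsplit]
  calc _ ≤ ((∏ x ∈ Finset.univ \ conflict Q, (1 + wt x)) * Real.exp (gap n) ^ Q.card) *
        (Real.exp (-gap n) ^ Q.card * ∏ q ∈ Q, wt q) := by
        refine mul_le_mul_of_nonneg_right (mul_le_mul_of_nonneg_left hQ hS) ?_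
        positivity
    _ = (∏ q ∈ Q, wt q) * (∏ x ∈ Finset.univ \ conflict Q, (1 + wt x)) *
        (Real.exp (gap n) ^ Q.card * Real.exp (-gap n) ^ Q.card) := by ring
    _ ≤ _ := by rw [he, mul_one]

lemma mul_le_log_one_add {t ε : ℝ} (h0 : 0 ≤ t) (hε : t ≤ ε) :
    (1 - ε) * t ≤ Real.log (1 + t) := by
  have h1 := Real.one_sub_inv_le_log_of_pos (show 0 < 1 + t by linarith)
  refine le_trans ?_ h1
  have : 1 - (1 + t)⁻¹ = t / (1 + t) := by
    field_simp
    ring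
  rw [this, le_div_iff₀ (by linarith)]
  have h2 : 0 ≤ t * (ε - t) := mul_nonneg h0 (by linarith)
  have h3 : 0 ≤ ε * (t * t) := mul_nonneg (h0.trans hε) (mul_self_nonneg t)
  linarith

theorem le_log_card_antichains :
    (1 - (1 / 2 : ℝ) ^ ((n : ℝ) / 2)) * (1 + Real.exp (-gap n)) * layerWeight n
      ≤ Real.log ((highAC n 0).card / 2 ^ Fintype.card (Lay n n)) := by
  have hg : 0 ≤ gap n := by rw [gap]; positivity
  have he : Real.exp (-gap n) ≤ 1 := Real.exp_le_one_iff.mpr (by linarith)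
  have he0 := Real.exp_pos (-gap n)
  have h := prod_mul_prod_le_card_antichains (n := n)
  rw [mul_comm, ← le_div_iff₀ (by positivity)] at h
  have hp1 : 0 < ∏ x : Lay n (n + 1), (1 + wt x) :=
    Finset.prod_pos fun x _ => by linarith [wt_pos x]
  have hp2 : 0 < ∏ x : Lay n (n + 1), (1 + Real.exp (-gap n) * wt x) :=
    Finset.prod_pos fun x _ => by have := wt_pos x; positivity
  refine le_trans ?_ (Real.log_le_log (mul_pos hp1 hp2) h)
  rw [Real.log_mul hp1.ne' hp2.ne', Real.log_prod (fun x _ => by have := wt_pos x; positivity),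
    Real.log_prod (fun x _ => by have := wt_pos x; positivity), ← Finset.sum_add_distrib]
  rw [layerWeight, Finset.mul_sum]
  refine Finset.sum_le_sum fun x _ => ?_
  have hw := wt_pos x
  have hw' := wt_le x
  have h1 := mul_le_log_one_add hw.le hw'
  have h2 := mul_le_log_one_add (mul_nonneg he0.le hw.le)
    ((mul_le_of_le_one_left hw.le he).trans hw')
  change _ * wt x ≤ _
  linarith

end LowerBound

section Laplace

/-- The exponential growth rate of the weight of the layer above the middle one. -/
noncomputable def rate : ℝ := (1 + 2 * Real.sqrt 2) / 2

/-- The normalised generating function of the weights on the circle of radius `√2`. -/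
noncomputable def charFn (θ : ℝ) : ℝ := 1 - Real.sqrt 2 / rate * (1 - Real.cos θ)

lemma sqrt_two_sq : Real.sqrt 2 * Real.sqrt 2 = 2 := Real.mul_self_sqrt (by norm_num)

lemma rate_gt : 191 / 100 < rate := by
  have : (1411 / 1000 : ℝ) < Real.sqrt 2 := Real.lt_sqrt_of_sq_lt (by norm_num)
  rw [rate]
  linarith

lemma rate_pos : 0 < rate := by linarith [rate_gt]

lemma rate_mul_charFn (θ : ℝ) : rate * charFn θ = 1 / 2 + Real.sqrt 2 * Real.cos θ := by
  have h := rate_pos.ne'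
  rw [charFn, mul_sub, ← mul_assoc, mul_div_cancel₀ _ h, rate]
  ring

lemma abs_charFn_le {θ : ℝ} (h : |θ| ≤ Real.pi) :
    |charFn θ| ≤ Real.exp (-(1 / (2 * Real.pi ^ 2)) * θ ^ 2) := by
  have hpi := Real.pi_pos
  have h0 := rate_pos
  have h1 : 1 / 4 ≤ Real.sqrt 2 / rate := by
    rw [le_div_iff₀ h0, rate]
    have : (1 : ℝ) < Real.sqrt 2 := Real.lt_sqrt_of_sq_lt (by norm_num)
    linarith
  have h2 : Real.sqrt 2 / rate ≤ 3 / 4 := by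
    rw [div_le_iff₀ h0, rate]
    have : Real.sqrt 2 < 1415 / 1000 := (Real.sqrt_lt' (by norm_num)).mpr (by norm_num)
    linarith
  have h3 := Real.cos_le_one_sub_mul_cos_sq h
  have h4 : θ ^ 2 ≤ Real.pi ^ 2 := sq_le_sq' (by linarith [(abs_le.mp h).1]) (abs_le.mp h).2
  have h5 : 1 / (2 * Real.pi ^ 2) * θ ^ 2 ≤ 1 / 2 := by
    rw [div_mul_eq_mul_div, one_mul, div_le_iff₀ (by positivity)]
    linarith
  have h6 : 2 / Real.pi ^ 2 * θ ^ 2 = 4 * (1 / (2 * Real.pi ^ 2) * θ ^ 2) := by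
    field_simp
    ring
  have h7 : 0 ≤ 1 / (2 * Real.pi ^ 2) * θ ^ 2 := by positivity
  have h8 := Real.add_one_le_exp (-(1 / (2 * Real.pi ^ 2)) * θ ^ 2)
  refine le_trans ?_ h8
  rw [charFn, neg_mul]
  generalize 1 / (2 * Real.pi ^ 2) * θ ^ 2 = y at *
  have h9 : 4 * y ≤ 1 - Real.cos θ := by linarith
  have h10 : 1 - Real.cos θ ≤ 2 := by linarith [Real.neg_one_le_cos θ]
  rw [abs_le]
  constructor
  · have : Real.sqrt 2 / rate * (1 - Real.cos θ) ≤ 3 / 4 * 2 := by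
      apply mul_le_mul h2 h10 (by linarith) (by norm_num)
    linarith
  · have : 1 / 4 * (4 * y) ≤ Real.sqrt 2 / rate * (1 - Real.cos θ) :=
      mul_le_mul h1 h9 (by linarith) (by linarith)
    linarith

lemma tendsto_charFn_pow (u : ℝ) :
    Tendsto (fun n : ℕ => charFn (u / Real.sqrt n) ^ n) atTop
      (nhds (Real.exp (-(Real.sqrt 2 / rate / 2) * u ^ 2))) := by
  have h0 : Tendsto (fun n : ℕ => u / Real.sqrt n) atTop (nhds 0) :=
    tendsto_const_nhds.div_atTop (Real.tendsto_sqrt_atTop.comp tendsto_natCast_atTop_atTop)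
  have h1 : Tendsto (fun n : ℕ => Real.sinc (u / Real.sqrt n / 2)) atTop (nhds 1) := by
    have := (Real.continuous_sinc.tendsto (0 / 2)).comp (h0.div_const 2)
    rwa [zero_div, Real.sinc_zero] at this
  have h2 : Tendsto (fun n : ℕ => -(Real.sqrt 2 / rate / 2) * u ^ 2 *
      Real.sinc (u / Real.sqrt n / 2) ^ 2) atTop
      (nhds (-(Real.sqrt 2 / rate / 2) * u ^ 2)) := by
    have := (h1.pow 2).const_mul (-(Real.sqrt 2 / rate / 2) * u ^ 2)
    rwa [one_pow, mul_one] at this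
  have key : Tendsto (fun n : ℕ => (n : ℝ) * (-(Real.sqrt 2 / rate * (1 - Real.cos (u / Real.sqrt n)))))
      atTop (nhds (-(Real.sqrt 2 / rate / 2) * u ^ 2)) := by
    refine h2.congr' ?_
    filter_upwards [eventually_gt_atTop 0] with n hn
    have hs : 0 < Real.sqrt n := Real.sqrt_pos.mpr (by exact_mod_cast hn)
    have hn2 : Real.sqrt n ^ 2 = n := Real.sq_sqrt (Nat.cast_nonneg n)
    have hsin : Real.sin (u / Real.sqrt n / 2) =
        u / Real.sqrt n / 2 * Real.sinc (u / Real.sqrt n / 2) := by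
      by_cases hx : u / Real.sqrt n / 2 = 0
      · rw [hx]; simp
      · rw [Real.sinc_of_ne_zero hx, mul_div_cancel₀ _ hx]
    have hcos : 1 - Real.cos (u / Real.sqrt n) = 2 * Real.sin (u / Real.sqrt n / 2) ^ 2 := by
      rw [Real.sin_sq_eq_half_sub]
      ring_nf
    rw [hcos, hsin]
    generalize Real.sqrt n = r at *
    rw [← hn2]
    generalize Real.sinc (u / r / 2) = s
    field_simp
  have := Real.tendsto_one_add_pow_exp_of_tendsto key
  refine this.congr fun n => ?_
  rw [charFn, ← sub_eq_add_neg]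

/-- Laplace's method for the powers of `charFn`. -/
lemma tendsto_sqrt_mul_integral :
    Tendsto (fun n : ℕ => Real.sqrt n * ∫ θ in (-Real.pi)..Real.pi, charFn θ ^ n * Real.cos θ) atTop
      (nhds (Real.sqrt (Real.pi / (Real.sqrt 2 / rate / 2)))) := by
  have hpi := Real.pi_pos
  have hcont : Continuous charFn := by unfold charFn; fun_prop
  rw [← integral_gaussian]
  have hlim : Tendsto (fun n : ℕ => ∫ u : ℝ, (Set.Ioc (-Real.pi) Real.pi).indicator
      (fun θ => charFn θ ^ n * Real.cos θ) (u / Real.sqrt n)) atTop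
      (nhds (∫ u : ℝ, Real.exp (-(Real.sqrt 2 / rate / 2) * u ^ 2))) := by
    refine MeasureTheory.tendsto_integral_filter_of_dominated_convergence
      (fun u => Real.exp (-(1 / (2 * Real.pi ^ 2)) * u ^ 2)) ?_ ?_ ?_ ?_
    · refine Eventually.of_forall fun n => Measurable.aestronglyMeasurable ?_
      refine Measurable.comp (Measurable.indicator ?_ measurableSet_Ioc) (by fun_prop)
      exact Continuous.measurable (by fun_prop)
    · filter_upwards [eventually_gt_atTop 0] with n hn
      refine Eventually.of_forall fun u => ?_
      have hs : 0 < Real.sqrt n := Real.sqrt_pos.mpr (by exact_mod_cast hn)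
      have hn2 : Real.sqrt n ^ 2 = n := Real.sq_sqrt (Nat.cast_nonneg n)
      by_cases hu : u / Real.sqrt n ∈ Set.Ioc (-Real.pi) Real.pi
      · rw [Set.indicator_of_mem hu, norm_mul, norm_pow, Real.norm_eq_abs, Real.norm_eq_abs]
        have h1 := abs_charFn_le (abs_le.mpr ⟨hu.1.le, hu.2⟩)
        calc _ ≤ |charFn (u / Real.sqrt n)| ^ n * 1 := by
              gcongr
              exact Real.abs_cos_le_one _
          _ ≤ Real.exp (-(1 / (2 * Real.pi ^ 2)) * (u / Real.sqrt n) ^ 2) ^ n := by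
              rw [mul_one]
              gcongr
          _ = _ := by
              rw [← Real.exp_nat_mul, div_pow, hn2]
              congr 1
              have : (n : ℝ) ≠ 0 := by exact_mod_cast hn.ne'
              field_simp
      · rw [Set.indicator_of_notMem hu, norm_zero]
        positivity
    · exact integrable_exp_neg_mul_sq (by positivity)
    · refine Eventually.of_forall fun u => ?_
      have h0 : Tendsto (fun n : ℕ => u / Real.sqrt n) atTop (nhds 0) :=
        tendsto_const_nhds.div_atTop (Real.tendsto_sqrt_atTop.comp tendsto_natCast_atTop_atTop)
      have hc : Tendsto (fun n : ℕ => Real.cos (u / Real.sqrt n)) atTop (nhds 1) := by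
        rw [← Real.cos_zero]
        exact (Real.continuous_cos.tendsto 0).comp h0
      have := (tendsto_charFn_pow u).mul hc
      rw [mul_one] at this
      refine this.congr' ?_
      filter_upwards [h0.eventually (Ioc_mem_nhds (show -Real.pi < 0 by linarith) hpi)] with n hn
      rw [Set.indicator_of_mem (show u / Real.sqrt n ∈ Set.Ioc (-Real.pi) Real.pi from hn)]
  refine hlim.congr fun n => ?_
  rw [MeasureTheory.Measure.integral_comp_div, smul_eq_mul, abs_of_nonneg (Real.sqrt_nonneg _),
    MeasureTheory.integral_indicator measurableSet_Ioc,
    intervalIntegral.integral_of_le (by linarith)]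

lemma integral_cos_int_mul (k : ℤ) :
    ∫ θ in (-Real.pi)..Real.pi, Real.cos (k * θ) = if k = 0 then 2 * Real.pi else 0 := by
  split_ifs with h
  · simp [h]
    ring
  · have : (k : ℝ) ≠ 0 := by exact_mod_cast h
    rw [intervalIntegral.integral_comp_mul_left _ this, integral_cos, mul_neg, Real.sin_neg,
      Real.sin_int_mul_pi]
    simp

variable {n : ℕ}

lemma prod_weight (x : Cube n) :
    ∏ i, (if x i = 0 then (1 : ℝ) else 1 / 2) = (1 / 2 : ℝ) ^ (cnt x 1 + cnt x 2) := by
  rw [Finset.prod_ite, Finset.prod_const_one, one_mul, Finset.prod_const]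
  congr 1
  have h1 := cnt_add x
  have h2 := Finset.card_filter_add_card_filter_not (s := (Finset.univ : Finset (Fin n))) (fun i => x i = 0)
  rw [Finset.card_univ, Fintype.card_fin] at h2
  unfold cnt at *
  omega

lemma sum_weight_mul_cos (θ : ℝ) :
    ∑ x : Cube n, (1 / 2 : ℝ) ^ (cnt x 1 + cnt x 2) * Real.sqrt 2 ^ rk x *
      Real.cos (((rk x : ℤ) - (n + 1) : ℤ) * θ)
      = Real.sqrt 2 ^ n * (rate ^ n * (charFn θ ^ n * Real.cos θ)) := by
  obtain ⟨z, hz⟩ : ∃ z : ℂ, z = Complex.exp (θ * Complex.I) := ⟨_, rfl⟩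
  have hz0 : z ≠ 0 := hz ▸ Complex.exp_ne_zero _
  have hs : (Real.sqrt 2 : ℂ) ^ 2 = 2 := by
    rw [sq, ← Complex.ofReal_mul, sqrt_two_sq]
    simp
  have hzc : z ^ 2 + 1 = 2 * Complex.cos θ * z := by
    rw [Complex.cos, neg_mul, Complex.exp_neg, ← hz]
    field_simp
  have hbase : ∑ c : Fin 3, (((if c = 0 then (1 : ℝ) else 1 / 2 : ℝ) : ℂ) *
      (Real.sqrt 2 * z) ^ (c : ℕ)) = Real.sqrt 2 * z * ((rate * charFn θ : ℝ) : ℂ) := by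
    rw [rate_mul_charFn, Fin.sum_univ_three]
    simp
    linear_combination (z ^ 2 / 2 - z * Complex.cos θ) * hs + hzc
  have hpow := congrArg (· ^ n) hbase
  simp only [Fintype.sum_pow, Finset.prod_mul_distrib, Finset.prod_pow_eq_pow_sum] at hpow
  have hre := congrArg (fun w : ℂ => (w * (z⁻¹) ^ (n + 1)).re) hpow
  simp only [Finset.sum_mul, Complex.re_sum] at hre
  have hterm : ∀ k : ℕ, (z ^ k * (z⁻¹) ^ (n + 1)).re = Real.cos (((k : ℤ) - (n + 1) : ℤ) * θ) := by
    intro k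
    rw [hz, ← Complex.exp_neg, ← Complex.exp_nat_mul, ← Complex.exp_nat_mul, ← Complex.exp_add,
      ← Complex.exp_ofReal_mul_I_re]
    congr 2
    push_cast
    ring
  convert hre using 1
  · refine Finset.sum_congr rfl fun x _ => ?_
    rw [← prod_weight, ← hterm, mul_pow, ← Complex.re_ofReal_mul]
    congr 1
    push_cast [rk]
    ring
  · have h1 := hterm n
    rw [show (((n : ℤ) - (n + 1) : ℤ) : ℝ) * θ = -θ by push_cast; ring, Real.cos_neg] at h1
    rw [← h1, show Real.sqrt 2 ^ n * (rate ^ n * (charFn θ ^ n * (z ^ n * (z⁻¹) ^ (n + 1)).re))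
      = (Real.sqrt 2 * (rate * charFn θ)) ^ n * (z ^ n * (z⁻¹) ^ (n + 1)).re by ring,
      ← Complex.re_ofReal_mul]
    congr 1
    push_cast
    ring

lemma layerWeight_eq : layerWeight n = (Real.sqrt 2)⁻¹ * (2 * Real.pi)⁻¹ * rate ^ n *
    ∫ θ in (-Real.pi)..Real.pi, charFn θ ^ n * Real.cos θ := by
  have hcont : Continuous charFn := by unfold charFn; fun_prop
  have h := intervalIntegral.integral_congr (a := -Real.pi) (b := Real.pi) (μ := MeasureTheory.volume)
    (fun θ _ => sum_weight_mul_cos (n := n) θ)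
  rw [intervalIntegral.integral_const_mul, intervalIntegral.integral_const_mul,
    intervalIntegral.integral_finsetSum
      (fun x _ => Continuous.intervalIntegrable (by fun_prop) _ _)] at h
  simp only [intervalIntegral.integral_const_mul, integral_cos_int_mul] at h
  have h2 : ∑ x : Cube n, (1 / 2 : ℝ) ^ (cnt x 1 + cnt x 2) * Real.sqrt 2 ^ rk x *
      (if (rk x : ℤ) - (n + 1) = 0 then 2 * Real.pi else 0)
      = layerWeight n * (Real.sqrt 2 ^ (n + 1) * (2 * Real.pi)) := by
    have hp : ∀ x : Cube n, x ∈ Finset.univ.filter (fun x => rk x = n + 1) ↔ rk x = n + 1 := by simp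
    rw [layerWeight, Finset.sum_mul, ← Finset.sum_subtype _ hp fun x : Cube n =>
      (1 / 2 : ℝ) ^ (cnt x 1 + cnt x 2) * (Real.sqrt 2 ^ (n + 1) * (2 * Real.pi)), Finset.sum_filter]
    refine Finset.sum_congr rfl fun x _ => ?_
    by_cases hx : rk x = n + 1
    · rw [if_pos (by omega), if_pos hx, hx]
      ring
    · rw [if_neg (by omega), if_neg hx, mul_zero]
  rw [h2] at h
  have hpi := Real.pi_pos
  have h3 : 0 < Real.sqrt 2 := by positivity
  rw [pow_succ] at h
  field_simp
  have h4 : 0 < Real.sqrt 2 ^ n := by positivity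
  apply mul_left_cancel₀ h4.ne'
  linarith

theorem tendsto_layerWeight :
    Tendsto (fun n : ℕ => 2 * layerWeight n /
        (Real.sqrt ((1 + 2 * Real.sqrt 2) / (2 * Real.sqrt 2 * Real.pi)) *
          (n : ℝ) ^ (-(1 / 2 : ℝ)) * ((1 + 2 * Real.sqrt 2) / 2) ^ n))
      atTop (nhds 1) := by
  have hpi := Real.pi_pos
  have hr := rate_pos
  have h2 : 0 < Real.sqrt 2 := by positivity
  obtain ⟨C, hC⟩ : ∃ C, C = Real.sqrt ((1 + 2 * Real.sqrt 2) / (2 * Real.sqrt 2 * Real.pi)) := ⟨_, rfl⟩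
  have hC0 : 0 < C := by rw [hC]; positivity
  have hconst : 2 * ((Real.sqrt 2)⁻¹ * (2 * Real.pi)⁻¹) *
      Real.sqrt (Real.pi / (Real.sqrt 2 / rate / 2)) = C := by
    rw [hC, eq_comm, Real.sqrt_eq_iff_mul_self_eq_of_pos (by positivity)]
    have := Real.mul_self_sqrt (show 0 ≤ Real.pi / (Real.sqrt 2 / rate / 2) by positivity)
    rw [mul_mul_mul_comm, this, rate]
    field_simp
    linear_combination -sqrt_two_sq
  have h := tendsto_sqrt_mul_integral.const_mul (2 * ((Real.sqrt 2)⁻¹ * (2 * Real.pi)⁻¹) / C)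
  rw [div_mul_eq_mul_div, hconst, div_self hC0.ne'] at h
  refine h.congr' ?_
  filter_upwards [eventually_gt_atTop 0] with n hn
  have hn0 : (0 : ℝ) < n := by exact_mod_cast hn
  have hs : 0 < Real.sqrt n := Real.sqrt_pos.mpr hn0
  rw [← hC, layerWeight_eq, Real.rpow_neg hn0.le, ← Real.sqrt_eq_rpow,
    show (1 + 2 * Real.sqrt 2) / 2 = rate from rfl]
  have hrn : 0 < rate ^ n := by positivity
  field_simp

end Laplace

lemma card_highAC_zero (n : ℕ) : (highAC n 0).card = alphaT 3 n := by
  classical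
  rw [alphaT, Nat.card_eq_fintype_card, Fintype.card_subtype]
  congr 1
  ext A
  rw [mem_highAC]
  simp

lemma card_lay_self (n : ℕ) : Fintype.card (Lay n n) = midLayer3 n := by
  rw [midLayer3]
  rfl

lemma half_rpow_mul_natCast (c : ℝ) (n : ℕ) : (1 / 2 : ℝ) ^ (c * n) = ((1 / 2 : ℝ) ^ c) ^ n :=
  Real.rpow_mul_natCast (by norm_num) _ _

lemma half_rpow_half_lt_one : (1 / 2 : ℝ) ^ (1 / 2 : ℝ) < 1 :=
  Real.rpow_lt_one (by norm_num) (by norm_num) (by norm_num)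

lemma tendsto_half_rpow_half : Tendsto (fun n : ℕ => (1 / 2 : ℝ) ^ ((n : ℝ) / 2)) atTop (nhds 0) := by
  refine (tendsto_pow_atTop_nhds_zero_of_lt_one (by positivity) half_rpow_half_lt_one).congr
    fun n => ?_
  rw [← half_rpow_mul_natCast]
  congr 1
  ring

lemma tendsto_gap : Tendsto gap atTop (nhds 0) := by
  have h := tendsto_pow_const_mul_const_pow_of_abs_lt_one 2
    (show |(1 / 2 : ℝ) ^ (1 / 2 : ℝ)| < 1 by
      rw [abs_of_pos (by positivity)]; exact half_rpow_half_lt_one)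
  refine h.congr fun n => ?_
  rw [gap, ← half_rpow_mul_natCast]
  congr 2
  ring

lemma three_mul_half_rpow_lt_rate : 3 * (1 / 2 : ℝ) ^ (3 / 4 : ℝ) < rate := by
  refine lt_trans ?_ rate_gt
  refine lt_of_pow_lt_pow_left₀ 4 (by norm_num) ?_
  rw [mul_pow, ← half_rpow_mul_natCast]
  norm_num

lemma log_card_antichains_le {n : ℕ} (ha : Admissible n) :
    Real.log ((highAC n 0).card / 2 ^ Fintype.card (Lay n n)) ≤
      2 * ((1 + 4 / (n : ℝ) ^ 2) * layerWeight n + 3 ^ n * (1 / 2 : ℝ) ^ (3 * (n : ℝ) / 4)) := by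
  have hpos : 0 < (highAC n 0).card := Finset.card_pos.mpr ⟨∅, by rw [mem_highAC]; simp⟩
  have hpos' : (0 : ℝ) < (highAC n 0).card := by exact_mod_cast hpos
  have hz : 0 ≤ upperZ n := by unfold upperZ; positivity
  rw [Real.log_le_iff_le_exp (by positivity), div_le_iff₀ (by positivity), two_mul, Real.exp_add,
    ← sq, mul_comm]
  refine card_antichains_le.trans ?_
  gcongr
  exact upperZ_le ha

/-- The asymptotic value of the logarithm of the normalised number of antichains. -/
noncomputable def mainTerm (n : ℕ) : ℝ :=
  Real.sqrt ((1 + 2 * Real.sqrt 2) / (2 * Real.sqrt 2 * Real.pi)) *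
    (n : ℝ) ^ (-(1 / 2 : ℝ)) * ((1 + 2 * Real.sqrt 2) / 2) ^ n

lemma mainTerm_nonneg (n : ℕ) : 0 ≤ mainTerm n := by unfold mainTerm; positivity

lemma tendsto_error_div_mainTerm :
    Tendsto (fun n : ℕ => 2 * (3 ^ n * (1 / 2 : ℝ) ^ (3 * (n : ℝ) / 4)) / mainTerm n)
      atTop (nhds 0) := by
  obtain ⟨C, hC⟩ : ∃ C, C = Real.sqrt ((1 + 2 * Real.sqrt 2) / (2 * Real.sqrt 2 * Real.pi)) :=
    ⟨_, rfl⟩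
  have hC0 : 0 < C := by rw [hC]; have := Real.pi_pos; positivity
  have hr := rate_pos
  have h := (tendsto_self_mul_const_pow_of_lt_one
    (show 0 ≤ 3 * (1 / 2 : ℝ) ^ (3 / 4 : ℝ) / rate by positivity)
    ((div_lt_one hr).mpr three_mul_half_rpow_lt_rate)).const_mul (2 / C)
  rw [mul_zero] at h
  refine squeeze_zero' (Eventually.of_forall fun n => ?_) ?_ h
  · have := mainTerm_nonneg n
    positivity
  · filter_upwards [eventually_gt_atTop 0] with n hn
    have hn1 : (1 : ℝ) ≤ n := by exact_mod_cast hn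
    have hsq : Real.sqrt n ≤ n := by
      rw [Real.sqrt_le_left (by linarith)]
      exact le_self_pow₀ hn1 two_ne_zero
    have hs : 0 < Real.sqrt n := Real.sqrt_pos.mpr (by linarith)
    rw [mainTerm, ← hC, Real.rpow_neg (by linarith), ← Real.sqrt_eq_rpow,
      show (1 + 2 * Real.sqrt 2) / 2 = rate from rfl,
      show 3 * (n : ℝ) / 4 = 3 / 4 * n by ring, half_rpow_mul_natCast, div_pow, mul_pow]
    calc _ = 2 / C * (Real.sqrt n * (3 ^ n * ((1 / 2 : ℝ) ^ (3 / 4 : ℝ)) ^ n / rate ^ n)) := by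
          field_simp
      _ ≤ _ := by gcongr

end AntichainCount

open AntichainCount

/-- The Jenssen–Park–Sarantis theorem: sharp asymptotics for the number of antichains
in `[3]^n`. -/
theorem stmt17 :
    Tendsto (fun n : ℕ =>
      Real.log ((alphaT 3 n : ℝ) / (2 : ℝ) ^ (midLayer3 n)) /
        (Real.sqrt ((1 + 2 * Real.sqrt 2) / (2 * Real.sqrt 2 * Real.pi)) *
          (n : ℝ) ^ (-(1 / 2 : ℝ)) * ((1 + 2 * Real.sqrt 2) / 2) ^ n))
      atTop (nhds 1) := by
  have hW : Tendsto (fun n : ℕ => 2 * layerWeight n / mainTerm n) atTop (nhds 1) :=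
    tendsto_layerWeight
  have hlow : Tendsto (fun n : ℕ => (1 - (1 / 2 : ℝ) ^ ((n : ℝ) / 2)) *
      (1 + Real.exp (-gap n)) / 2 * (2 * layerWeight n / mainTerm n)) atTop (nhds 1) := by
    have h1 : Tendsto (fun n => Real.exp (-gap n)) atTop (nhds (Real.exp (-0))) :=
      (Real.continuous_exp.tendsto _).comp tendsto_gap.neg
    have := ((((tendsto_half_rpow_half.const_sub 1).mul (h1.const_add 1)).div_const 2).mul hW)
    norm_num at this
    convert this using 1
  have hup : Tendsto (fun n : ℕ => (1 + 4 / (n : ℝ) ^ 2) * (2 * layerWeight n / mainTerm n) +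
      2 * (3 ^ n * (1 / 2 : ℝ) ^ (3 * (n : ℝ) / 4)) / mainTerm n) atTop (nhds 1) := by
    have h1 : Tendsto (fun n : ℕ => 4 / (n : ℝ) ^ 2) atTop (nhds 0) :=
      tendsto_const_nhds.div_atTop
        ((tendsto_pow_atTop two_ne_zero).comp tendsto_natCast_atTop_atTop)
    have := ((h1.const_add 1).mul hW).add tendsto_error_div_mainTerm
    rwa [add_zero, add_zero, mul_one] at this
  refine tendsto_of_tendsto_of_tendsto_of_le_of_le' hlow hup (Eventually.of_forall fun n => ?_) ?_
  · rw [← card_highAC_zero, ← card_lay_self]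
    calc _ = (1 - (1 / 2 : ℝ) ^ ((n : ℝ) / 2)) * (1 + Real.exp (-gap n)) * layerWeight n /
          mainTerm n := by ring
      _ ≤ _ := div_le_div_of_nonneg_right le_log_card_antichains (mainTerm_nonneg n)
  · filter_upwards [eventually_admissible] with n ha
    rw [← card_highAC_zero, ← card_lay_self]
    refine (div_le_div_of_nonneg_right (log_card_antichains_le ha) (mainTerm_nonneg n)).trans_eq ?_
    ring
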